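/- arXiv:1411.2069 — 5 statements merged into one kernel-verified Lean document; each statement's English description precedes it below -/
import Mathlib

section
/- Let G be a graph and v a node of G such that G - v is bipartite. Then the stable set polytope of G equals the intersection of the edge relaxation of G with all odd-cycle inequalities of G; that is, STAB(G) is defined by nonnegativity, edge, and odd-cycle constraints. -/
/-- A set of vertices is stable (independent) in `G`. -/
def IsStable {V : Type*} (G : SimpleGraph V) (S : Set V) : Prop :=
  ∀ u ∈ S, ∀ v ∈ S, ¬ G.Adj u v

/-- The stable set polytope: convex hull of characteristic vectors of stable sets. -/
noncomputable def STAB {V : Type*} (G : SimpleGraph V) : Set (V → ℝ) :=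
  convexHull ℝ {x | ∃ S : Set V, IsStable G S ∧ x = S.indicator 1}

open MeasureTheory in
/-- A family of subsets of `(0,1]` with measures `x u`, disjoint along edges, certifies
membership in the stable set polytope. -/
lemma stab_of_sets {V : Type*} [Fintype V] (G : SimpleGraph V) (x : V → ℝ) (A : V → Set ℝ)
    (hm : ∀ u, MeasurableSet (A u)) (hs : ∀ u, A u ⊆ Set.Ioc 0 1)
    (hv : ∀ u, volume.real (A u) = x u)
    (hd : ∀ u w, G.Adj u w → Disjoint (A u) (A w)) : x ∈ STAB G := by
  classical
  set μ : Measure ℝ := volume.restrict (Set.Ioc (0:ℝ) 1) with hμ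
  have : IsProbabilityMeasure μ := ⟨by simp [hμ]⟩
  let f : ℝ → V → ℝ := fun θ u => (A u).indicator 1 θ
  have hfi : ∀ u, Integrable (fun θ => f θ u) μ := fun u =>
    (integrable_const (1:ℝ)).indicator (hm u)
  have hint : Integrable f μ := Integrable.of_eval hfi
  have hfin : Set.Finite {x : V → ℝ | ∃ S : Set V, IsStable G S ∧ x = S.indicator 1} := by
    refine (Set.finite_range (fun S : Set V => (S.indicator 1 : V → ℝ))).subset ?_
    rintro _ ⟨S, _, rfl⟩
    exact ⟨S, rfl⟩
  have hmem : ∫ θ, f θ ∂μ ∈ STAB G := by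
    refine (convex_convexHull ℝ _).integral_mem (hfin.isCompact_convexHull ℝ).isClosed ?_ hint
    refine Filter.Eventually.of_forall fun θ => subset_convexHull ℝ _ ?_
    refine ⟨{u | θ ∈ A u}, fun u hu w hw h => Set.disjoint_left.1 (hd u w h) hu hw, ?_⟩
    funext u
    by_cases h : θ ∈ A u <;> simp [f, h]
  have : ∫ θ, f θ ∂μ = x := by
    funext u
    rw [eval_integral hfi]
    change ∫ θ, (A u).indicator 1 θ ∂μ = x u
    rw [integral_indicator_one (hm u), ← hv u, hμ, measureReal_restrict_apply (hm u),
      Set.inter_eq_left.2 (hs u)]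
  exact this ▸ hmem

lemma walk_sum_le {V : Type*} (G : SimpleGraph V) (x : V → ℝ)
    (hx : ∀ u w, G.Adj u w → x u + x w ≤ 1) {u w : V} (p : G.Walk u w) :
    2 * (p.support.map x).sum - x u - x w ≤ p.length := by
  induction p with
  | nil => simp; linarith
  | cons h p ih =>
    have := hx _ _ h
    simp only [SimpleGraph.Walk.support_cons, List.map_cons, List.sum_cons,
      SimpleGraph.Walk.length_cons]
    push_cast
    linarith

lemma cycle_support {V : Type*} [DecidableEq V] (G : SimpleGraph V) (x : V → ℝ)
    {u : V} (c : G.Walk u u) (hc : c.IsCycle) :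
    ∑ w ∈ c.support.toFinset, x w = (c.support.map x).sum - x u := by
  have h1 : c.support = u :: c.support.tail := c.cons_tail_support.symm
  have h2 : u ∈ c.support.tail := SimpleGraph.Walk.end_mem_tail_support hc.not_nil
  have h3 : c.support.toFinset = c.support.tail.toFinset := by
    generalize c.support.tail = l at h1 h2
    rw [h1, List.toFinset_cons, Finset.insert_eq_of_mem (List.mem_toFinset.2 h2)]
  have h4 : (c.support.map x).sum = x u + (c.support.tail.map x).sum := by
    generalize c.support.tail = l at h1
    rw [h1, List.map_cons, List.sum_cons]
  rw [h3, List.sum_toFinset _ hc.support_nodup, h4]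
  ring

lemma stab_easy {V : Type*} [Fintype V] [DecidableEq V] (G : SimpleGraph V) :
    STAB G ⊆ {x | (∀ u, 0 ≤ x u ∧ x u ≤ 1) ∧
      (∀ u w, G.Adj u w → x u + x w ≤ 1) ∧
      (∀ (u : V) (c : G.Walk u u), c.IsCycle → Odd c.length →
        ∑ w ∈ c.support.toFinset, x w ≤ ((c.length - 1 : ℕ) : ℝ) / 2)} := by
  classical
  refine convexHull_min ?_ ?_
  · rintro _ ⟨S, hS, rfl⟩
    have hedge : ∀ u w, G.Adj u w → (S.indicator 1 u : ℝ) + S.indicator 1 w ≤ 1 := by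
      intro u w h
      by_cases hu : u ∈ S <;> by_cases hw : w ∈ S <;> simp [hu, hw]
      exact (hS u hu w hw h).elim
    refine ⟨fun u => ?_, hedge, ?_⟩
    · by_cases hu : u ∈ S <;> simp [hu]
    · intro u c hc hodd
      have h1 := walk_sum_le G _ hedge c
      have h2 := cycle_support G (S.indicator 1 : V → ℝ) c hc
      have h3 : ∑ w ∈ c.support.toFinset, (S.indicator 1 w : ℝ)
          = ((c.support.toFinset.filter (· ∈ S)).card : ℝ) := by
        rw [Finset.card_filter]
        push_cast
        refine Finset.sum_congr rfl fun w _ => ?_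
        simp [Set.indicator_apply]
      have h4 : 2 * ((c.support.toFinset.filter (· ∈ S)).card : ℝ) ≤ c.length := by
        rw [← h3, h2]; linarith
      have h5 : 2 * (c.support.toFinset.filter (· ∈ S)).card ≤ c.length := by exact_mod_cast h4
      have h6 : 2 * (c.support.toFinset.filter (· ∈ S)).card ≤ c.length - 1 := by
        obtain ⟨k, hk⟩ := hodd
        omega
      have h7 : 2 * ((c.support.toFinset.filter (· ∈ S)).card : ℝ) ≤ ((c.length - 1 : ℕ) : ℝ) := by
        exact_mod_cast h6
      rw [h3]; linarith
  · rintro x ⟨hx1, hx2, hx3⟩ y ⟨hy1, hy2, hy3⟩ a b ha hb hab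
    refine ⟨fun u => ⟨?_, ?_⟩, fun u w h => ?_, fun u c hc ho => ?_⟩
    · have := mul_nonneg ha (hx1 u).1
      have := mul_nonneg hb (hy1 u).1
      simp; linarith
    · have := mul_le_mul_of_nonneg_left (hx1 u).2 ha
      have := mul_le_mul_of_nonneg_left (hy1 u).2 hb
      simp; linarith
    · have := mul_le_mul_of_nonneg_left (hx2 u w h) ha
      have := mul_le_mul_of_nonneg_left (hy2 u w h) hb
      simp; linarith
    · have h1 := mul_le_mul_of_nonneg_left (hx3 u c hc ho) ha
      have h2 := mul_le_mul_of_nonneg_left (hy3 u c hc ho) hb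
      simp only [Pi.add_apply, Pi.smul_apply, smul_eq_mul, Finset.sum_add_distrib,
        ← Finset.mul_sum]
      calc _ ≤ _ := add_le_add h1 h2
        _ = _ := by rw [← add_mul, hab, one_mul]

/-- The dart cost. -/
noncomputable def dcost {V : Type*} (H : SimpleGraph V) (x : V → ℝ) (col : V → Bool)
    (d : H.Dart) : ℝ := if col d.fst = true then 1 - x d.fst - x d.snd else 0

/-- The cost of a walk. -/
noncomputable def wcost {V : Type*} (H : SimpleGraph V) (x : V → ℝ) (col : V → Bool)
    {u w : V} (p : H.Walk u w) : ℝ := (p.darts.map (dcost H x col)).sum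

lemma dcost_nonneg {V : Type*} (H : SimpleGraph V) (x : V → ℝ) (col : V → Bool)
    (hx : ∀ u w, H.Adj u w → x u + x w ≤ 1) (d : H.Dart) : 0 ≤ dcost H x col d := by
  have := hx _ _ d.adj
  unfold dcost
  split_ifs <;> linarith

lemma wcost_nonneg {V : Type*} (H : SimpleGraph V) (x : V → ℝ) (col : V → Bool)
    (hx : ∀ u w, H.Adj u w → x u + x w ≤ 1) {u w : V} (p : H.Walk u w) :
    0 ≤ wcost H x col p := by
  refine List.sum_nonneg fun r hr => ?_
  obtain ⟨d, _, rfl⟩ := List.mem_map.1 hr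
  exact dcost_nonneg H x col hx d

lemma wcost_bypass {V : Type*} [DecidableEq V] (H : SimpleGraph V) (x : V → ℝ) (col : V → Bool)
    (hx : ∀ u w, H.Adj u w → x u + x w ≤ 1) {u w : V} (p : H.Walk u w) :
    wcost H x col p.bypass ≤ wcost H x col p := by
  have hnd : p.bypass.darts.Nodup :=
    SimpleGraph.Walk.darts_nodup_of_support_nodup p.bypass_isPath.support_nodup
  have hsub : p.bypass.darts.Subperm p.darts :=
    hnd.subperm (SimpleGraph.Walk.darts_bypass_subset_darts p)
  obtain ⟨l, hl, hl2⟩ := hsub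
  unfold wcost
  rw [← (hl.map (dcost H x col)).sum_eq]
  refine (hl2.map (dcost H x col)).sum_le_sum ?_
  intro r hr
  obtain ⟨d, _, rfl⟩ := List.mem_map.1 hr
  exact dcost_nonneg H x col hx d

lemma wcost_formula {V : Type*} (H : SimpleGraph V) (x : V → ℝ) (col : V → Bool)
    (hcol : ∀ u w, H.Adj u w → col u ≠ col w) {u w : V} (p : H.Walk u w) (hw : col w = false) :
    (col u = true → Odd p.length ∧
      wcost H x col p = ((p.length : ℝ) + 1) / 2 - (p.support.map x).sum) ∧
    (col u = false → Even p.length ∧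
      wcost H x col p = (p.length : ℝ) / 2 - (p.support.map x).sum + x u) := by
  induction p with
  | nil => simp [hw, wcost]
  | @cons u u' w h p ih =>
    have hne := hcol _ _ h
    obtain ⟨ih1, ih2⟩ := ih hw
    have hc : wcost H x col (SimpleGraph.Walk.cons h p)
      = (if col u = true then 1 - x u - x u' else 0) + wcost H x col p := by
      simp [wcost, dcost]
    constructor
    · intro hu
      have hu' : col u' = false := by
        cases h' : col u' <;> simp_all
      obtain ⟨e, f⟩ := ih2 hu'
      refine ⟨by simpa using e.add_one, ?_⟩
      rw [hc, f, if_pos hu]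
      simp
      ring
    · intro hu
      have hu' : col u' = true := by
        cases h' : col u' <;> simp_all
      obtain ⟨e, f⟩ := ih1 hu'
      refine ⟨by simpa using e.add_one, ?_⟩
      rw [hc, f]
      simp [hu]
      ring

/-- The graph `G - v`, on the same vertex set. -/
def delV {V : Type*} (G : SimpleGraph V) (v : V) : SimpleGraph V where
  Adj u w := G.Adj u w ∧ u ≠ v ∧ w ≠ v
  symm := ⟨fun _ _ h => ⟨h.1.symm, h.2.2, h.2.1⟩⟩
  loopless := ⟨fun _ h => h.1.ne rfl⟩

lemma delV_support {V : Type*} (G : SimpleGraph V) (v : V) {u w : V}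
    (p : (delV G v).Walk u w) (hu : u ≠ v) : v ∉ p.support := by
  induction p with
  | nil => simpa using hu.symm
  | cons h p ih =>
    simp only [SimpleGraph.Walk.support_cons, List.mem_cons, not_or]
    exact ⟨hu.symm, ih h.2.2⟩

lemma cost_ge {V : Type*} [DecidableEq V] (G : SimpleGraph V) (v : V) (x : V → ℝ)
    (col : V → Bool) (hcol : ∀ u w, (delV G v).Adj u w → col u ≠ col w)
    (hx : ∀ u w, G.Adj u w → x u + x w ≤ 1)
    (hodd : ∀ (u : V) (c : G.Walk u u), c.IsCycle → Odd c.length →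
        ∑ w ∈ c.support.toFinset, x w ≤ ((c.length - 1 : ℕ) : ℝ) / 2)
    {a b : V} (p : (delV G v).Walk a b) (ha : G.Adj v a) (hb : G.Adj v b)
    (ca : col a = true) (cb : col b = false) : x v ≤ wcost (delV G v) x col p := by
  have hle : delV G v ≤ G := fun _ _ h => h.1
  refine le_trans ?_ (wcost_bypass (delV G v) x col (fun u w h => hx u w h.1) p)
  have hq := p.bypass_isPath
  generalize p.bypass = q at hq
  obtain ⟨ho, hc⟩ := (wcost_formula _ x col hcol q cb).1 ca
  have hv : v ∉ (q.mapLe hle).support := by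
    simpa using delV_support G v q ha.ne'
  have hP : ((q.mapLe hle).concat hb.symm).IsPath :=
    ((SimpleGraph.Walk.isPath_mapLe hle).2 hq).concat hv hb.symm
  have hab : a ≠ b := by rintro rfl; simp [ca] at cb
  have hC : (SimpleGraph.Walk.cons ha ((q.mapLe hle).concat hb.symm)).IsCycle := by
    rw [SimpleGraph.Walk.cons_isCycle_iff]
    refine ⟨hP, ?_⟩
    rw [SimpleGraph.Walk.edges_concat]
    simp only [List.concat_eq_append, List.mem_append, List.mem_singleton, not_or]
    refine ⟨fun h => hv (SimpleGraph.Walk.fst_mem_support_of_mem_edges _ h), ?_⟩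
    intro h
    rw [Sym2.eq_swap, Sym2.congr_left] at h
    exact hab h
  have h1 := hodd v _ hC (by
    simp only [SimpleGraph.Walk.length_cons, SimpleGraph.Walk.length_concat,
      SimpleGraph.Walk.length_map]
    exact ho.add_one.add_one)
  rw [cycle_support G x _ hC] at h1
  simp [SimpleGraph.Walk.support_concat] at h1
  rw [hc]
  linarith

/-- Truncated distance from the neighbours of `v` in the first colour class. -/
noncomputable def dst {V : Type*} (G : SimpleGraph V) (v : V) (x : V → ℝ)
    (col : V → Bool) (u : V) : ℝ :=
  sInf (insert (x v) {r | ∃ a, ∃ p : (delV G v).Walk a u, G.Adj v a ∧ col a = true ∧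
    r = wcost (delV G v) x col p})

lemma dst_step {V : Type*} (G : SimpleGraph V) (v : V) (x : V → ℝ)
    (col : V → Bool) (hx : ∀ u w, G.Adj u w → x u + x w ≤ 1) (hv : 0 ≤ x v)
    {u w : V} (h : (delV G v).Adj u w) :
    dst G v x col w ≤ dst G v x col u + (if col u = true then 1 - x u - x w else 0) := by
  have hx' : ∀ u w, (delV G v).Adj u w → x u + x w ≤ 1 := fun u w h => hx u w h.1
  have hbdd : BddBelow (insert (x v) {r | ∃ a, ∃ p : (delV G v).Walk a w, G.Adj v a ∧
      col a = true ∧ r = wcost (delV G v) x col p}) := by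
    refine ⟨0, ?_⟩
    rintro r (rfl | ⟨a, p, _, _, rfl⟩)
    · exact hv
    · exact wcost_nonneg _ x col hx' p
  have hc := dcost_nonneg (delV G v) x col hx' ⟨(u, w), h⟩
  simp only [dcost] at hc
  rw [← sub_le_iff_le_add]
  refine le_csInf (Set.insert_nonempty _ _) ?_
  rintro r (rfl | ⟨a, p, h1, h2, rfl⟩)
  · rw [sub_le_iff_le_add]
    refine (csInf_le hbdd (Set.mem_insert _ _)).trans (by linarith)
  · rw [sub_le_iff_le_add]
    refine csInf_le hbdd (Set.mem_insert_of_mem _ ⟨a, p.concat h, h1, h2, ?_⟩)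
    simp [wcost, dcost, SimpleGraph.Walk.darts_concat]

lemma dst_source {V : Type*} (G : SimpleGraph V) (v : V) (x : V → ℝ)
    (col : V → Bool) (hx : ∀ u w, G.Adj u w → x u + x w ≤ 1) (hv : 0 ≤ x v)
    {a : V} (h : G.Adj v a) (ca : col a = true) : dst G v x col a ≤ 0 := by
  have hx' : ∀ u w, (delV G v).Adj u w → x u + x w ≤ 1 := fun u w h => hx u w h.1
  refine csInf_le ⟨0, ?_⟩ (Set.mem_insert_of_mem _ ⟨a, SimpleGraph.Walk.nil, h, ca, ?_⟩)
  · rintro r (rfl | ⟨a, p, _, _, rfl⟩)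
    · exact hv
    · exact wcost_nonneg _ x col hx' p
  · simp [wcost]

/-- The potential. -/
noncomputable def pot {V : Type*} (G : SimpleGraph V) (v : V) (x : V → ℝ)
    (col : V → Bool) (u : V) : ℝ :=
  if col u = true then
    max (max 0 (x u - 1 + x v)) (min (min (x u) (x v)) (dst G v x col u))
  else
    max (max 0 (x v - x u)) (min (min (x v) (1 - x u)) (dst G v x col u))

lemma exists_pot {V : Type*} [DecidableEq V] (G : SimpleGraph V) (v : V) (x : V → ℝ)
    (col : V → Bool) (hcol : ∀ u w, (delV G v).Adj u w → col u ≠ col w)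
    (hbd : ∀ u, 0 ≤ x u ∧ x u ≤ 1)
    (hx : ∀ u w, G.Adj u w → x u + x w ≤ 1)
    (hodd : ∀ (u : V) (c : G.Walk u u), c.IsCycle → Odd c.length →
        ∑ w ∈ c.support.toFinset, x w ≤ ((c.length - 1 : ℕ) : ℝ) / 2) :
    ∃ t : V → ℝ,
      (∀ a, col a = true → 0 ≤ t a ∧ x a - 1 + x v ≤ t a ∧ t a ≤ x a ∧ t a ≤ x v) ∧
      (∀ b, col b = false → 0 ≤ t b ∧ x v - x b ≤ t b ∧ t b ≤ x v ∧ t b ≤ 1 - x b) ∧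
      (∀ a, col a = true → G.Adj v a → t a = 0) ∧
      (∀ b, col b = false → G.Adj v b → t b = x v) ∧
      (∀ a b, col a = true → col b = false → (delV G v).Adj a b →
        t a ≤ t b ∧ t b ≤ t a + (1 - x a - x b)) := by
  have hv := hbd v
  refine ⟨pot G v x col, ?_, ?_, ?_, ?_, ?_⟩
  · intro a ca
    have ha := hbd a
    simp only [pot, ca, if_true]
    refine ⟨?_, ?_, ?_, ?_⟩
    · simp
    · simp
    · refine max_le (max_le ?_ ?_) ((min_le_left _ _).trans (min_le_left _ _)) <;> linarith
    · refine max_le (max_le ?_ ?_) ((min_le_left _ _).trans (min_le_right _ _)) <;> linarith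
  · intro b cb
    have hb := hbd b
    simp only [pot, cb]
    refine ⟨?_, ?_, ?_, ?_⟩
    · simp
    · simp
    · refine max_le (max_le ?_ ?_) ((min_le_left _ _).trans (min_le_left _ _)) <;> linarith
    · refine max_le (max_le ?_ ?_) ((min_le_left _ _).trans (min_le_right _ _)) <;> linarith
  · intro a ca h
    have := hx _ _ h
    have h1 := dst_source G v x col hx hv.1 h ca
    simp only [pot, ca, if_true]
    rw [max_eq_left (by linarith : x a - 1 + x v ≤ 0),
      max_eq_left ((min_le_right _ _).trans h1)]
  · intro b cb h
    have := hx _ _ h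
    have hb := hbd b
    have h1 : x v ≤ dst G v x col b := by
      refine le_csInf (Set.insert_nonempty _ _) ?_
      rintro r (rfl | ⟨a, p, h1, h2, rfl⟩)
      · exact le_rfl
      · exact cost_ge G v x col hcol hx hodd p h1 h h2 cb
    simp only [pot, cb]
    rw [min_eq_left (by linarith : x v ≤ 1 - x b), min_eq_left h1]
    exact max_eq_right (max_le hv.1 (by linarith))
  · intro a b ca cb h
    have h1 := dst_step G v x col hx hv.1 h
    have h2 := dst_step G v x col hx hv.1 h.symm
    have h3 := hx _ _ h.1
    simp only [ca, cb, if_true] at h1 h2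
    simp only [Bool.false_eq_true, if_false, add_zero] at h2
    simp only [pot, ca, cb, if_true, Bool.false_eq_true, if_false]
    constructor
    · refine max_le_max (max_le_max le_rfl (by linarith))
        (le_min (le_min ?_ ?_) ((min_le_right _ _).trans h2))
      · exact (min_le_left _ _).trans (min_le_right _ _)
      · exact ((min_le_left _ _).trans (min_le_left _ _)).trans (by linarith)
    · rw [← max_add_add_right, ← max_add_add_right, ← min_add_add_right, ← min_add_add_right]
      refine max_le_max (max_le_max (by linarith) (by linarith))
        (le_min (le_min ?_ ?_) ((min_le_right _ _).trans h1))
      · exact ((min_le_left _ _).trans (min_le_right _ _)).trans (by linarith)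
      · exact ((min_le_left _ _).trans (min_le_left _ _)).trans (by linarith)

open MeasureTheory in
lemma vol_two (a b c d : ℝ) (h1 : a ≤ b) (h2 : b ≤ c) (h3 : c ≤ d) :
    volume.real (Set.Ioc a b ∪ Set.Ioc c d) = (b - a) + (d - c) := by
  rw [measureReal_union _ measurableSet_Ioc (by simp) (by simp)]
  · simp [measureReal_def, h1, h3]
  · rw [Set.disjoint_left]
    rintro y ⟨_, h⟩ ⟨h', _⟩
    linarith

lemma stab_hard {V : Type*} [Fintype V] [DecidableEq V] (G : SimpleGraph V) (v : V)
    (col : V → Bool) (hcol : ∀ u w, (delV G v).Adj u w → col u ≠ col w) (x : V → ℝ)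
    (hbd : ∀ u, 0 ≤ x u ∧ x u ≤ 1)
    (hx : ∀ u w, G.Adj u w → x u + x w ≤ 1)
    (hodd : ∀ (u : V) (c : G.Walk u u), c.IsCycle → Odd c.length →
        ∑ w ∈ c.support.toFinset, x w ≤ ((c.length - 1 : ℕ) : ℝ) / 2) : x ∈ STAB G := by
  obtain ⟨t, hA, hB, hNA, hNB, hE⟩ := exists_pot G v x col hcol hbd hx hodd
  have hv := hbd v
  let A : V → Set ℝ := fun u =>
    if u = v then Set.Ioc 0 (x v) ∪ Set.Ioc 1 1
    else if col u = true then Set.Ioc 0 (t u) ∪ Set.Ioc (x v) (x v + (x u - t u))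
    else Set.Ioc (t u) (x v) ∪ Set.Ioc (1 - (x u - (x v - t u))) 1
  have Av : A v = Set.Ioc 0 (x v) ∪ Set.Ioc 1 1 := by simp [A]
  have AA : ∀ u, u ≠ v → col u = true →
      A u = Set.Ioc 0 (t u) ∪ Set.Ioc (x v) (x v + (x u - t u)) := by
    intro u h c; simp [A, h, c]
  have AB : ∀ u, u ≠ v → col u = false →
      A u = Set.Ioc (t u) (x v) ∪ Set.Ioc (1 - (x u - (x v - t u))) 1 := by
    intro u h c; simp [A, h, c]
  have hcases : ∀ u, u = v ∨ (u ≠ v ∧ col u = true) ∨ (u ≠ v ∧ col u = false) := by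
    intro u
    by_cases h : u = v
    · exact Or.inl h
    · cases hc : col u <;> simp [h]
  have dvu : ∀ u, G.Adj v u → Disjoint (A v) (A u) := by
    intro u h
    rw [Set.disjoint_left, Av]
    intro y hy hy'
    simp only [Set.mem_union, Set.mem_Ioc] at hy
    rcases hcases u with rfl | ⟨hn, c⟩ | ⟨hn, c⟩
    · exact h.ne rfl
    · rw [AA u hn c, hNA u c h] at hy'
      simp only [Set.mem_union, Set.mem_Ioc] at hy'
      grind
    · rw [AB u hn c, hNB u c h] at hy'
      simp only [Set.mem_union, Set.mem_Ioc] at hy'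
      have := hx _ _ h
      grind
  have dab : ∀ a b, a ≠ v → b ≠ v → col a = true → col b = false → G.Adj a b →
      Disjoint (A a) (A b) := by
    intro a b ha hb ca cb h
    have h1 := hE a b ca cb ⟨h, ha, hb⟩
    have h2 := hA a ca
    have h3 := hB b cb
    rw [AA a ha ca, AB b hb cb, Set.disjoint_left]
    intro y hy hy'
    simp only [Set.mem_union, Set.mem_Ioc] at hy hy'
    rcases hy with ⟨_, _⟩ | ⟨_, _⟩ <;> rcases hy' with ⟨_, _⟩ | ⟨_, _⟩ <;> linarith
  refine stab_of_sets G x A ?_ ?_ ?_ ?_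
  · intro u
    rcases hcases u with rfl | ⟨hn, c⟩ | ⟨hn, c⟩
    · rw [Av]; exact measurableSet_Ioc.union measurableSet_Ioc
    · rw [AA u hn c]; exact measurableSet_Ioc.union measurableSet_Ioc
    · rw [AB u hn c]; exact measurableSet_Ioc.union measurableSet_Ioc
  · intro u
    rcases hcases u with rfl | ⟨hn, c⟩ | ⟨hn, c⟩
    · rw [Av]
      refine Set.union_subset (Set.Ioc_subset_Ioc ?_ ?_) (Set.Ioc_subset_Ioc ?_ ?_) <;> linarith
    · rw [AA u hn c]
      have := hA u c
      refine Set.union_subset (Set.Ioc_subset_Ioc ?_ ?_) (Set.Ioc_subset_Ioc ?_ ?_) <;> linarith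
    · rw [AB u hn c]
      have := hB u c
      refine Set.union_subset (Set.Ioc_subset_Ioc ?_ ?_) (Set.Ioc_subset_Ioc ?_ ?_) <;> linarith
  · intro u
    rcases hcases u with rfl | ⟨hn, c⟩ | ⟨hn, c⟩
    · rw [Av, vol_two] <;> linarith
    · have := hA u c
      rw [AA u hn c, vol_two] <;> linarith
    · have := hB u c
      rw [AB u hn c, vol_two] <;> linarith
  · intro u w h
    by_cases hu : u = v
    · subst hu; exact dvu w h
    by_cases hw : w = v
    · subst hw; exact (dvu u h.symm).symm
    have hne := hcol u w ⟨h, hu, hw⟩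
    cases cu : col u <;> cases cw : col w
    · simp [cu, cw] at hne
    · exact (dab w u hw hu cw cu h.symm).symm
    · exact dab u w hu hw cu cw h
    · simp [cu, cw] at hne

/-- If `G - v` is bipartite, then `STAB(G)` is defined by nonnegativity, bounds,
edge constraints and odd-cycle constraints. -/
theorem stmt0 {V : Type*} [Fintype V] [DecidableEq V] (G : SimpleGraph V) (v : V)
    (hbip : (G.induce {u | u ≠ v}).Colorable 2) :
    STAB G = {x | (∀ u, 0 ≤ x u ∧ x u ≤ 1) ∧
      (∀ u w, G.Adj u w → x u + x w ≤ 1) ∧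
      (∀ (u : V) (c : G.Walk u u), c.IsCycle → Odd c.length →
        ∑ w ∈ c.support.toFinset, x w ≤ ((c.length - 1 : ℕ) : ℝ) / 2)} := by
  refine Set.Subset.antisymm (stab_easy G) ?_
  rintro x ⟨h1, h2, h3⟩
  obtain ⟨C⟩ := hbip
  let col : V → Bool := fun u => if h : u ≠ v then decide (C ⟨u, h⟩ = 0) else false
  refine stab_hard G v col ?_ x h1 h2 h3
  intro u w h
  have hu := h.2.1
  have hw := h.2.2
  have hne : C ⟨u, hu⟩ ≠ C ⟨w, hw⟩ := C.valid (by simpa using h.1)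
  simp only [col, dif_pos hu, dif_pos hw]
  intro he
  rw [decide_eq_decide] at he
  apply hne
  generalize C ⟨u, hu⟩ = i at he
  generalize C ⟨w, hw⟩ = j at he
  revert i j
  decide
end

section
/- For every k ≥ 2, the graph H^k is LS_+-imperfect; specifically, there exists γ ∈ (0,1) such that the point x(k,γ) = (1/(2k+2+γ))·(2,2,...,2,4)ᵀ ∈ R^{2k+2} (with last coordinate corresponding to node 2k+1) belongs to LS_+(FRAC(H^k)) but violates the rank inequality sum_{v} x_v ≤ 2 of STAB(H^k). -/
/-- The edge relaxation `FRAC(G)`. -/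
def FRAC {V : Type*} (G : SimpleGraph V) : Set (V → ℝ) :=
  {x | (∀ v, 0 ≤ x v ∧ x v ≤ 1) ∧ ∀ u v, G.Adj u v → x u + x v ≤ 1}

/-- The homogenization cone of `K ⊆ [0,1]^ι` (index `none` is the coordinate `0`). -/
def coneK {ι : Type*} (K : Set (ι → ℝ)) : Set (Option ι → ℝ) :=
  {z | ∃ c : ℝ, 0 ≤ c ∧ ∃ y ∈ K, z none = c ∧ ∀ i, z (some i) = c * y i}

/-- The Lovász–Schrijver positive semidefinite operator `LS₊`. -/
def LSplus {ι : Type} [Fintype ι] [DecidableEq ι] (K : Set (ι → ℝ)) : Set (ι → ℝ) :=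
  {x | (∀ i, 0 ≤ x i ∧ x i ≤ 1) ∧
    ∃ Y : Matrix (Option ι) (Option ι) ℝ, Y.PosSemidef ∧
      Y none none = 1 ∧
      (∀ j, Y j none = Y j j) ∧
      (∀ i, Y (some i) none = x i) ∧
      (∀ i, (fun j => Y j (some i)) ∈ coneK K) ∧
      (∀ i, (fun j => Y j none - Y j (some i)) ∈ coneK K)}

/-- Nodes `i,j ∈ {1,…,2k+1}` are consecutive on the cycle `C_{2k+1}`. -/
def consec (k : ℕ) (i j : Fin (2*k+2)) : Prop :=
  (j : ℕ) = (i : ℕ) + 1 ∨ (i : ℕ) = (j : ℕ) + 1 ∨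
    ((i : ℕ) = 1 ∧ (j : ℕ) = 2*k+1) ∨ ((i : ℕ) = 2*k+1 ∧ (j : ℕ) = 1)

/-- The graph `H^k` on `{0,…,2k+1}`: nodes `1,…,2k+1` induce the complement of
`C_{2k+1}`, and node `0` is adjacent to every node except `2k+1`. -/
def Hk (k : ℕ) : SimpleGraph (Fin (2*k+2)) :=
  SimpleGraph.fromRel (fun i j =>
    (i = 0 ∧ j ≠ 0 ∧ (j : ℕ) ≠ 2*k+1) ∨
    (i ≠ 0 ∧ j ≠ 0 ∧ ¬ consec k i j))

def AA (k : ℕ) (t : ℝ) (i j : ℕ) : ℝ :=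
  (if j = i + 1 ∧ 1 ≤ i then 1 + 4 * t * (-1)^i else 0)
  + (if i = 1 ∧ j = 2*k+1 then 1 + 4 * t else 0)
  + (if i = 0 ∧ j = 2*k+1 then 2 else 0)
def DD (k : ℕ) (i : ℕ) : ℝ := if i = 2*k+1 then 4 else 2
def WW (k : ℕ) (t : ℝ) (i j : ℕ) : ℝ :=
  (if i = j then DD k i else 0) + AA k t i j + AA k t j i

def adjN (k u v : ℕ) : Prop := u ≠ v ∧ ¬(u=0∧v=2*k+1) ∧ ¬(v=0∧u=2*k+1) ∧ ¬(1≤u ∧ v=u+1) ∧ ¬(1≤v∧u=v+1) ∧ ¬(u=1∧v=2*k+1) ∧¬(v=1∧u=2*k+1)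

theorem WW_symm (k t i j) : WW k t i j = WW k t j i := by
  unfold WW
  by_cases h : i = j
  · subst h; ring
  · rw [if_neg h, if_neg (Ne.symm h)]; ring

theorem DD_ge (k i) : 2 ≤ DD k i := by unfold DD; split_ifs <;> norm_num
theorem DD_le (k i) : DD k i ≤ 4 := by unfold DD; split_ifs <;> norm_num

theorem WW_diag (k t i) (hk : 2 ≤ k) : WW k t i i = DD k i := by
  unfold WW AA
  rw [if_pos rfl, if_neg (by omega), if_neg (by omega), if_neg (by omega)]; ring

theorem WW_adj (k t i j) (h : adjN k i j) : WW k t i j = 0 := by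
  unfold adjN at h
  unfold WW AA
  rw [if_neg (by omega), if_neg (by omega), if_neg (by omega), if_neg (by omega), if_neg (by omega), if_neg (by omega), if_neg (by omega)]; ring

theorem AA_next (k t i) (hk : 2 ≤ k) (h : 1 ≤ i) : WW k t i (i+1) = 1 + 4 * t * (-1)^i := by
  unfold WW AA
  rw [if_neg (by omega), if_pos (by omega), if_neg (by omega), if_neg (by omega), if_neg (by omega), if_neg (by omega), if_neg (by omega)]; ring
theorem AA_wrap (k t) (hk : 2 ≤ k) : WW k t 1 (2*k+1) = 1 + 4 * t := by
  unfold WW AA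
  rw [if_neg (by omega), if_neg (by omega), if_pos (by omega), if_neg (by omega), if_neg (by omega), if_neg (by omega), if_neg (by omega)]; ring
theorem AA_zero (k t) (hk : 2 ≤ k) : WW k t 0 (2*k+1) = 2 := by
  unfold WW AA
  rw [if_neg (by omega), if_neg (by omega), if_neg (by omega), if_pos (by omega), if_neg (by omega), if_neg (by omega), if_neg (by omega)]; ring

theorem WW_bd (k t i j) (hk : 2 ≤ k) (h0 : 0 < t) (h1 : t ≤ 1/16) (h : i ≠ j) :
    0 ≤ WW k t i j ∧ WW k t i j ≤ 2 := by
  have key : ∀ i, 0 ≤ 1 + 4 * t * (-1)^i ∧ 1 + 4 * t * (-1)^i ≤ 2 := by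
    intro i
    rcases neg_one_pow_eq_or ℝ i with e | e <;> rw [e] <;> constructor <;> linarith
  by_cases ha : adjN k i j
  · rw [WW_adj _ _ _ _ ha]; norm_num
  · have : (1 ≤ i ∧ j = i+1) ∨ (1 ≤ j ∧ i = j+1) ∨ (i = 1 ∧ j = 2*k+1) ∨ (j = 1 ∧ i = 2*k+1) ∨ (i = 0 ∧ j = 2*k+1) ∨ (j = 0 ∧ i = 2*k+1) := by
      unfold adjN at ha; tauto
    rcases this with ⟨a, rfl⟩ | ⟨a, rfl⟩ | ⟨rfl, rfl⟩ | ⟨rfl, rfl⟩ | ⟨rfl, rfl⟩ | ⟨rfl, rfl⟩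
    · rw [AA_next _ _ _ hk a]; exact key _
    · rw [WW_symm, AA_next _ _ _ hk a]; exact key _
    · rw [AA_wrap _ _ hk]; constructor <;> linarith
    · rw [WW_symm, AA_wrap _ _ hk]; constructor <;> linarith
    · rw [AA_zero _ _ hk]; constructor <;> linarith
    · rw [WW_symm, AA_zero _ _ hk]; constructor <;> linarith

theorem adjN_symm {k u v} (h : adjN k u v) : adjN k v u := by unfold adjN at *; omega

theorem WW_col (k t u v i) (hk : 2 ≤ k) (h0 : 0 < t) (h1 : t ≤ 1/16) (hu : u < 2*k+2) (hv : v < 2*k+2)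
    (hi : i < 2*k+2)
    (h : adjN k u v) : WW k t u i + WW k t v i ≤ DD k i := by
  by_cases e1 : u = i
  · subst e1; rw [WW_diag _ _ _ hk, WW_adj _ _ _ _ (adjN_symm h)]; linarith
  by_cases e2 : v = i
  · subst e2; rw [WW_diag _ _ _ hk, WW_adj _ _ _ _ (h)]; linarith
  have b1 := WW_bd k t u i hk h0 h1 e1
  have b2 := WW_bd k t v i hk h0 h1 e2
  have d := DD_ge k i
  by_cases a1 : adjN k u i
  · rw [WW_adj _ _ _ _ a1]; linarith
  by_cases a2 : adjN k v i
  · rw [WW_adj _ _ _ _ a2]; linarith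
  by_cases hn : i = 2*k+1
  · rw [DD, if_pos hn]; linarith
  have main : ∀ u v, adjN k u v → u < v → v < 2*k+2 → ¬ adjN k u i → ¬ adjN k v i → u ≠ i → v ≠ i →
      WW k t u i + WW k t v i ≤ 2 := by
    intro u v h huv hv a1 a2 e1 e2
    have : (i = 1 ∧ u = 2 ∧ v = 2*k+1) ∨ (1 ≤ u ∧ i = u + 1 ∧ v = u + 1 + 1) := by
      unfold adjN at *; omega
    rcases this with ⟨rfl, rfl, rfl⟩ | ⟨a, rfl, rfl⟩
    · rw [WW_symm, WW_symm _ _ _ 1, AA_wrap _ _ hk, AA_next _ _ _ hk le_rfl]; linarith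
    · rw [WW_symm _ _ (u+1+1), AA_next _ _ _ hk (by omega), AA_next _ _ _ hk (by omega), pow_succ]; linarith
  rcases lt_or_gt_of_ne h.1 with hl | hl
  · have := main u v h hl hv a1 a2 e1 e2; linarith
  · have := main v u (adjN_symm h) hl hu a2 a1 e2 e1; linarith

theorem WW_col2 (k t u v i) (hk : 2 ≤ k) (h0 : 0 < t) (h1 : t ≤ 1/16) (hu : u < 2*k+2) (hv : v < 2*k+2)
    (hi : i < 2*k+2)
    (h : adjN k u v) : (DD k u - WW k t u i) + (DD k v - WW k t v i) ≤ (2 * k + 3 - t) - DD k i := by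
  have hk' : (2:ℝ) ≤ k := by exact_mod_cast hk
  have s2 : ∀ u v, u ≠ v → DD k u + DD k v ≤ 6 := by
    intro u v h; unfold DD; split_ifs <;> first | omega | norm_num
  by_cases e1 : u = i
  · subst e1; rw [WW_diag _ _ _ hk, WW_adj _ _ _ _ (adjN_symm h)]; linarith [s2 u v h.1]
  by_cases e2 : v = i
  · subst e2; rw [WW_diag _ _ _ hk, WW_adj _ _ _ _ (h)]; linarith [s2 u v h.1]
  have b1 := WW_bd k t u i hk h0 h1 e1
  have b2 := WW_bd k t v i hk h0 h1 e2
  by_cases h3 : 3 ≤ k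
  · have hk' : (3:ℝ) ≤ k := by exact_mod_cast h3
    have : DD k u + DD k v + DD k i ≤ 8 := by
      have := h.1
      unfold DD; split_ifs <;> first | omega | norm_num
    linarith
  obtain rfl : k = 2 := by omega
  by_cases hn : u ≠ 5 ∧ v ≠ 5 ∧ i ≠ 5
  · have : DD 2 u + DD 2 v + DD 2 i ≤ 6 := by
      unfold DD; split_ifs <;> first | omega | norm_num
    push_cast; linarith
  unfold adjN at h
  have : DD 2 u + DD 2 v + DD 2 i ≤ 8 := by
    have := h.1
    unfold DD; split_ifs <;> first | omega | norm_num
  have x1 := AA_zero 2 t hk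
  have x2 := AA_wrap 2 t hk
  have x3 := AA_next 2 t 2 hk (by norm_num)
  have x4 := AA_next 2 t 4 hk (by norm_num)
  have y1 := WW_symm 2 t 0 5
  have y2 := WW_symm 2 t 1 5
  have y3 := WW_symm 2 t 2 3
  have y4 := WW_symm 2 t 4 5
  norm_num at x1 x2 x3 x4
  push_cast
  interval_cases u <;> interval_cases v <;> first | omega | (interval_cases i <;> first | omega | linarith)

theorem poinc (m : ℕ) (r : ℕ → ℝ) (q : ℝ) (hq : 0 ≤ q) (h : ∀ i < 2*m, |r i + r (i+1)| ≤ q)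
    (hw : |r (2*m) + r 0| ≤ q) : ∀ i ≤ 2*m, |r i| ≤ (2*m+1) * 2 * q := by
  have h1 : ∀ i ≤ 2*m, |(-1)^i * r i - r 0| ≤ i * q := by
    intro i
    induction i with
    | zero => simp
    | succ i ih =>
      intro hi
      have a := ih (by omega)
      have b := h i (by omega)
      have e : (-1:ℝ)^(i+1) * r (i+1) - r 0 = ((-1)^i * r i - r 0) - (-1)^i * (r i + r (i+1)) := by ring
      rw [e]
      have c : |(-1:ℝ)^i * (r i + r (i+1))| ≤ q := by rw [abs_mul, abs_neg_one_pow, one_mul]; exact b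
      push_cast
      linarith [abs_sub ((-1:ℝ)^i * r i - r 0) ((-1)^i * (r i + r (i+1)))]
  have h0 : |r 0| ≤ (2*m+1) * q := by
    have a := h1 (2*m) le_rfl
    rw [pow_mul, neg_one_sq, one_pow, one_mul] at a
    push_cast at a
    have hmq : 0 ≤ (m:ℝ) * q := by positivity
    rw [abs_le] at *
    constructor <;> nlinarith
  intro i hi
  have a := h1 i hi
  have hi' : (i:ℝ) ≤ 2 * m := by exact_mod_cast hi
  have c : |r i| = |(-1:ℝ)^i * r i| := by rw [abs_mul, abs_neg_one_pow, one_mul]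
  rw [c]
  have : (i:ℝ) * q ≤ 2 * m * q := by gcongr
  have := abs_sub_abs_le_abs_sub ((-1:ℝ)^i * r i) (r 0)
  linarith

theorem idA (m : ℕ) (r : ℕ → ℝ) (c : ℝ) :
    ∑ i ∈ Finset.range m, ((r i + c) + (r (i+1) + c))^2 = 4 * m * c^2 + 4 * c * (2 * ∑ i ∈ Finset.range (m+1), r i - r 0 - r m)
      + 2 * ∑ i ∈ Finset.range (m+1), (r i)^2 - (r 0)^2 - (r m)^2 + 2 * ∑ i ∈ Finset.range m, r i * r (i+1) := by
  induction m with
  | zero => simp; ring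
  | succ m ih =>
    rw [Finset.sum_range_succ, ih, Finset.sum_range_succ _ (m+1), Finset.sum_range_succ _ (m+1), Finset.sum_range_succ (fun i => r i * r (i+1)) m]
    push_cast; ring

theorem idB (k : ℕ) (r : ℕ → ℝ) (c : ℝ) :
    ∑ i ∈ Finset.range (2*k), (-1)^(i+1) * ((r i + c) * (r (i+1) + c)) = 
      ∑ i ∈ Finset.range (2*k), (-1)^(i+1) * (r i * r (i+1)) + c * (r (2*k) - r 0) := by
  induction k with
  | zero => simp
  | succ k ih =>
    have : 2 * (k+1) = 2*k+1+1 := by ring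
    rw [this, Finset.sum_range_succ, Finset.sum_range_succ, ih, Finset.sum_range_succ, Finset.sum_range_succ]
    simp only [pow_succ, pow_mul]; norm_num; ring

theorem main_ineq (k : ℕ) (hk : 2 ≤ k) (t : ℝ) (h0 : 0 < t) (ht : t * (96 * (2*k+1)^3) ≤ 1) (z y0 : ℝ) (y : ℕ → ℝ) :
    0 ≤ (2 * k + 3 - t) * z^2 + 2 * z * (2 * y0 + 2 * ∑ i ∈ Finset.range (2*k+1), y i + 2 * y (2*k))
      + (2 * y0^2 + 2 * ∑ i ∈ Finset.range (2*k+1), (y i)^2 + 2 * (y (2*k))^2)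
      + 2 * (∑ i ∈ Finset.range (2*k), y i * y (i+1) + 4 * t * ∑ i ∈ Finset.range (2*k), (-1)^(i+1) * (y i * y (i+1))
      + (1 + 4 * t) * (y 0 * y (2*k)) + 2 * (y0 * y (2*k))) := by
  have A := idA (2*k) y (z/2)
  have B := idB k y (z/2)
  set r : ℕ → ℝ := fun i => y i + z/2 with hr
  set U := ∑ i ∈ Finset.range (2*k), (r i + r (i+1))^2 + (r (2*k) + r 0)^2 with hU
  have hU0 : 0 ≤ U := by positivity
  have P := poinc k r (√U) (Real.sqrt_nonneg _) (by
      intro i hi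
      apply Real.abs_le_sqrt
      have := Finset.single_le_sum (f := fun i => (r i + r (i+1))^2) (fun i _ => sq_nonneg _) (Finset.mem_range.2 hi)
      have h5 := sq_nonneg (r (2*k) + r 0)
      rw [hU]; linarith) (by
      apply Real.abs_le_sqrt
      have := Finset.sum_nonneg (s := Finset.range (2*k)) (f := fun i => (r i + r (i+1))^2) (fun i _ => sq_nonneg _)
      linarith)
  set L : ℝ := 4 * (2*k+1)^2 * U with hL
  have P2 : ∀ i ≤ 2*k, (r i)^2 ≤ L := by
    intro i hi
    have := P i hi
    have h2 := pow_le_pow_left₀ (abs_nonneg _) this 2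
    rw [sq_abs] at h2
    rw [mul_pow, Real.sq_sqrt hU0] at h2
    rw [hL]; linarith
  have P3 : ∀ i < 2*k, -L ≤ (-1)^(i+1) * (r i * r (i+1)) := by
    intro i hi
    have a := P2 i (by omega)
    have b := P2 (i+1) (by omega)
    rcases neg_one_pow_eq_or ℝ (i+1) with e | e <;> rw [e]
    · nlinarith [sq_nonneg (r i + r (i+1))]
    · nlinarith [sq_nonneg (r i - r (i+1))]
  have P4 : -(2*k*L) ≤ ∑ i ∈ Finset.range (2*k), (-1)^(i+1) * (r i * r (i+1)) := by
    have := Finset.sum_le_sum (s := Finset.range (2*k)) (f := fun _ => -L) (fun i hi => P3 i (Finset.mem_range.1 hi))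
    simp at this
    linarith
  have P5 : -L ≤ r 0 * r (2*k) := by
    nlinarith [P2 0 (by omega), P2 (2*k) le_rfl, sq_nonneg (r 0 + r (2*k))]
  have P6 := P2 (2*k) le_rfl
  have hL0 : 0 ≤ L := by positivity
  have hk' : (2:ℝ) ≤ k := by exact_mod_cast hk
  have fin : 24 * (2*k+1) * (t * L) ≤ U := by
    have : 24 * (2*k+1) * (t * L) = (t * (96 * (2*k+1)^3)) * U := by rw [hL]; ring
    rw [this]; exact mul_le_of_le_one_left hU0 ht
  have sqs : 0 ≤ t * (-z + 4 * r (2*k))^2 := by positivity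
  have q1 : 0 ≤ 2 * (y0 + z/2 + r (2*k))^2 := by positivity
  have tP4 := mul_le_mul_of_nonneg_left P4 h0.le
  have tP5 := mul_le_mul_of_nonneg_left P5 h0.le
  have tP6 := mul_le_mul_of_nonneg_left P6 h0.le
  have tL : 0 ≤ t * L := by positivity
  have ktL : 0 ≤ k * (t * L) := by positivity
  have r0 : r 0 = y 0 + z/2 := rfl
  have rn : r (2*k) = y (2*k) + z/2 := rfl
  have final : 0 ≤ U + 2 * (y0 + z/2 + r (2*k))^2 + t * (-z + 4 * r (2*k))^2 - 16 * (t * (r (2*k))^2) 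
     + 8 * (t * ∑ i ∈ Finset.range (2*k), (-1)^(i+1) * (r i * r (i+1))) + 8 * (t * (r 0 * r (2*k))) := by
    linarith
  refine le_of_le_of_eq final ?_
  rw [hU]
  have A' : ∑ i ∈ Finset.range (2*k), (r i + r (i+1))^2 = _ := A
  have B' : ∑ i ∈ Finset.range (2*k), (-1)^(i+1) * (r i * r (i+1)) = _ := B
  rw [A', B', r0, rn]
  push_cast
  ring

theorem sumA (k : ℕ) (hk : 2 ≤ k) (t : ℝ) (f : ℕ → ℝ) :
    ∑ i ∈ Finset.range (2*k+2), ∑ j ∈ Finset.range (2*k+2), f i * AA k t i j * f j =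
      ∑ i ∈ Finset.range (2*k), (1 + 4*t*(-1)^(i+1)) * (f (i+1) * f (i+1+1)) + (1+4*t) * (f 1 * f (2*k+1))
       + 2 * (f 0 * f (2*k+1)) := by
  have e1 : ∀ i j, f i * AA k t i j * f j = (if j = i + 1 then (if 1 ≤ i then (1 + 4 * t * (-1)^i) * (f i * f j) else 0) else 0)
     + (if j = 2*k+1 then (if i = 1 then (1+4*t) * (f i * f j) else 0) else 0)
     + (if j = 2*k+1 then (if i = 0 then 2 * (f i * f j) else 0) else 0) := by
    intro i j
    unfold AA
    simp only [ite_and]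
    split_ifs <;> first | omega | ring
  simp only [e1, Finset.sum_add_distrib, Finset.sum_ite_eq', Finset.mem_range]
  have h1 : 2*k+1 < 2*k+2 := by omega
  have h2 : 1 < 2*k+2 := by omega
  have h3 : 0 < 2*k+2 := by omega
  simp only [if_pos h1, Finset.sum_ite_eq', Finset.mem_range, if_pos h2, if_pos h3]
  rw [Finset.sum_range_succ, if_neg (by omega), Finset.sum_range_succ']
  simp only [add_zero]
  congr 2
  rw [if_pos (by omega), if_neg (by omega), add_zero]
  apply Finset.sum_congr rfl
  intro i hi
  rw [Finset.mem_range] at hi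
  rw [if_pos (by omega), if_pos (by omega)]

theorem sumW (k : ℕ) (hk : 2 ≤ k) (t : ℝ) (f : ℕ → ℝ) :
    ∑ i ∈ Finset.range (2*k+2), ∑ j ∈ Finset.range (2*k+2), f i * WW k t i j * f j =
      ∑ i ∈ Finset.range (2*k+2), DD k i * (f i)^2 + 2 * (∑ i ∈ Finset.range (2*k), (1 + 4*t*(-1)^(i+1)) * (f (i+1) * f (i+1+1)) + (1+4*t) * (f 1 * f (2*k+1))
       + 2 * (f 0 * f (2*k+1))) := by
  have e1 : ∀ i j, f i * WW k t i j * f j = (if i = j then DD k i * (f i * f j) else 0) + f i * AA k t i j * f j + f j * AA k t j i * f i := by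
    intro i j
    unfold WW
    split_ifs <;> ring
  simp only [e1, Finset.sum_add_distrib, Finset.sum_ite_eq]
  rw [Finset.sum_comm (f := fun i j => f j * AA k t j i * f i), sumA k hk]
  have : ∑ i ∈ Finset.range (2*k+2), (if i ∈ Finset.range (2*k+2) then DD k i * (f i * f i) else 0) = ∑ i ∈ Finset.range (2*k+2), DD k i * (f i)^2 := by
    apply Finset.sum_congr rfl
    intro i hi
    rw [if_pos hi]; ring
  rw [this]; ring

theorem sumD (k : ℕ) (f : ℕ → ℝ) : ∑ i ∈ Finset.range (2*k+2), DD k i * f i =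
    2 * f 0 + 2 * ∑ i ∈ Finset.range (2*k+1), f (i+1) + 2 * f (2*k+1) := by
  have e : ∀ i, DD k i * f i = 2 * f i + (if i = 2*k+1 then 2 * f i else 0) := by
    intro i; unfold DD; split_ifs <;> ring
  simp only [e, Finset.sum_add_distrib, Finset.sum_ite_eq', Finset.mem_range]
  rw [if_pos (by omega), ← Finset.mul_sum, Finset.sum_range_succ']
  ring

noncomputable def YY (k : ℕ) (t : ℝ) : Matrix (Option (Fin (2*k+2))) (Option (Fin (2*k+2))) ℝ :=
  fun a b => match a, b with
  | none, none => 2*k+3-t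
  | none, some j => DD k j
  | some i, none => DD k i
  | some i, some j => WW k t i j

theorem YY_psd (k : ℕ) (hk : 2 ≤ k) (t : ℝ) (h0 : 0 < t) (ht : t * (96 * (2*k+1)^3) ≤ 1) :
    (YY k t).PosSemidef := by
  apply Matrix.PosSemidef.of_dotProduct_mulVec_nonneg
  · ext a b
    rcases a with _ | a <;> rcases b with _ | b <;> simp [YY]
    exact WW_symm _ _ _ _
  · intro x
    obtain ⟨f, hf⟩ : ∃ f : ℕ → ℝ, ∀ i : Fin (2*k+2), x (some i) = f i :=
      ⟨fun j => if h : j < 2*k+2 then x (some ⟨j, h⟩) else 0, fun i => by simp⟩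
    have M := main_ineq k hk t h0 ht (x none) (f 0) (fun i => f (i+1))
    refine le_of_le_of_eq M ?_
    have e1 : ∑ i : Fin (2*k+2), DD k i * f i = _ := (Fin.sum_univ_eq_sum_range (fun i => DD k i * f i) (2*k+2)).trans (sumD k f)
    have e2 : ∑ i : Fin (2*k+2), ∑ j : Fin (2*k+2), f i * WW k t i j * f j = ∑ i ∈ Finset.range (2*k+2), ∑ j ∈ Finset.range (2*k+2), f i * WW k t i j * f j := by
      rw [← Fin.sum_univ_eq_sum_range (fun i => ∑ j ∈ Finset.range (2*k+2), f i * WW k t i j * f j)]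
      apply Finset.sum_congr rfl
      intro i _
      rw [← Fin.sum_univ_eq_sum_range (fun j => f i * WW k t i j * f j)]
    rw [sumW k hk, sumD k (fun i => (f i)^2)] at e2
    have e3 : star x ⬝ᵥ (YY k t).mulVec x = (2*k+3-t) * (x none)^2 + 2 * x none * (∑ i : Fin (2*k+2), DD k i * f i) + ∑ i : Fin (2*k+2), ∑ j : Fin (2*k+2), f i * WW k t i j * f j := by
      simp only [dotProduct, Matrix.mulVec, Fintype.sum_option, YY, Pi.star_apply, star_trivial, hf, mul_add, Finset.sum_add_distrib, Finset.mul_sum]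
      have : ∀ i : Fin (2*k+2), ∑ j : Fin (2*k+2), f i * (WW k t i j * f j) = ∑ j : Fin (2*k+2), f i * WW k t i j * f j := by
        intro i; apply Finset.sum_congr rfl; intros; ring
      simp only [this]
      have : ∑ i : Fin (2*k+2), f i * (DD k i * x none) = ∑ i : Fin (2*k+2), x none * (DD k i * f i) := by
        apply Finset.sum_congr rfl; intros; ring
      rw [this]
      simp only [← Finset.mul_sum]
      ring
    rw [e3, e1, e2]
    have e4 : ∑ i ∈ Finset.range (2*k), (1 + 4*t*(-1)^(i+1)) * (f (i+1) * f (i+1+1)) = ∑ i ∈ Finset.range (2*k), f (i+1) * f (i+1+1) + 4 * t * ∑ i ∈ Finset.range (2*k), (-1)^(i+1) * (f (i+1) * f (i+1+1)) := by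
      rw [Finset.mul_sum, ← Finset.sum_add_distrib]
      apply Finset.sum_congr rfl; intros; ring
    rw [e4]
    simp only [zero_add]
    rw [add_assoc]

theorem adj_adjN (k : ℕ) (u v : Fin (2*k+2)) (h : (Hk k).Adj u v) : adjN k u v := by
  simp only [Hk, SimpleGraph.fromRel_adj, consec, ne_eq, Fin.ext_iff, Fin.val_zero] at h
  unfold adjN
  omega

theorem adjN_adj (k : ℕ) (u v : Fin (2*k+2)) (h : adjN k u v) : (Hk k).Adj u v := by
  simp only [Hk, SimpleGraph.fromRel_adj, consec, ne_eq, Fin.ext_iff, Fin.val_zero]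
  unfold adjN at h
  omega

theorem mem_cone (k : ℕ) (z : Option (Fin (2*k+2)) → ℝ) (h0 : 0 < z none)
    (h1 : ∀ i, 0 ≤ z (some i) ∧ z (some i) ≤ z none)
    (h2 : ∀ u v : Fin (2*k+2), adjN k u v → z (some u) + z (some v) ≤ z none) :
    z ∈ coneK (FRAC (Hk k)) := by
  refine ⟨z none, h0.le, fun i => z (some i) / z none, ⟨fun v => ⟨div_nonneg (h1 v).1 h0.le, ?_⟩, fun u v h => ?_⟩, rfl, fun i => ?_⟩
  · rw [div_le_one h0]; exact (h1 v).2
  · rw [← add_div, div_le_one h0]; exact h2 u v (adj_adjN _ _ _ h)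
  · field_simp

theorem mem_LS (k : ℕ) (hk : 2 ≤ k) (t : ℝ) (h0 : 0 < t) (h1 : t ≤ 1/16) (ht : t * (96 * (2*k+1)^3) ≤ 1) :
    (fun v : Fin (2*k+2) => DD k v / (2 * (k : ℝ) + 3 - t)) ∈ LSplus (FRAC (Hk k)) := by
  have hk' : (2:ℝ) ≤ k := by exact_mod_cast hk
  have hN : 0 < 2 * (k : ℝ) + 3 - t := by linarith
  set N := 2 * (k : ℝ) + 3 - t with hNd
  have hN6 : 6 < N := by linarith
  refine ⟨fun i => ⟨?_, ?_⟩, N⁻¹ • YY k t, (YY_psd k hk t h0 ht).smul (by positivity), ?_, ?_, ?_, ?_, ?_⟩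
  · exact div_nonneg (by linarith [DD_ge k i]) hN.le
  · rw [div_le_one hN]; linarith [DD_le k i]
  · simp only [Matrix.smul_apply, YY, smul_eq_mul]
    rw [← hNd]; field_simp
  · rintro (_ | j)
    · rfl
    · simp only [Matrix.smul_apply, YY, WW_diag _ _ _ hk]
  · intro i
    simp only [Matrix.smul_apply, YY, smul_eq_mul]
    rw [div_eq_inv_mul]
  · intro i
    have hI : 0 < N⁻¹ := by positivity
    apply mem_cone
    · simp only [Matrix.smul_apply, YY, smul_eq_mul]
      have := DD_ge k i
      positivity
    · intro j
      simp only [Matrix.smul_apply, YY, smul_eq_mul]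
      have d := DD_ge k i
      have : 0 ≤ WW k t j i ∧ WW k t j i ≤ DD k i := by
        by_cases e : (j:ℕ) = i
        · rw [e, WW_diag _ _ _ hk]; constructor <;> linarith
        · have := WW_bd k t j i hk h0 h1 e
          constructor <;> linarith
      exact ⟨mul_nonneg hI.le this.1, mul_le_mul_of_nonneg_left this.2 hI.le⟩
    · intro u v h
      simp only [Matrix.smul_apply, YY, smul_eq_mul]
      rw [← mul_add]
      exact mul_le_mul_of_nonneg_left (WW_col k t u v i hk h0 h1 u.2 v.2 i.2 h) hI.le
  · intro i
    have hI : 0 < N⁻¹ := by positivity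
    apply mem_cone
    · simp only [Matrix.smul_apply, YY, smul_eq_mul]
      have := DD_le k i
      rw [← hNd, ← mul_sub]
      exact mul_pos hI (by linarith)
    · intro j
      simp only [Matrix.smul_apply, YY, smul_eq_mul]
      rw [← hNd, ← mul_sub, ← mul_sub]
      have d := DD_ge k j
      have d2 := DD_le k i
      have : 0 ≤ DD k j - WW k t j i ∧ DD k j - WW k t j i ≤ N - DD k i := by
        by_cases e : (j:ℕ) = i
        · rw [e, WW_diag _ _ _ hk]; constructor <;> linarith
        · have := WW_bd k t j i hk h0 h1 e
          have : DD k j + DD k i ≤ 6 := by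
            unfold DD; split_ifs <;> first | omega | norm_num
          constructor <;> linarith
      exact ⟨mul_nonneg hI.le this.1, mul_le_mul_of_nonneg_left this.2 hI.le⟩
    · intro u v h
      simp only [Matrix.smul_apply, YY, smul_eq_mul]
      rw [← hNd, ← mul_sub, ← mul_sub, ← mul_sub, ← mul_add]
      exact mul_le_mul_of_nonneg_left (WW_col2 k t u v i hk h0 h1 u.2 v.2 i.2 h) hI.le

theorem stab_rank (k : ℕ) (hk : 2 ≤ k) (x : Fin (2*k+2) → ℝ) (hx : x ∈ STAB (Hk k)) : ∑ v, x v ≤ 2 := by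
  have : STAB (Hk k) ⊆ {x | ∑ v, x v ≤ 2} := by
    apply convexHull_min
    · rintro _ ⟨S, hS, rfl⟩
      classical
      have e : ∑ v, S.indicator (1 : Fin (2*k+2) → ℝ) v = ((Finset.univ.filter (· ∈ S)).card : ℝ) := by
        simp [Set.indicator_apply]
      show ∑ v, S.indicator (1 : Fin (2*k+2) → ℝ) v ≤ 2
      rw [e]
      by_contra hc
      have h2 : 2 < (Finset.univ.filter (· ∈ S)).card := by
        have : (2:ℝ) < ((Finset.univ.filter (· ∈ S)).card : ℝ) := not_le.1 hc
        exact_mod_cast this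
      obtain ⟨a, ha, b, hb, c, hc, hab, hac, hbc⟩ := Finset.two_lt_card.1 h2
      simp only [Finset.mem_filter, Finset.mem_univ, true_and] at ha hb hc
      have n1 : ¬ adjN k a b := fun h => hS a ha b hb (adjN_adj k a b h)
      have n2 : ¬ adjN k a c := fun h => hS a ha c hc (adjN_adj k a c h)
      have n3 : ¬ adjN k b c := fun h => hS b hb c hc (adjN_adj k b c h)
      have := a.2
      have := b.2
      have := c.2
      rw [ne_eq, Fin.ext_iff] at hab hac hbc
      unfold adjN at n1 n2 n3
      omega
    · have : IsLinearMap ℝ (fun x : Fin (2*k+2) → ℝ => ∑ v, x v) :=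
        ⟨fun x y => by simp [Finset.sum_add_distrib], fun c x => by simp [Finset.mul_sum]⟩
      exact convex_halfSpace_le this 2
  exact this hx

/-- `H^k` is `LS₊`-imperfect: there is `γ ∈ (0,1)` such that the point
`x(k,γ) = (2,…,2,4)/(2k+2+γ)` lies in `LS₊(FRAC(H^k))` but violates the rank
inequality `∑ x_v ≤ 2` of `STAB(H^k)`. -/
theorem stmt13 (k : ℕ) (hk : 2 ≤ k) :
    LSplus (FRAC (Hk k)) ≠ STAB (Hk k) ∧
    ∃ γ : ℝ, 0 < γ ∧ γ < 1 ∧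
      (fun v : Fin (2*k+2) =>
        (if (v : ℕ) = 2*k+1 then (4 : ℝ) else 2) / (2 * (k : ℝ) + 2 + γ))
        ∈ LSplus (FRAC (Hk k)) ∧
      (2 : ℝ) < ∑ v : Fin (2*k+2),
        (if (v : ℕ) = 2*k+1 then (4 : ℝ) else 2) / (2 * (k : ℝ) + 2 + γ) := by
  have hk' : (2:ℝ) ≤ k := by exact_mod_cast hk
  obtain ⟨t, h0, h1, ht⟩ : ∃ t : ℝ, 0 < t ∧ t ≤ 1/16 ∧ t * (96 * (2*k+1)^3) ≤ 1 := by
    refine ⟨(96 * (2*k+1)^3)⁻¹, by positivity, ?_, ?_⟩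
    · rw [one_div]
      apply inv_anti₀ (by norm_num)
      have : (1:ℝ) ≤ (2*k+1)^3 := one_le_pow₀ (by linarith)
      linarith
    · rw [inv_mul_cancel₀ (by positivity)]
  have hN : 2 * (k:ℝ) + 2 + (1 - t) = 2 * k + 3 - t := by ring
  have hpos : 0 < 2 * (k:ℝ) + 3 - t := by linarith
  have mem := mem_LS k hk t h0 h1 ht
  have hsum : (2:ℝ) < ∑ v : Fin (2*k+2), DD k v / (2 * (k : ℝ) + 3 - t) := by
    rw [← Finset.sum_div, lt_div_iff₀ hpos]
    have e : ∑ v : Fin (2*k+2), DD k v = _ := Fin.sum_univ_eq_sum_range (fun i => DD k i) (2*k+2)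
    have s := sumD k (fun _ => 1)
    simp only [mul_one] at s
    rw [e, s]
    simp
    linarith
  refine ⟨fun h => ?_, 1 - t, by linarith, by linarith, ?_, ?_⟩
  · rw [h] at mem
    exact absurd (stab_rank k hk _ mem) (not_le.2 hsum)
  · rw [hN]; exact mem
  · rw [hN]; exact hsum
end

section
/- Let G be a graph on {0,...,2k+1} with k ≥ 3, G - 0 = C_{2k+1}, and deg_G(0) ≥ 3, and suppose G has three consecutive 3-central cycles. Then G can be obtained by a clique subdivision of an edge from a graph G' on {0,...,2k-1} with G' - 0 = C_{2k-1}, where G' has two fewer 3-central cycles than G and deg_{G'}(0) = deg_G(0) - 2. -/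
def centralLen (k s : ℕ) (v : Fin s → Fin (2*k+2)) (i : Fin s) : ℕ :=
  if h : (i : ℕ) + 1 < s then ((v ⟨(i : ℕ) + 1, h⟩ : ℕ) - (v i : ℕ)) + 2
  else (2*k + 3) - (v i : ℕ) + (v ⟨0, i.pos⟩ : ℕ)

/-- Clique subdivision of the edge `v₁v₂` in the clique `K` of `H`: the edge
`v₁v₂` is deleted and new nodes `w₁ = inr 0`, `w₂ = inr 1` are added with edges
`v₁w₁`, `w₁w₂`, `w₂v₂` and `wᵢ x` for all `x ∈ K \ {v₁, v₂}`. -/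
def cliqueSub {W : Type*} (H : SimpleGraph W) (K : Finset W) (v₁ v₂ : W) :
    SimpleGraph (W ⊕ Fin 2) :=
  SimpleGraph.fromRel (fun a b =>
    (∃ x y, a = Sum.inl x ∧ b = Sum.inl y ∧ H.Adj x y ∧
      ¬((x = v₁ ∧ y = v₂) ∨ (x = v₂ ∧ y = v₁))) ∨
    (∃ (i : Fin 2) (x : W), a = Sum.inl x ∧ b = Sum.inr i ∧
      ((i = 0 ∧ (x = v₁ ∨ (x ∈ K ∧ x ≠ v₁ ∧ x ≠ v₂))) ∨
       (i = 1 ∧ (x = v₂ ∨ (x ∈ K ∧ x ≠ v₁ ∧ x ≠ v₂))))) ∨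
    (a = Sum.inr 0 ∧ b = Sum.inr 1))


/-- successor on the cycle `1, …, 2k+1` -/
def nx (k n : ℕ) : ℕ := if n = 2*k+1 then 1 else n+1

lemma nx_eq (k n n' : ℕ) :
    nx k n = n' ↔ (n = 2*k+1 ∧ n' = 1) ∨ (n ≠ 2*k+1 ∧ n' = n+1) := by
  unfold nx; split_ifs <;> omega

lemma arith_rr (m i j : ℕ) (hm : 2 ≤ m) (hi : i < 2) (hj : j < 2) :
    (nx (m+1) (2*m+2+i) = 2*m+2+j ∨ nx (m+1) (2*m+2+j) = 2*m+2+i) ↔ i ≠ j := by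
  rw [nx_eq, nx_eq]; omega

lemma arith_ll (m x y : ℕ) (hm : 2 ≤ m) (hx : x ≠ 0) (hy : y ≠ 0) (hxl : x < 2*m+2)
    (hyl : y < 2*m+2) :
    (nx (m+1) x = y ∨ nx (m+1) y = x) ↔ (nx m x = y ∨ nx m y = x) ∧
      ¬((x = 2*m+1 ∧ y = 1) ∨ (x = 1 ∧ y = 2*m+1)) := by
  simp only [nx_eq]; omega

lemma arith_lr (m x i : ℕ) (hm : 2 ≤ m) (hx : x ≠ 0) (hxl : x < 2*m+2) (hi : i < 2) :
    (nx (m+1) x = 2*m+2+i ∨ nx (m+1) (2*m+2+i) = x) ↔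
      (i = 0 ∧ x = 2*m+1) ∨ (i = 1 ∧ x = 1) := by
  simp only [nx_eq]; omega

/-- rotation by `b` of the cycle `1, …, 2k+1`, fixing `0` -/
def rt (k b n : ℕ) : ℕ :=
  if n = 0 then 0 else if b + n ≤ 2*k+1 then b + n else b + n - (2*k+1)

lemma rt_mem {k b n : ℕ} (hb : 1 ≤ b) (hb' : b ≤ 2*k+1) (hn : 1 ≤ n) (hn' : n ≤ 2*k+1) :
    1 ≤ rt k b n ∧ rt k b n ≤ 2*k+1 := by
  unfold rt; split_ifs <;> omega

lemma rt_inj {k b n n' : ℕ} (hb : 1 ≤ b) (hb' : b ≤ 2*k+1) (hn' : n ≤ 2*k+1)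
    (hm' : n' ≤ 2*k+1) (h : rt k b n = rt k b n') : n = n' := by
  unfold rt at h; split_ifs at h <;> omega

lemma rt_nx {k b n : ℕ} (hb : 1 ≤ b) (hb' : b ≤ 2*k+1) (hn : 1 ≤ n) (hn' : n ≤ 2*k+1) :
    rt k b (nx k n) = nx k (rt k b n) := by
  unfold rt nx; split_ifs <;> omega

lemma rt_surj {k b y : ℕ} (hb : 1 ≤ b) (hb' : b ≤ 2*k+1) (hn : 1 ≤ y) (hn' : y ≤ 2*k+1) :
    ∃ n, 1 ≤ n ∧ n ≤ 2*k+1 ∧ rt k b n = y := by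
  by_cases h : b < y
  · refine ⟨y - b, by omega, by omega, ?_⟩
    unfold rt; split_ifs <;> omega
  · refine ⟨y + (2*k+1) - b, by omega, by omega, ?_⟩
    unfold rt; split_ifs <;> omega

/-- the cycle adjacency in terms of `nx` -/
lemma consec_iff {k : ℕ} (hk : 1 ≤ k) (i j : Fin (2*k+2)) (hi : i ≠ 0) (hj : j ≠ 0) :
    consec k i j ↔ nx k i = j ∨ nx k j = i := by
  have h1 := i.isLt
  have h2 := j.isLt
  have h3 : (i : ℕ) ≠ 0 := fun h => hi (Fin.ext h)
  have h4 : (j : ℕ) ≠ 0 := fun h => hj (Fin.ext h)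
  unfold consec nx
  split_ifs <;> omega

lemma central_next {k s : ℕ} (v : Fin s → Fin (2*k+2)) (hmono : StrictMono v)
    (hne : ∀ i, v i ≠ 0) (i j : Fin s) (hj : (j : ℕ) = ((i : ℕ) + 1) % s)
    (h : centralLen k s v i = 3) : (v j : ℕ) = nx k (v i) := by
  have hv := (v i).isLt
  unfold centralLen at h
  split_ifs at h with h1
  · rw [Nat.mod_eq_of_lt h1] at hj
    have : (⟨(i:ℕ)+1, h1⟩ : Fin s) = j := Fin.ext hj.symm
    rw [this] at h
    have := (v j).isLt
    unfold nx; split_ifs <;> omega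
  · have h2 : (i:ℕ)+1 = s := by have := i.isLt; omega
    rw [h2, Nat.mod_self] at hj
    have : (⟨0, i.pos⟩ : Fin s) = j := Fin.ext hj.symm
    rw [this] at h
    have h4 : (v j : ℕ) ≠ 0 := fun h => hne j (Fin.ext h)
    unfold nx; split_ifs <;> omega

lemma central_iff {k s : ℕ} (v : Fin s → Fin (2*k+2)) (hmono : StrictMono v)
    (hne : ∀ i, v i ≠ 0) (i : Fin s) :
    centralLen k s v i = 3 ↔ ∃ j, (v j : ℕ) = nx k (v i) := by
  have hs : 0 < s := i.pos
  constructor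
  · intro h
    exact ⟨⟨((i:ℕ)+1) % s, Nat.mod_lt _ hs⟩, central_next v hmono hne i _ rfl h⟩
  · rintro ⟨j, hj⟩
    have hv := (v i).isLt
    have hvj := (v j).isLt
    have hz : ∀ i, (v i : ℕ) ≠ 0 := fun i h => hne i (Fin.ext h)
    have hzj := hz j
    unfold centralLen
    split_ifs with h1
    · have hlt : (v i : ℕ) < v ⟨(i:ℕ)+1, h1⟩ := hmono (by simp [Fin.lt_def])
      have hv1 := (v ⟨(i:ℕ)+1, h1⟩).isLt
      have hj' : (v j : ℕ) = v i + 1 := by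
        unfold nx at hj; split_ifs at hj <;> omega
      have hij : i < j := hmono.lt_iff_lt.1 (by rw [Fin.lt_def]; omega)
      have hle : (v ⟨(i:ℕ)+1, h1⟩ : ℕ) ≤ v j := hmono.monotone (by
        rw [Fin.le_def]; rw [Fin.lt_def] at hij; exact hij)
      omega
    · have hji : (v j : ℕ) ≤ v i := hmono.monotone (by
        rw [Fin.le_def]; have := j.isLt; omega)
      have h0j : (v ⟨0, i.pos⟩ : ℕ) ≤ v j := hmono.monotone (by simp [Fin.le_def])
      have := hz ⟨0, i.pos⟩
      unfold nx at hj; split_ifs at hj <;> omega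

lemma central_count {k s : ℕ} (v : Fin s → Fin (2*k+2)) (hmono : StrictMono v)
    (hne : ∀ i, v i ≠ 0) (S : Finset ℕ) (hS : ∀ n, n ∈ S ↔ ∃ i, (v i : ℕ) = n) :
    (Finset.univ.filter (fun i : Fin s => centralLen k s v i = 3)).card =
      (S.filter (fun n => nx k n ∈ S)).card := by
  refine Finset.card_bij (fun i _ => (v i : ℕ)) ?_ ?_ ?_
  · intro i hi
    rw [Finset.mem_filter] at hi ⊢
    exact ⟨(hS _).2 ⟨i, rfl⟩, (hS _).2 ((central_iff v hmono hne i).1 hi.2)⟩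
  · intro i _ j _ h
    exact hmono.injective (Fin.ext h)
  · intro n hn
    rw [Finset.mem_filter] at hn
    obtain ⟨i, hi⟩ := (hS n).1 hn.1
    subst hi
    refine ⟨i, ?_, rfl⟩
    rw [Finset.mem_filter]
    exact ⟨Finset.mem_univ _, (central_iff v hmono hne i).2 ((hS _).1 hn.2)⟩

lemma rot_card {k b : ℕ} (hb : 1 ≤ b) (hb' : b ≤ 2*k+1) (S : Finset ℕ)
    (hS : ∀ n ∈ S, 1 ≤ n ∧ n ≤ 2*k+1) :
    ((Finset.Icc 1 (2*k+1)).filter (fun n => rt k b n ∈ S)).card = S.card := by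
  refine Finset.card_bij (fun n _ => rt k b n) ?_ ?_ ?_
  · intro n hn
    exact (Finset.mem_filter.1 hn).2
  · intro n hn n' hn' h
    simp only [Finset.mem_filter, Finset.mem_Icc] at hn hn'
    exact rt_inj hb hb' hn.1.2 hn'.1.2 h
  · intro y hy
    obtain ⟨n, h1, h2, h3⟩ := rt_surj hb hb' (hS y hy).1 (hS y hy).2
    exact ⟨n, by simp [h1, h2, h3, hy], h3⟩

/-- Splitting off the last two elements. -/
lemma split_card (m : ℕ) (P Q : ℕ → Prop) [DecidablePred P] [DecidablePred Q]
    (h : ∀ n, 1 ≤ n → n ≤ 2*m+1 → (P n ↔ Q n)) (h1 : P (2*m+2)) (h2 : P (2*m+3)) :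
    ((Finset.Icc 1 (2*(m+1)+1)).filter P).card =
      ((Finset.Icc 1 (2*m+1)).filter Q).card + 2 := by
  have : (Finset.Icc 1 (2*(m+1)+1)).filter P =
      insert (2*m+3) (insert (2*m+2) ((Finset.Icc 1 (2*m+1)).filter Q)) := by
    ext n
    simp only [Finset.mem_filter, Finset.mem_Icc, Finset.mem_insert]
    constructor
    · rintro ⟨⟨h3, h4⟩, h5⟩
      by_cases h6 : n ≤ 2*m+1
      · exact Or.inr (Or.inr ⟨⟨h3, h6⟩, (h n h3 h6).1 h5⟩)
      · omega
    · rintro (rfl | rfl | ⟨⟨h3, h4⟩, h5⟩)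
      · exact ⟨by omega, h2⟩
      · exact ⟨by omega, h1⟩
      · exact ⟨by omega, (h n h3 h4).2 h5⟩
  rw [this, Finset.card_insert_of_notMem, Finset.card_insert_of_notMem]
  · simp
  · simp

/-- The contracted graph: cycle on the nonzero vertices, hub `0` joined to `T`. -/
def hubGraph (m : ℕ) (hm : 1 ≤ m) (T : Finset ℕ) : SimpleGraph (Fin (2*m+2)) where
  Adj x y := (x ≠ 0 ∧ y ≠ 0 ∧ consec m x y) ∨ (x = 0 ∧ y ≠ 0 ∧ (y : ℕ) ∈ T) ∨
    (y = 0 ∧ x ≠ 0 ∧ (x : ℕ) ∈ T)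
  symm := ⟨by
    intro x y h
    unfold consec at *
    tauto⟩
  loopless := ⟨by
    intro x h
    unfold consec at h
    rcases h with h | h | h
    · omega
    · exact h.2.1 h.1
    · exact h.2.1 h.1⟩

/-- vertex map of the subdivided graph -/
def vidx (m : ℕ) : Fin (2*m+2) ⊕ Fin 2 → ℕ
  | Sum.inl x => x
  | Sum.inr i => 2*m+2+i

lemma vidx_lt (m : ℕ) (a : Fin (2*m+2) ⊕ Fin 2) : vidx m a ≤ 2*(m+1)+1 := by
  rcases a with x | i
  · have := x.isLt; simp only [vidx]; omega
  · have := i.isLt; simp only [vidx]; omega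

lemma vidx_inj (m : ℕ) : Function.Injective (vidx m) := by
  rintro (x | i) (y | j) h <;> simp only [vidx] at h
  · rw [Fin.ext h]
  · have := x.isLt; omega
  · have := y.isLt; omega
  · congr 1; exact Fin.ext (by omega)

lemma cliqueSub_ll {W : Type*} (H : SimpleGraph W) (K : Finset W) (v₁ v₂ x y : W) :
    (cliqueSub H K v₁ v₂).Adj (Sum.inl x) (Sum.inl y) ↔
      H.Adj x y ∧ ¬((x = v₁ ∧ y = v₂) ∨ (x = v₂ ∧ y = v₁)) := by
  simp only [cliqueSub, SimpleGraph.fromRel_adj]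
  have h1 := H.adj_comm x y
  have h2 : H.Adj x y → x ≠ y := fun h => h.ne
  constructor
  · rintro ⟨_, (⟨a, c, h, h', h''⟩ | ⟨i, a, h, h', _⟩ | ⟨h, _⟩) |
      (⟨a, c, h, h', h''⟩ | ⟨i, a, h, h', _⟩ | ⟨h, _⟩)⟩ <;> cases h <;> cases h'
    · exact h''
    · tauto
  · intro h
    exact ⟨fun e => h2 h.1 (Sum.inl_injective e), Or.inl (Or.inl ⟨x, y, rfl, rfl, h⟩)⟩

lemma cliqueSub_lr {W : Type*} (H : SimpleGraph W) (K : Finset W) (v₁ v₂ x : W) (i : Fin 2) :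
    (cliqueSub H K v₁ v₂).Adj (Sum.inl x) (Sum.inr i) ↔
      ((i = 0 ∧ (x = v₁ ∨ (x ∈ K ∧ x ≠ v₁ ∧ x ≠ v₂))) ∨
       (i = 1 ∧ (x = v₂ ∨ (x ∈ K ∧ x ≠ v₁ ∧ x ≠ v₂)))) := by
  simp only [cliqueSub, SimpleGraph.fromRel_adj]
  constructor
  · rintro ⟨_, (⟨a, c, h, h', h''⟩ | ⟨j, a, h, h', h''⟩ | ⟨h, _⟩) |
      (⟨a, c, h, h', h''⟩ | ⟨j, a, h, h', _⟩ | ⟨_, h⟩)⟩ <;> cases h <;> cases h'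
    exact h''
  · intro h
    exact ⟨by simp, Or.inl (Or.inr (Or.inl ⟨i, x, rfl, rfl, h⟩))⟩

lemma cliqueSub_rr {W : Type*} (H : SimpleGraph W) (K : Finset W) (v₁ v₂ : W) (i j : Fin 2) :
    (cliqueSub H K v₁ v₂).Adj (Sum.inr i) (Sum.inr j) ↔ i ≠ j := by
  simp only [cliqueSub, SimpleGraph.fromRel_adj]
  fin_cases i <;> fin_cases j <;> simp


lemma main_aux (m s : ℕ) (hm : 2 ≤ m)
    (G : SimpleGraph (Fin (2*(m+1)+2)))
    (hGC : ∀ i j : Fin (2*(m+1)+2), i ≠ 0 → j ≠ 0 → (G.Adj i j ↔ consec (m+1) i j))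
    (S : Finset ℕ) (hS1 : ∀ n ∈ S, 1 ≤ n ∧ n ≤ 2*(m+1)+1)
    (hS : ∀ u : Fin (2*(m+1)+2), G.Adj 0 u ↔ (u : ℕ) ∈ S) (hcard : S.card = s)
    (b : ℕ) (hb : 1 ≤ b) (hb' : b ≤ 2*(m+1)+1)
    (m1 : rt (m+1) b (2*m+1) ∈ S) (m2 : rt (m+1) b (2*m+2) ∈ S)
    (m3 : rt (m+1) b (2*m+3) ∈ S) (m4 : rt (m+1) b 1 ∈ S) :
    ∃ (G' : SimpleGraph (Fin (2*m+2))),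
      (∀ i j : Fin (2*m+2), i ≠ 0 → j ≠ 0 → (G'.Adj i j ↔ consec m i j)) ∧
      ∃ (K : Finset (Fin (2*m+2))) (v₁ v₂ : Fin (2*m+2)),
        G'.IsClique ↑K ∧ v₁ ∈ K ∧ v₂ ∈ K ∧ G'.Adj v₁ v₂ ∧
        Nonempty (G ≃g cliqueSub G' K v₁ v₂) ∧
        ∃ w : Fin (s-2) → Fin (2*m+2), StrictMono w ∧ (∀ i, w i ≠ 0) ∧
          (∀ i, G'.Adj 0 (w i)) ∧ (∀ u, G'.Adj 0 u → ∃ i, w i = u) ∧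
          (Finset.univ.filter (fun i : Fin (s-2) => centralLen m (s-2) w i = 3)).card =
            (S.filter (fun n => nx (m+1) n ∈ S)).card - 2 := by
  set T : Finset ℕ := (Finset.Icc 1 (2*m+1)).filter (fun n => rt (m+1) b n ∈ S) with hT
  have memT : ∀ n, n ∈ T ↔ (1 ≤ n ∧ n ≤ 2*m+1) ∧ rt (m+1) b n ∈ S := by
    intro n; simp [hT]
  have hTcard : T.card = s - 2 := by
    have h1 := rot_card hb hb' S hS1
    have h2 := split_card m (fun n => rt (m+1) b n ∈ S) (fun n => rt (m+1) b n ∈ S)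
      (fun _ _ _ => Iff.rfl) m2 m3
    rw [h1, hcard] at h2
    change s = T.card + 2 at h2
    omega
  have h1T : 1 ∈ T := (memT _).2 ⟨by omega, m4⟩
  have hlT : 2*m+1 ∈ T := (memT _).2 ⟨by omega, m1⟩
  have hfc : (S.filter (fun n => nx (m+1) n ∈ S)).card =
      (T.filter (fun n => nx m n ∈ T)).card + 2 := by
    have h1 := rot_card hb hb' (S.filter (fun n => nx (m+1) n ∈ S))
      (fun n hn => hS1 n (Finset.mem_filter.1 hn).1)
    have e1 : nx (m+1) (rt (m+1) b (2*m+1)) = rt (m+1) b (2*m+2) := by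
      rw [← rt_nx hb hb' (by omega) (by omega)]; congr 1; unfold nx; split_ifs <;> omega
    have e2 : nx (m+1) (rt (m+1) b (2*m+2)) = rt (m+1) b (2*m+3) := by
      rw [← rt_nx hb hb' (by omega) (by omega)]; congr 1; unfold nx; split_ifs <;> omega
    have e3 : nx (m+1) (rt (m+1) b (2*m+3)) = rt (m+1) b 1 := by
      rw [← rt_nx hb hb' (by omega) (by omega)]; congr 1; unfold nx; split_ifs <;> omega
    have h2 := split_card m
      (fun n => rt (m+1) b n ∈ S.filter (fun n => nx (m+1) n ∈ S))
      (fun n => rt (m+1) b n ∈ S ∧ nx m n ∈ T) ?_ ?_ ?_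
    · rw [← h1, h2, hT, Finset.filter_filter]
    · intro n hn hn'
      rw [Finset.mem_filter]
      by_cases hl : n = 2*m+1
      · subst hl
        rw [e1]
        have : nx m (2*m+1) = 1 := by simp [nx]
        rw [this]; tauto
      · rw [← rt_nx hb hb' (by omega) (by omega)]
        have e : nx m n = n + 1 := by simp [nx, hl]
        have e' : nx (m+1) n = n + 1 := by unfold nx; split_ifs <;> omega
        rw [e, e', memT]
        have : 1 ≤ n + 1 ∧ n + 1 ≤ 2*m+1 := by omega
        tauto
    · rw [Finset.mem_filter, e2]; exact ⟨m2, m3⟩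
    · rw [Finset.mem_filter, e3]; exact ⟨m3, m4⟩
  have hne0 : ∀ (x : Fin (2*m+2)), x ≠ 0 ↔ (x : ℕ) ≠ 0 := by
    intro x; rw [Ne, Fin.ext_iff]; rfl
  refine ⟨hubGraph m (by omega) T, ?_, ?_⟩
  · intro i j hi hj
    simp [hubGraph, hi, hj]
  have hub0 : ∀ u, (hubGraph m (by omega) T).Adj 0 u ↔ (u : ℕ) ∈ T := by
    intro u
    have : (u : ℕ) ∈ T → u ≠ 0 := by
      intro h; rw [hne0]; have := (memT _).1 h; omega
    simp only [hubGraph]; simp; tauto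
  let p : Fin (2*m+2) := ⟨2*m+1, by omega⟩
  let q : Fin (2*m+2) := ⟨1, by omega⟩
  have hp0 : p ≠ 0 := by rw [hne0]; simp [p]
  have hq0 : q ≠ 0 := by rw [hne0]; simp [q]
  have hpq : p ≠ q := by rw [Ne, Fin.ext_iff]; simp [p, q]; omega
  have apq : (hubGraph m (by omega) T).Adj p q :=
    Or.inl ⟨hp0, hq0, by unfold consec; simp [p, q]⟩
  have a0p : (hubGraph m (by omega) T).Adj 0 p := (hub0 _).2 hlT
  have a0q : (hubGraph m (by omega) T).Adj 0 q := (hub0 _).2 h1T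
  refine ⟨{0, p, q}, p, q, ?_, by simp, by simp, apq, ?_, ?_⟩
  · intro x hx y hy hxy
    simp only [Finset.coe_insert, Finset.coe_singleton, Set.mem_insert_iff,
      Set.mem_singleton_iff] at hx hy
    rcases hx with rfl | rfl | rfl <;> rcases hy with rfl | rfl | rfl <;>
      first
      | exact absurd rfl hxy
      | assumption
      | (apply SimpleGraph.Adj.symm; assumption)
  · let g : Fin (2*m+2) ⊕ Fin 2 → Fin (2*(m+1)+2) := fun a => ⟨rt (m+1) b (vidx m a), by
      have h := vidx_lt m a
      unfold rt; split_ifs <;> omega⟩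
    have hginj : Function.Injective g := by
      intro a c h
      exact vidx_inj m (rt_inj hb hb' (vidx_lt m a) (vidx_lt m c) (Fin.ext_iff.1 h))
    have hgbij : Function.Bijective g := by
      rw [Fintype.bijective_iff_injective_and_card]
      exact ⟨hginj, by simp; ring⟩
    have hg0 : ∀ a, g a = 0 ↔ vidx m a = 0 := by
      intro a
      have h := vidx_lt m a
      rw [Fin.ext_iff]
      change rt (m+1) b (vidx m a) = 0 ↔ _
      unfold rt; split_ifs <;> omega
    have hgS : ∀ a, (g a : ℕ) ∈ S ↔ rt (m+1) b (vidx m a) ∈ S := fun a => Iff.rfl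
    have key0 : ∀ a c, vidx m a = 0 → (G.Adj (g a) (g c) ↔ rt (m+1) b (vidx m c) ∈ S) := by
      intro a c ha
      rw [(hg0 a).2 ha, hS]
    have key1 : ∀ a c, vidx m a ≠ 0 → vidx m c ≠ 0 → (G.Adj (g a) (g c) ↔
        nx (m+1) (vidx m a) = vidx m c ∨ nx (m+1) (vidx m c) = vidx m a) := by
      intro a c ha hc
      have ha' := mt (hg0 a).1 ha
      have hc' := mt (hg0 c).1 hc
      have la := vidx_lt m a
      have lc := vidx_lt m c
      have hx : ∀ n, n ≤ 2*(m+1)+1 → nx (m+1) n ≤ 2*(m+1)+1 := by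
        intro n hn; unfold nx; split_ifs <;> omega
      rw [hGC _ _ ha' hc', consec_iff (by omega) _ _ ha' hc']
      change nx (m+1) (rt (m+1) b (vidx m a)) = rt (m+1) b (vidx m c) ∨
        nx (m+1) (rt (m+1) b (vidx m c)) = rt (m+1) b (vidx m a) ↔ _
      rw [← rt_nx hb hb' (by omega) la, ← rt_nx hb hb' (by omega) lc]
      constructor
      · rintro (h | h)
        · exact Or.inl (rt_inj hb hb' (hx _ la) lc h)
        · exact Or.inr (rt_inj hb hb' (hx _ lc) la h)
      · rintro (h | h)
        · exact Or.inl (by rw [h])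
        · exact Or.inr (by rw [h])
    have hlr : ∀ x i, G.Adj (g (Sum.inl x)) (g (Sum.inr i)) ↔
        (cliqueSub (hubGraph m (by omega) T) {0, p, q} p q).Adj (Sum.inl x) (Sum.inr i) := by
      intro x i
      rw [cliqueSub_lr]
      by_cases hx : x = 0
      · subst hx
        rw [key0 _ _ rfl]
        simp only [hp0.symm, hq0.symm, Finset.mem_insert, true_or, false_or, ne_eq,
          not_false_eq_true, and_true]
        fin_cases i
        · simpa [vidx] using m2
        · simpa [vidx] using m3
      · have hx' := (hne0 x).1 hx
        rw [key1 (Sum.inl x) (Sum.inr i) hx' (by simp [vidx])]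
        have hxl := x.isLt
        have hK : ¬ (x ∈ ({0, p, q} : Finset (Fin (2*m+2))) ∧ x ≠ p ∧ x ≠ q) := by
          simp only [Finset.mem_insert, Finset.mem_singleton]; tauto
        simp only [hK, or_false]
        have e1 : x = p ↔ (x : ℕ) = 2*m+1 := Fin.ext_iff
        have e2 : x = q ↔ (x : ℕ) = 1 := Fin.ext_iff
        rw [e1, e2]
        have e3 : i = 0 ↔ (i : ℕ) = 0 := Fin.ext_iff
        have e4 : i = 1 ↔ (i : ℕ) = 1 := Fin.ext_iff
        rw [e3, e4]
        exact arith_lr m x i hm hx' hxl i.isLt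
    refine ⟨(RelIso.mk (Equiv.ofBijective g hgbij) ?_ :
      cliqueSub (hubGraph m (by omega) T) {0, p, q} p q ≃g G).symm⟩
    intro a c
    change G.Adj (g a) (g c) ↔ _
    rcases a with x | i <;> rcases c with y | j
    · rw [cliqueSub_ll]
      by_cases hx : x = 0
      · subst hx
        rw [key0 _ _ rfl, hub0, memT]
        have hyl := y.isLt
        simp only [hp0.symm, hq0.symm, false_and, or_false, not_false_eq_true, and_true, vidx]
        constructor
        · intro h
          refine ⟨⟨?_, by omega⟩, h⟩
          by_contra h0
          have h1 : (y : ℕ) = 0 := by omega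
          rw [h1] at h
          have := (hS1 _ h).1
          simp [rt] at this
        · exact fun h => h.2
      · by_cases hy : y = 0
        · subst hy
          rw [G.adj_comm (g _), (hubGraph m (by omega) T).adj_comm x, key0 (Sum.inl 0) _ rfl, hub0, memT]
          have hxl := x.isLt
          have hx' := (hne0 x).1 hx
          simp only [hp0.symm, hq0.symm, and_false, or_false, not_false_eq_true, and_true, vidx]
          exact ⟨fun h => ⟨by omega, h⟩, fun h => h.2⟩
        · have hx' := (hne0 x).1 hx
          have hy' := (hne0 y).1 hy
          rw [key1 (Sum.inl x) (Sum.inl y) hx' hy']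
          have hh : (hubGraph m (by omega) T).Adj x y ↔ consec m x y := by
            simp [hubGraph, hx, hy]
          rw [hh, consec_iff (by omega) _ _ hx hy]
          have e1 : x = p ↔ (x : ℕ) = 2*m+1 := Fin.ext_iff
          have e2 : x = q ↔ (x : ℕ) = 1 := Fin.ext_iff
          have e3 : y = p ↔ (y : ℕ) = 2*m+1 := Fin.ext_iff
          have e4 : y = q ↔ (y : ℕ) = 1 := Fin.ext_iff
          rw [e1, e2, e3, e4]
          have hxl := x.isLt
          have hyl := y.isLt
          exact arith_ll m x y hm hx' hy' hxl hyl
    · exact hlr x j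
    · rw [G.adj_comm (g (Sum.inr i)), (cliqueSub _ _ _ _).adj_comm (Sum.inr i)]
      exact hlr y i
    · rw [cliqueSub_rr, key1 _ _ (by simp [vidx]) (by simp [vidx])]
      have hi := i.isLt
      have hj := j.isLt
      have hij : i ≠ j ↔ (i : ℕ) ≠ (j : ℕ) := not_congr Fin.ext_iff
      rw [hij]
      exact arith_rr m i j hm hi hj
  · let w : Fin (s-2) → Fin (2*m+2) := fun i =>
      ⟨T.orderEmbOfFin hTcard i, by
        have := (memT _).1 (T.orderEmbOfFin_mem hTcard i); omega⟩
    have hw : ∀ i, (w i : ℕ) ∈ T := fun i => T.orderEmbOfFin_mem hTcard i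
    have hwm : StrictMono w := fun i j h => (T.orderEmbOfFin hTcard).strictMono h
    have hws : ∀ n ∈ T, ∃ i, (w i : ℕ) = n := by
      intro n hn
      have : n ∈ Set.range (T.orderEmbOfFin hTcard) := by
        rw [Finset.range_orderEmbOfFin]; exact hn
      exact this
    have hw0 : ∀ i, w i ≠ 0 := by
      intro i; rw [hne0]; have := (memT _).1 (hw i); omega
    refine ⟨w, hwm, hw0, fun i => (hub0 _).2 (hw i), ?_, ?_⟩
    · intro u hu
      obtain ⟨i, hi⟩ := hws _ ((hub0 u).1 hu)
      exact ⟨i, Fin.ext hi⟩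
    · rw [central_count w hwm hw0 T (fun n => ⟨hws n, by rintro ⟨i, rfl⟩; exact hw i⟩), hfc]
      omega

/-- If `G - 0 = C_{2k+1}` (`k ≥ 3`), `deg_G(0) = s ≥ 3` and `G` has three
consecutive `3`-central cycles, then `G` is obtained by a clique subdivision of
an edge from a graph `G'` on `{0,…,2(k-1)+1}` with `G' - 0 = C_{2k-1}`, two
fewer `3`-central cycles and `deg_{G'}(0) = s - 2`. -/
theorem stmt16 (k s : ℕ) (hk : 3 ≤ k) (hs : 3 ≤ s)
    (G : SimpleGraph (Fin (2*k+2)))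
    (hGC : ∀ i j : Fin (2*k+2), i ≠ 0 → j ≠ 0 → (G.Adj i j ↔ consec k i j))
    (v : Fin s → Fin (2*k+2)) (hmono : StrictMono v)
    (hne : ∀ i, v i ≠ 0) (hnbr : ∀ i, G.Adj 0 (v i))
    (hall : ∀ u : Fin (2*k+2), G.Adj 0 u → ∃ i, v i = u)
    (hthree : ∃ i j l : Fin s, (j : ℕ) = ((i : ℕ) + 1) % s ∧ (l : ℕ) = ((i : ℕ) + 2) % s ∧
      centralLen k s v i = 3 ∧ centralLen k s v j = 3 ∧ centralLen k s v l = 3) :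
    ∃ (G' : SimpleGraph (Fin (2*(k-1)+2))),
      (∀ i j : Fin (2*(k-1)+2), i ≠ 0 → j ≠ 0 → (G'.Adj i j ↔ consec (k-1) i j)) ∧
      ∃ (K : Finset (Fin (2*(k-1)+2))) (v₁ v₂ : Fin (2*(k-1)+2)),
        G'.IsClique ↑K ∧ v₁ ∈ K ∧ v₂ ∈ K ∧ G'.Adj v₁ v₂ ∧
        Nonempty (G ≃g cliqueSub G' K v₁ v₂) ∧
        ∃ w : Fin (s-2) → Fin (2*(k-1)+2), StrictMono w ∧ (∀ i, w i ≠ 0) ∧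
          (∀ i, G'.Adj 0 (w i)) ∧ (∀ u, G'.Adj 0 u → ∃ i, w i = u) ∧
          (Finset.univ.filter (fun i : Fin (s-2) => centralLen (k-1) (s-2) w i = 3)).card =
            (Finset.univ.filter (fun i : Fin s => centralLen k s v i = 3)).card - 2 := by
  obtain ⟨m, rfl⟩ : ∃ m, k = m + 1 := ⟨k - 1, by omega⟩
  obtain ⟨i, j, l, hj, hl, ci, cj, cl⟩ := hthree
  let S : Finset ℕ := Finset.univ.image (fun i => (v i : ℕ))
  have hS : ∀ n, n ∈ S ↔ ∃ i, (v i : ℕ) = n := by intro n; simp [S]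
  have hz : ∀ i, (v i : ℕ) ≠ 0 := fun i h => hne i (Fin.ext h)
  have vj := central_next v hmono hne i j hj ci
  have vl := central_next v hmono hne j l (by rw [hl, hj]; simp [Nat.add_assoc]) cj
  obtain ⟨t, vt⟩ := (central_iff v hmono hne l).1 cl
  have bi := (v i).isLt
  have bl := (v l).isLt
  have zl := hz l
  have zi := hz i
  have zj := hz j
  rw [central_count v hmono hne S hS]
  refine main_aux m s (by omega) G hGC S ?_ ?_ ?_ (v l) (by omega) (by omega) ?_ ?_ ?_ ?_
  · intro n hn
    obtain ⟨x, rfl⟩ := (hS n).1 hn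
    have := hz x
    have := (v x).isLt
    omega
  · intro u
    rw [hS]
    constructor
    · intro h
      obtain ⟨x, hx⟩ := hall u h
      exact ⟨x, by rw [hx]⟩
    · rintro ⟨x, hx⟩
      rw [← Fin.ext hx]; exact hnbr x
  · rw [Finset.card_image_of_injective _ (fun a b h => hmono.injective (Fin.ext h))]
    simp
  · refine (hS _).2 ⟨i, ?_⟩
    unfold nx at vj vl; unfold rt; split_ifs at * <;> omega
  · refine (hS _).2 ⟨j, ?_⟩
    unfold nx at vl; unfold rt; split_ifs at * <;> omega
  · refine (hS _).2 ⟨l, ?_⟩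
    unfold rt; split_ifs at * <;> omega
  · refine (hS _).2 ⟨t, ?_⟩
    unfold nx at vt; unfold rt; split_ifs at * <;> omega
end

section
/- Let G be a graph on {0,...,2k+1} with k ≥ 3, G - 0 = C_{2k+1}, and deg_G(0) ≥ 3, having at least two 4-central cycles. Then G can be obtained by a 1-stretching of a node from a graph G' on {0,...,2k-1} with G' - 0 = C_{2k-1}, where G' has one fewer 4-central cycle than G and deg_{G'}(0) = deg_G(0) - 1. -/
/-- The stretching of node `v` of `G` determined by `A₁, A₂ ⊆ Γ(v)`:
`v` is replaced by new nodes `v₁ = inr 0`, `v₂ = inr 1`, `u = inr 2`, where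
`vᵢ` is adjacent to `{u} ∪ Aᵢ`. -/
def stretch {V : Type*} (G : SimpleGraph V) (v : V) (A₁ A₂ : Set V) :
    SimpleGraph ({w : V // w ≠ v} ⊕ Fin 3) :=
  SimpleGraph.fromRel (fun a b =>
    (∃ x y : {w : V // w ≠ v}, a = Sum.inl x ∧ b = Sum.inl y ∧ G.Adj x y) ∨
    (∃ (x : {w : V // w ≠ v}) (i : Fin 3), a = Sum.inl x ∧ b = Sum.inr i ∧
      ((i = 0 ∧ (x : V) ∈ A₁) ∨ (i = 1 ∧ (x : V) ∈ A₂))) ∨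
    (∃ i : Fin 3, a = Sum.inr i ∧ b = Sum.inr 2 ∧ (i = 0 ∨ i = 1)))

theorem stretch_ll {V : Type*} (G : SimpleGraph V) (v : V) (A₁ A₂ : Set V)
    (x y : {w : V // w ≠ v}) :
    (stretch G v A₁ A₂).Adj (Sum.inl x) (Sum.inl y) ↔ G.Adj x y := by
  simp only [stretch, SimpleGraph.fromRel_adj]
  constructor
  · rintro ⟨_, h | h⟩
    · simpa using h
    · have : G.Adj y x := by simpa using h
      exact this.symm
  · intro h
    refine ⟨?_, Or.inl (Or.inl ⟨x, y, rfl, rfl, h⟩)⟩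
    intro e
    have := Sum.inl.inj e
    subst this
    exact G.loopless.irrefl _ h

theorem stretch_lr {V : Type*} (G : SimpleGraph V) (v : V) (A₁ A₂ : Set V)
    (x : {w : V // w ≠ v}) (i : Fin 3) :
    (stretch G v A₁ A₂).Adj (Sum.inl x) (Sum.inr i) ↔
      ((i = 0 ∧ (x : V) ∈ A₁) ∨ (i = 1 ∧ (x : V) ∈ A₂)) := by
  simp only [stretch, SimpleGraph.fromRel_adj]
  constructor
  · rintro ⟨_, (⟨_, _, _, h, _⟩ | ⟨x', i', h1, h2, h3⟩ | ⟨_, h, _⟩) |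
      (⟨_, _, h, _⟩ | ⟨_, _, h, _⟩ | ⟨_, _, h, _⟩)⟩
    · cases h
    · cases h1; cases h2; exact h3
    · cases h
    · cases h
    · cases h
    · cases h
  · intro h
    exact ⟨by simp, Or.inl (Or.inr (Or.inl ⟨x, i, rfl, rfl, h⟩))⟩

theorem stretch_rr {V : Type*} (G : SimpleGraph V) (v : V) (A₁ A₂ : Set V)
    (i j : Fin 3) :
    (stretch G v A₁ A₂).Adj (Sum.inr i) (Sum.inr j) ↔
      ((j = 2 ∧ i ≠ 2) ∨ (i = 2 ∧ j ≠ 2)) := by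
  simp only [stretch, SimpleGraph.fromRel_adj]
  fin_cases i <;> fin_cases j <;> simp

set_option maxHeartbeats 4000000 in
theorem aux (m t : ℕ) (hk : 2 ≤ m) (hs : 2 ≤ t)
    (G : SimpleGraph (Fin (2*(m+1)+2)))
    (hGC : ∀ i j : Fin (2*(m+1)+2), i ≠ 0 → j ≠ 0 → (G.Adj i j ↔ consec (m+1) i j))
    (v : Fin (t+1) → Fin (2*(m+1)+2)) (hmono : StrictMono v)
    (hne : ∀ i, v i ≠ 0) (hnbr : ∀ i, G.Adj 0 (v i))
    (hall : ∀ u : Fin (2*(m+1)+2), G.Adj 0 u → ∃ i, v i = u)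
    (hfour : 2 ≤ (Finset.univ.filter
      (fun i : Fin (t+1) => centralLen (m+1) (t+1) v i = 4)).card) :
    ∃ (G' : SimpleGraph (Fin (2*m+2))),
      (∀ i j : Fin (2*m+2), i ≠ 0 → j ≠ 0 → (G'.Adj i j ↔ consec m i j)) ∧
      ∃ (u : Fin (2*m+2)) (A₁ A₂ : Set (Fin (2*m+2))),
        A₁.Nonempty ∧ A₂.Nonempty ∧ A₁ ∪ A₂ = G'.neighborSet u ∧
        G'.IsClique (A₁ ∩ A₂) ∧ (A₁ ∩ A₂).ncard = 1 ∧
        Nonempty (G ≃g stretch G' u A₁ A₂) ∧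
        ∃ w : Fin t → Fin (2*m+2), StrictMono w ∧ (∀ i, w i ≠ 0) ∧
          (∀ i, G'.Adj 0 (w i)) ∧ (∀ x, G'.Adj 0 x → ∃ i, w i = x) ∧
          (Finset.univ.filter (fun i : Fin t => centralLen m t w i = 4)).card =
            (Finset.univ.filter
              (fun i : Fin (t+1) => centralLen (m+1) (t+1) v i = 4)).card - 1 := by
  -- a 4-central cycle that does not wrap around
  obtain ⟨i, hi4, hit⟩ : ∃ i : Fin (t+1), centralLen (m+1) (t+1) v i = 4 ∧ (i:ℕ) < t := by
    obtain ⟨x, hx, y, hy, hxy⟩ := Finset.one_lt_card.mp hfour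
    simp only [Finset.mem_filter, Finset.mem_univ, true_and] at hx hy
    by_cases h : (x:ℕ) < t
    · exact ⟨x, hx, h⟩
    · refine ⟨y, hy, ?_⟩
      have : (x:ℕ) ≠ y := fun e => hxy (Fin.ext e)
      omega
  have hlt : ∀ p q : Fin (t+1), (p:ℕ) < q → (v p : ℕ) < v q := fun p q h => hmono h
  -- vn : natural-number version of v
  obtain ⟨f, hf⟩ : ∃ f : ℕ → ℕ, ∀ j : Fin (t+1), (v j : ℕ) = f j :=
    ⟨fun n => if h : n < t+1 then (v ⟨n, h⟩ : ℕ) else 0, fun j => by beta_reduce; rw [dif_pos j.2]⟩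
  have hfl : ∀ p q, p < q → q < t+1 → f p < f q := by
    intro p q h1 h2
    have := hlt ⟨p, by omega⟩ ⟨q, h2⟩ h1
    simpa [hf] using this
  have hfpos : ∀ p, p < t+1 → 0 < f p ∧ f p < 2*m+4 := by
    intro p hp
    have h1 := hne ⟨p, hp⟩
    have h2 := (v ⟨p, hp⟩).2
    have h3 := hf ⟨p, hp⟩
    have : (v ⟨p, hp⟩ : ℕ) ≠ 0 := fun e => h1 (Fin.ext e)
    simp only at h3
    omega
  obtain ⟨i, hi⟩ := i
  simp only at hit
  obtain ⟨a, ha⟩ : ∃ a, a = f i := ⟨_, rfl⟩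
  have ha2 : f (i+1) = a + 2 := by
    have := hfl i (i+1) (by omega) (by omega)
    simp only [centralLen, hf] at hi4
    rw [dif_pos (by omega)] at hi4
    omega
  have ha0 := hfpos i hi
  have ha3 := hfpos (i+1) (by omega)
  obtain ⟨N, hN⟩ : ∃ N : ℕ → Prop, ∀ n, N n ↔ ∃ j, j < t+1 ∧ f j = n :=
    ⟨_, fun n => Iff.rfl⟩
  have hG0 : ∀ x : Fin (2*(m+1)+2), G.Adj 0 x ↔ N x := by
    intro x
    rw [hN]
    constructor
    · intro h
      obtain ⟨j, hj⟩ := hall x h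
      exact ⟨j, j.2, by rw [← hf, hj]⟩
    · rintro ⟨j, hj, e⟩
      have : v ⟨j, hj⟩ = x := Fin.ext (by rw [hf]; exact e)
      rw [← this]; exact hnbr _
  have hNa : N a := (hN _).2 ⟨i, hi, ha.symm⟩
  have hNa2 : N (a+2) := (hN _).2 ⟨i+1, by omega, ha2⟩
  have hN0 : ¬ N 0 := by
    rw [hN]; rintro ⟨j, hj, e⟩
    have := hfpos j hj
    omega
  have hNa1 : ¬ N (a+1) := by
    rw [hN]; rintro ⟨j, hj, e⟩
    rcases lt_trichotomy j i with h | h | h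
    · have := hfl j i h hi
      omega
    · subst h; omega
    · by_cases h' : j = i + 1
      · subst h'; omega
      · have := hfl (i+1) j (by omega) hj
        omega
  have hGadj : ∀ x y : Fin (2*(m+1)+2), G.Adj x y ↔
      (((x:ℕ) = 0 ∧ N y) ∨ ((y:ℕ) = 0 ∧ N x) ∨
      ((x:ℕ) ≠ 0 ∧ (y:ℕ) ≠ 0 ∧ consec (m+1) x y)) := by
    intro x y
    by_cases hx : x = 0
    · subst hx
      rw [hG0]
      simp [hN0]
    · by_cases hy : y = 0
      · subst hy
        rw [G.adj_comm, hG0]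
        simp [hN0]
      · rw [hGC x y hx hy]
        have hx' : (x:ℕ) ≠ 0 := fun e => hx (Fin.ext e)
        have hy' : (y:ℕ) ≠ 0 := fun e => hy (Fin.ext e)
        simp [hx', hy']
  clear hG0 hGC hfour hnbr hall
  -- the embedding of the contracted cycle
  obtain ⟨φ, hφ⟩ : ∃ φ : ℕ → ℕ, ∀ n, (n ≤ a → φ n = n) ∧ (a < n → φ n = n + 2) :=
    ⟨fun n => if n ≤ a then n else n + 2, fun n => by constructor <;> intro h <;> simp <;> omega⟩
  have hφ0 : φ 0 = 0 := (hφ 0).1 (by omega)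
  have hφa : φ a = a := (hφ a).1 (by omega)
  let G' : SimpleGraph (Fin (2*m+2)) :=
    { Adj := fun x y => (((x:ℕ) = 0 ∧ N (φ y)) ∨ ((y:ℕ) = 0 ∧ N (φ x)) ∨
        ((x:ℕ) ≠ 0 ∧ (y:ℕ) ≠ 0 ∧ consec m x y))
      symm := ⟨by
        intro x y h
        simp only [consec] at *
        tauto⟩
      loopless := ⟨by
        intro x h
        simp only [consec] at h
        rcases h with ⟨h1, h2⟩ | ⟨h1, h2⟩ | h
        · rw [h1, hφ0] at h2; exact hN0 h2
        · rw [h1, hφ0] at h2; exact hN0 h2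
        · omega⟩ }
  have hG' : ∀ x y : Fin (2*m+2), G'.Adj x y ↔ (((x:ℕ) = 0 ∧ N (φ y)) ∨ ((y:ℕ) = 0 ∧ N (φ x)) ∨
        ((x:ℕ) ≠ 0 ∧ (y:ℕ) ≠ 0 ∧ consec m x y)) := fun x y => Iff.rfl
  clear_value G'
  have hGzero : ∀ x : Fin (2*m+2), G'.Adj 0 x ↔ N (φ x) := by
    intro x
    rw [hG']
    simp [hφ0, hN0]
  have key0 : (A₀ : Fin (2*m+2)) → (A₀ = 0 ↔ (A₀:ℕ) = 0) := fun A₀ => Fin.ext_iff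
  let u : Fin (2*m+2) := ⟨a, by omega⟩
  let A₁ : Set (Fin (2*m+2)) := {x | (x:ℕ) = 0 ∨ ((x:ℕ) ≠ 0 ∧ (x:ℕ) + 1 = a) ∨ (a = 1 ∧ (x:ℕ) = 2*m+1)}
  let A₂ : Set (Fin (2*m+2)) := {x | (x:ℕ) = 0 ∨ (x:ℕ) = a + 1 ∨ (a = 2*m+1 ∧ (x:ℕ) = 1)}
  have hA : A₁ ∩ A₂ = {0} := by
    ext x
    simp only [A₁, A₂, Set.mem_inter_iff, Set.mem_ofPred_eq, Set.mem_singleton_iff, key0]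
    omega
  refine ⟨G', ?_, u, A₁, A₂, ⟨0, Or.inl rfl⟩, ⟨0, Or.inl rfl⟩, ?_, ?_, ?_, ?_, ?_⟩
  · intro x y hx hy
    rw [hG']
    have hx' : (x:ℕ) ≠ 0 := fun e => hx (Fin.ext e)
    have hy' : (y:ℕ) ≠ 0 := fun e => hy (Fin.ext e)
    simp [hx', hy']
  · ext x
    simp only [A₁, A₂, Set.mem_union, Set.mem_ofPred_eq, SimpleGraph.mem_neighborSet, hG', u,
      consec, hφa, hNa]
    by_cases hx : (x:ℕ) = 0
    · simp [hx]
    · simp only [hx, false_and, false_or, true_and, ne_eq, not_false_eq_true]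
      omega
  · rw [hA]; simp
  · rw [hA]; simp
  · -- the isomorphism
    let g : {x : Fin (2*m+2) // x ≠ u} ⊕ Fin 3 → Fin (2*(m+1)+2) :=
      Sum.elim (fun x => ⟨φ x.1, by
          have := hφ x.1
          have := x.1.2
          rcases Nat.lt_or_ge a x.1 with h | h <;> omega⟩)
        (fun j => ⟨if j = 0 then a else if j = 1 then a + 2 else a + 1, by split_ifs <;> omega⟩)
    have hgl : ∀ x, (g (Sum.inl x) : ℕ) = φ x.1 := fun x => rfl
    have hg0 : (g (Sum.inr 0) : ℕ) = a := rfl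
    have hg1 : (g (Sum.inr 1) : ℕ) = a + 2 := rfl
    have hg2 : (g (Sum.inr 2) : ℕ) = a + 1 := rfl
    clear_value g
    have hxa : ∀ x : {x : Fin (2*m+2) // x ≠ u}, (x.1:ℕ) ≠ a := fun x e => x.2 (Fin.ext e)
    have hφc : ∀ x : {x : Fin (2*m+2) // x ≠ u},
        ((x.1:ℕ) < a ∧ φ x.1 = x.1) ∨ (a < (x.1:ℕ) ∧ φ x.1 = x.1 + 2) := by
      intro x
      have := hφ x.1
      have := hxa x
      omega
    have hbij : Function.Bijective g := by
      constructor
      · rintro (x | p) (y | q) h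
        · have h := congrArg Fin.val h
          rw [hgl, hgl] at h
          have := hφc x
          have := hφc y
          congr 1
          apply Subtype.ext; apply Fin.ext
          omega
        · exfalso
          have h := congrArg Fin.val h
          have := hφc x
          fin_cases q <;> simp only [hgl, hg0, hg1, hg2, Fin.zero_eta, Fin.mk_one, Fin.reduceFinMk] at h <;> omega
        · exfalso
          have h := congrArg Fin.val h
          have := hφc y
          fin_cases p <;> simp only [hgl, hg0, hg1, hg2, Fin.zero_eta, Fin.mk_one, Fin.reduceFinMk] at h <;> omega
        · have h := congrArg Fin.val h
          fin_cases p <;> fin_cases q <;> simp only [hgl, hg0, hg1, hg2, Fin.zero_eta, Fin.mk_one, Fin.reduceFinMk] at h ⊢ <;> omega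
      · intro y
        have hy := y.2
        rcases Nat.lt_or_ge y a with h | h
        · refine ⟨Sum.inl ⟨⟨y, by omega⟩, fun e => ?_⟩, ?_⟩
          · have := congrArg Fin.val e
            simp only [u] at this
            omega
          · apply Fin.ext
            rw [hgl]
            exact (hφ y).1 (by omega)
        · by_cases h0 : (y:ℕ) = a
          · exact ⟨Sum.inr 0, Fin.ext (by rw [hg0, h0])⟩
          by_cases h1 : (y:ℕ) = a + 1
          · exact ⟨Sum.inr 2, Fin.ext (by rw [hg2, h1])⟩
          by_cases h2 : (y:ℕ) = a + 2
          · exact ⟨Sum.inr 1, Fin.ext (by rw [hg1, h2])⟩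
          refine ⟨Sum.inl ⟨⟨y - 2, by omega⟩, fun e => ?_⟩, ?_⟩
          · have := congrArg Fin.val e
            simp only [u] at this
            omega
          · apply Fin.ext
            rw [hgl]
            have := (hφ (y - 2)).2 (by omega)
            simp only
            omega
    have hlr : ∀ (x : {x : Fin (2*m+2) // x ≠ u}) (p : Fin 3),
        G.Adj (g (Sum.inl x)) (g (Sum.inr p)) ↔
          (stretch G' u A₁ A₂).Adj (Sum.inl x) (Sum.inr p) := by
      intro x p
      rw [stretch_lr, hGadj]
      have h1 := hφc x
      have h2 := x.1.2
      simp only [A₁, A₂, Set.mem_ofPred_eq, consec]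
      have haz : (a = 0) = False := by simp; omega
      have h01 : ((0 : Fin 3) = 1) = False := by simp
      have h10 : ((1 : Fin 3) = 0) = False := by simp
      have h20 : ((2 : Fin 3) = 0) = False := by simp
      have h21 : ((2 : Fin 3) = 1) = False := by simp
      fin_cases p <;> simp only [hgl, hg0, hg1, hg2, Fin.zero_eta, Fin.mk_one, Fin.reduceFinMk]
      · simp only [hNa, haz, h01, and_true, true_and, false_and, or_false, false_or]; omega
      · simp only [hNa2, h10, and_true, true_and, false_and, or_false, false_or,
          show (a + 2 = 0) = False by simp]; omega
      · simp only [hNa1, h20, h21, and_false, true_and, false_and, or_false, false_or,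
          show (a + 1 = 0) = False by simp, iff_false]; omega
    refine ⟨RelIso.symm (⟨Equiv.ofBijective g hbij, ?_⟩ : stretch G' u A₁ A₂ ≃g G)⟩
    intro p q
    simp only [Equiv.ofBijective_apply]
    rcases p with x | p <;> rcases q with y | q
    · rw [stretch_ll, hGadj, hG']
      simp only [hgl, consec]
      have h1 := hφc x
      have h2 := hφc y
      have h3 := x.1.2
      have h4 := y.1.2
      have e1 : φ x.1 = 0 ↔ (x.1:ℕ) = 0 := by omega
      have e2 : φ y.1 = 0 ↔ (y.1:ℕ) = 0 := by omega
      rw [e1, e2]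
      refine or_congr Iff.rfl (or_congr Iff.rfl ?_)
      omega
    · exact hlr x q
    · rw [G.adj_comm, (stretch G' u A₁ A₂).adj_comm]
      exact hlr y p
    · rw [stretch_rr, hGadj]
      simp only [consec]
      fin_cases p <;> fin_cases q <;> simp [hg0, hg1, hg2] <;> omega
  · -- the neighbours of the hub in the contracted graph
    obtain ⟨e, he⟩ : ∃ e : ℕ → ℕ, ∀ j, (j ≤ i → e j = f j) ∧ (i ≤ j → e j + 2 = f (j+1) ∨ ¬ j < t) := by
      refine ⟨fun j => if j ≤ i then f j else f (j+1) - 2, fun j => ⟨fun h => by simp [h], fun h => ?_⟩⟩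
      by_cases hj : j < t
      · left
        rcases Nat.eq_or_lt_of_le h with h | h
        · subst h; simp; omega
        · have := hfl (i+1) (j+1) (by omega) (by omega)
          simp only [show ¬ j ≤ i by omega, if_false]
          omega
      · exact Or.inr hj
    have he1 : ∀ j, j ≤ i → e j = f j := fun j => (he j).1
    have he2 : ∀ j, i ≤ j → j < t → e j + 2 = f (j+1) := by
      intro j h1 h2
      have := (he j).2 h1
      tauto
    have hea : e i = a := by rw [he1 i le_rfl, ha]
    have hel : ∀ p q, p < q → q < t → e p < e q := by
      intro p q h1 h2
      rcases Nat.lt_or_ge i q with h | h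
      · have h5 := he2 q (by omega) h2
        rcases Nat.lt_or_ge p i with h' | h'
        · have h3 := he1 p (by omega)
          have h4 := hfl p i h' (by omega)
          have h6 := hfl (i+1) (q+1) (by omega) (by omega)
          omega
        · have h3 := he2 p h' (by omega)
          have h4 := hfl (p+1) (q+1) (by omega) (by omega)
          omega
      · rw [he1 p (by omega), he1 q h]
        exact hfl p q h1 (by omega)
    have heb : ∀ p, p < t → 0 < e p ∧ e p < 2*m+2 := by
      intro p hp
      rcases Nat.lt_or_ge p i with h | h
      · have h1 := he1 p (by omega)
        have h2 := hfl p i h hi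
        have h3 := hfpos p (by omega)
        omega
      · have h1 := he2 p h hp
        have h3 := hfpos (p+1) (by omega)
        rcases Nat.eq_or_lt_of_le h with h' | h'
        · subst h'; omega
        · have := hel i p h' hp
          omega
    have hφe : ∀ p, p < t → (p ≤ i → φ (e p) = f p) ∧ (i < p → φ (e p) = f (p+1)) := by
      intro p hp
      constructor
      · intro h
        rw [he1 p h]
        apply (hφ _).1
        rcases Nat.eq_or_lt_of_le h with h' | h'
        · subst h'; omega
        · have := hfl p i h' hi
          omega
      · intro h
        rw [← he2 p (by omega) hp]
        apply (hφ _).2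
        have := hel i p h hp
        omega
    refine ⟨fun j => ⟨e j, (heb j j.2).2⟩, ?_, ?_, ?_, ?_, ?_⟩
    · intro p q h
      exact hel p q h q.2
    · intro p h
      have := congrArg Fin.val h
      have := heb p p.2
      simp at *
      omega
    · intro p
      rw [hGzero, hN]
      have := hφe p p.2
      rcases Nat.lt_or_ge i p with h | h
      · exact ⟨p+1, by omega, (this.2 h).symm⟩
      · exact ⟨p, by omega, (this.1 h).symm⟩
    · intro x hx
      rw [hGzero, hN] at hx
      obtain ⟨j, hj, hjx⟩ := hx
      rcases Nat.lt_or_ge i j with h | h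
      · have h4 := he2 (j-1) (by omega) (by omega)
        have h3 := hφe (j-1) (by omega)
        rw [show j - 1 + 1 = j by omega] at h3 h4
        refine ⟨⟨j-1, by omega⟩, Fin.ext ?_⟩
        have h1 := hφ x
        have h5 : a ≤ e (j-1) := by
          rcases Nat.eq_or_lt_of_le h with h' | h'
          · subst h'; simp [hea]
          · have := hel i (j-1) (by omega) (by omega)
            omega
        simp only
        omega
      · refine ⟨⟨j, by omega⟩, Fin.ext ?_⟩
        have h1 := hφ x
        have h2 := he1 j h
        have h5 : f j ≤ a := by
          rcases Nat.eq_or_lt_of_le h with h' | h'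
          · subst h'; omega
          · have := hfl j i h' hi
            omega
        simp only
        omega
    · have himg : (Finset.univ.filter
              (fun j : Fin (t+1) => centralLen (m+1) (t+1) v j = 4)) =
          insert (⟨i, hi⟩ : Fin (t+1)) ((Finset.univ.filter (fun j : Fin t =>
            centralLen m t (fun j => ⟨e j, (heb j j.2).2⟩) j = 4)).map
              (Fin.succAboveEmb (⟨i, hi⟩ : Fin (t+1)))) := by
        have hlen : ∀ j : Fin t, centralLen m t (fun j => ⟨e j, (heb j j.2).2⟩) j =
            centralLen (m+1) (t+1) v ((⟨i, hi⟩ : Fin (t+1)).succAbove j) := by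
          intro j
          have hj := j.2
          have e0 : e 0 = f 0 := he1 0 (by omega)
          simp only [centralLen, hf]
          rcases Nat.lt_or_ge j i with h | h
          · rw [Fin.succAbove_of_castSucc_lt _ _ (by simpa [Fin.lt_def] using h)]
            simp only [Fin.val_castSucc]
            rw [dif_pos (by omega), dif_pos (by omega), he1 _ h, he1 _ (by omega)]
          · rw [Fin.succAbove_of_le_castSucc _ _ (by simpa [Fin.le_def] using h)]
            simp only [Fin.val_succ]
            have h1 := he2 j h hj
            by_cases hjt : (j:ℕ) + 1 < t
            · rw [dif_pos hjt, dif_pos (by omega)]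
              have h2 := he2 (j+1) (by omega) hjt
              omega
            · rw [dif_neg hjt, dif_neg (by omega)]
              have := heb j hj
              omega
        ext j
        simp only [Finset.mem_filter, Finset.mem_univ, true_and, Finset.mem_insert,
          Finset.mem_map, hlen]
        constructor
        · intro h
          by_cases hji : j = ⟨i, hi⟩
          · exact Or.inl hji
          · right
            obtain ⟨l, hl⟩ := Fin.exists_succAbove_eq hji
            exact ⟨l, by rw [hl]; exact h, hl⟩
        · rintro (h | ⟨l, h1, h2⟩)
          · rw [h]; exact hi4
          · rw [← h2]; exact h1
      rw [himg, Finset.card_insert_of_notMem, Finset.card_map, Nat.add_sub_cancel]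
      simp [Fin.succAbove_ne]

/-- If `G - 0 = C_{2k+1}` (`k ≥ 3`), `deg_G(0) = s ≥ 3` and `G` has at least two
`4`-central cycles, then `G` is obtained by a `1`-stretching of a node from a
graph `G'` on `{0,…,2(k-1)+1}` with `G' - 0 = C_{2k-1}`, one fewer `4`-central
cycle and `deg_{G'}(0) = s - 1`. -/
theorem stmt17 (k s : ℕ) (hk : 3 ≤ k) (hs : 3 ≤ s)
    (G : SimpleGraph (Fin (2*k+2)))
    (hGC : ∀ i j : Fin (2*k+2), i ≠ 0 → j ≠ 0 → (G.Adj i j ↔ consec k i j))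
    (v : Fin s → Fin (2*k+2)) (hmono : StrictMono v)
    (hne : ∀ i, v i ≠ 0) (hnbr : ∀ i, G.Adj 0 (v i))
    (hall : ∀ u : Fin (2*k+2), G.Adj 0 u → ∃ i, v i = u)
    (hfour : 2 ≤ (Finset.univ.filter (fun i : Fin s => centralLen k s v i = 4)).card) :
    ∃ (G' : SimpleGraph (Fin (2*(k-1)+2))),
      (∀ i j : Fin (2*(k-1)+2), i ≠ 0 → j ≠ 0 → (G'.Adj i j ↔ consec (k-1) i j)) ∧
      ∃ (u : Fin (2*(k-1)+2)) (A₁ A₂ : Set (Fin (2*(k-1)+2))),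
        A₁.Nonempty ∧ A₂.Nonempty ∧ A₁ ∪ A₂ = G'.neighborSet u ∧
        G'.IsClique (A₁ ∩ A₂) ∧ (A₁ ∩ A₂).ncard = 1 ∧
        Nonempty (G ≃g stretch G' u A₁ A₂) ∧
        ∃ w : Fin (s-1) → Fin (2*(k-1)+2), StrictMono w ∧ (∀ i, w i ≠ 0) ∧
          (∀ i, G'.Adj 0 (w i)) ∧ (∀ x, G'.Adj 0 x → ∃ i, w i = x) ∧
          (Finset.univ.filter (fun i : Fin (s-1) => centralLen (k-1) (s-1) w i = 4)).card =
            (Finset.univ.filter (fun i : Fin s => centralLen k s v i = 4)).card - 1 := by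
  obtain ⟨m, rfl⟩ : ∃ m, k = m + 1 := ⟨k - 1, by omega⟩
  obtain ⟨t, rfl⟩ : ∃ t, s = t + 1 := ⟨s - 1, by omega⟩
  exact aux m t (by omega) (by omega) G hGC v hmono hne hnbr hall hfour
end

section
/- Let G be a properly fs-perfect graph that is also LS_+-perfect. Then G is the complete join of a (possibly empty) complete graph and a minimally imperfect graph. -/
noncomputable def cliqueNum {V : Type*} (G : SimpleGraph V) : ℕ :=
  sSup {n | ∃ s : Finset V, G.IsNClique n s}

noncomputable def PerfectG {V : Type*} (G : SimpleGraph V) : Prop :=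
  ∀ A : Set V, (G.induce A).chromaticNumber = (cliqueNum (G.induce A) : ℕ∞)

noncomputable def MinImperfect {V : Type*} (G : SimpleGraph V) : Prop :=
  ¬ PerfectG G ∧ ∀ v : V, PerfectG (G.induce {u | u ≠ v})

def QSTABset {V : Type*} [Fintype V] (G : SimpleGraph V) : Set (V → ℝ) :=
  {x | (∀ v, 0 ≤ x v) ∧ ∀ K : Finset V, G.IsClique ↑K → ∑ v ∈ K, x v ≤ 1}

noncomputable def FsPerfect {V : Type*} [Fintype V] (G : SimpleGraph V) : Prop :=
  STAB G = QSTABset G ∨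
    ∃ (a : V → ℝ) (β : ℝ), (∀ v, a v ≠ 0) ∧
      STAB G = QSTABset G ∩ {x | ∑ v, a v * x v ≤ β}

namespace Fs

open Finset

/-- combinatorial form of `χ = ω` for the subgraph induced by `C` -/
def Good {V : Type*} (G : SimpleGraph V) (C : Set V) : Prop :=
  ∃ s : Finset V, (s : Set V) ⊆ C ∧ G.IsClique (s : Set V) ∧ ∃ c : V → ℕ,
    (∀ v ∈ C, c v < s.card) ∧ ∀ u ∈ C, ∀ v ∈ C, G.Adj u v → c u ≠ c v

lemma good_univ_iff {V : Type*} [Finite V] (G : SimpleGraph V) :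
    G.chromaticNumber = (cliqueNum G : ℕ∞) ↔ Good G Set.univ := by
  classical
  have := Fintype.ofFinite V
  have hbdd : BddAbove {n | ∃ s : Finset V, G.IsNClique n s} := by
    refine ⟨Fintype.card V, ?_⟩
    rintro n ⟨s, hs⟩
    rw [← hs.card_eq]; exact Finset.card_le_univ s
  constructor
  · intro h
    have hmem : cliqueNum G ∈ {n | ∃ s : Finset V, G.IsNClique n s} := by
      apply Nat.sSup_mem _ hbdd
      exact ⟨0, ∅, by simp⟩
    obtain ⟨s, hs⟩ := hmem
    have hc : G.Colorable (cliqueNum G) := by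
      rw [← SimpleGraph.chromaticNumber_le_iff_colorable, h]
    obtain ⟨c⟩ := hc
    refine ⟨s, by simp, hs.isClique, fun v => c v, ?_, ?_⟩
    · intro v _
      rw [hs.card_eq]; exact (c v).2
    · intro u _ v _ huv h
      exact c.valid huv (Fin.ext h)
  · rintro ⟨s, -, hs, c, hc1, hc2⟩
    have hc : G.Colorable s.card :=
      ⟨SimpleGraph.Coloring.mk (fun v => ⟨c v, hc1 v trivial⟩) (by
        intro u v huv h
        exact hc2 u trivial v trivial huv (by simpa using h))⟩
    have e1 : G.chromaticNumber = s.card := by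
      apply le_antisymm hc.chromaticNumber_le
      exact hs.card_le_chromaticNumber
    have e2 : cliqueNum G = s.card := by
      apply le_antisymm
      · apply csSup_le (s := {n | ∃ s : Finset V, G.IsNClique n s}) ⟨0, ∅, by simp⟩
        rintro n ⟨t, ht⟩
        rw [← ht.card_eq]
        have := ht.isClique.card_le_chromaticNumber
        rw [e1] at this
        exact_mod_cast this
      · exact le_csSup hbdd ⟨s, hs, rfl⟩
    rw [e1, e2]

lemma good_induce {V : Type*} (G : SimpleGraph V) (A : Set V) (C : Set A) :
    Good (G.induce A) C ↔ Good G (Subtype.val '' C) := by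
  classical
  constructor
  · rintro ⟨s, h1, h2, c, h3, h4⟩
    refine ⟨s.map (Function.Embedding.subtype _), ?_, ?_, fun v => if h : v ∈ A then c ⟨v, h⟩ else 0, ?_, ?_⟩
    · intro x hx
      simp only [coe_map, Function.Embedding.subtype_apply, Set.mem_image] at hx
      obtain ⟨y, hy, rfl⟩ := hx
      exact ⟨y, h1 hy, rfl⟩
    · intro x hx y hy hxy
      simp only [coe_map, Function.Embedding.subtype_apply, Set.mem_image] at hx hy
      obtain ⟨x, hx, rfl⟩ := hx
      obtain ⟨y, hy, rfl⟩ := hy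
      exact h2 hx hy (fun h => hxy (by rw [h]))
    · rintro _ ⟨v, hv, rfl⟩
      simpa using h3 v hv
    · rintro _ ⟨u, hu, rfl⟩ _ ⟨v, hv, rfl⟩ huv
      simpa using h4 u hu v hv huv
  · rintro ⟨s, h1, h2, c, h3, h4⟩
    have hsA : ∀ x ∈ s, x ∈ A := by
      intro x hx
      obtain ⟨y, -, rfl⟩ := h1 hx
      exact y.2
    refine ⟨s.subtype (· ∈ A), ?_, ?_, fun v => c v, ?_, ?_⟩
    · intro x hx
      simp only [Finset.mem_coe, Finset.mem_subtype] at hx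
      obtain ⟨y, hy, h⟩ := h1 hx
      rwa [← Subtype.ext h]
    · intro x hx y hy hxy
      simp only [Finset.mem_coe, Finset.mem_subtype] at hx hy
      exact h2 hx hy (fun h => hxy (Subtype.ext h))
    · intro v hv
      rw [Finset.card_subtype, Finset.filter_true_of_mem hsA]
      exact h3 v ⟨v, hv, rfl⟩
    · intro u hu v hv huv
      exact h4 u ⟨u, hu, rfl⟩ v ⟨v, hv, rfl⟩ huv

lemma perfect_iff {V : Type*} [Finite V] (G : SimpleGraph V) :
    PerfectG G ↔ ∀ C : Set V, Good G C := by
  unfold PerfectG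
  refine forall_congr' fun C => ?_
  rw [good_univ_iff, good_induce, Set.image_univ, Subtype.range_val]

lemma minImperfect_of {V : Type*} [Finite V] (G : SimpleGraph V) (A : Set V)
    (h : ¬ Good G A) (hmin : ∀ C, C ⊂ A → Good G C) : MinImperfect (G.induce A) := by
  refine ⟨?_, ?_⟩
  · intro hp
    rw [perfect_iff] at hp
    have := hp Set.univ
    rw [good_induce, Set.image_univ, Subtype.range_val] at this
    exact h this
  · intro v
    rw [perfect_iff]
    intro C
    rw [good_induce, good_induce]
    apply hmin
    refine ⟨?_, ?_⟩
    · rintro _ ⟨y, -, rfl⟩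
      exact y.2
    · intro hh
      obtain ⟨y, ⟨z, hz, rfl⟩, hy⟩ := hh v.2
      exact z.2 (Subtype.ext hy)

lemma exists_min {V : Type*} [Fintype V] (G : SimpleGraph V) (h : ¬ PerfectG G) :
    ∃ A : Finset V, ¬ Good G A ∧ ∀ C : Set V, C ⊂ A → Good G C := by
  classical
  rw [perfect_iff] at h
  push Not at h
  obtain ⟨C, hC⟩ := h
  have hne : (Finset.univ.filter (fun A : Finset V => ¬ Good G A)).Nonempty :=
    ⟨C.toFinset, by simpa using hC⟩
  obtain ⟨A, hA, hAm⟩ := Finset.exists_min_image _ Finset.card hne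
  refine ⟨A, by simpa using hA, ?_⟩
  intro D hD
  by_contra hcon
  have := hAm D.toFinset (by simpa using hcon)
  have h2 : D.toFinset ⊂ A := by
    rw [← Finset.coe_ssubset]; simpa using hD
  exact absurd (Finset.card_lt_card h2) (by omega)

/-- the structure of minimally imperfect graphs that we need -/
lemma struct {V : Type} [Fintype V] [DecidableEq V] (G : SimpleGraph V) (A : Finset V)
    (hA : ¬ Good G A) (hmin : ∀ C : Set V, C ⊂ A → Good G C) :
    ∃ (α ω : ℕ) (ι : Type) (_ : Fintype ι) (S : ι → Finset V),
      1 ≤ α ∧ 2 ≤ ω ∧ Fintype.card ι = α * ω + 1 ∧ A.card = α * ω + 1 ∧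
      (∀ i, S i ⊆ A) ∧ (∀ i, IsStable G (S i : Set V)) ∧ (∀ i, (S i).card = α) ∧
      (∀ R : Finset V, R ⊆ A → IsStable G (R : Set V) → R.card ≤ α) ∧
      (∀ K : Finset V, K ⊆ A → G.IsClique (K : Set V) → K.card ≤ ω) ∧
      (∀ v ∈ A, ∑ i, (if v ∈ S i then (1 : ℝ) else 0) = α) ∧
      (∀ f : V → ℝ, ∃ γ : ι → ℝ, ∀ v ∈ A, ∑ i, γ i * (if v ∈ S i then (1 : ℝ) else 0) = f v) := by
  classical
  have hmin' : ∀ C : Finset V, C ⊂ A → Good G C := fun C hC => hmin C (by exact_mod_cast hC)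
  obtain ⟨K0, hK0, hK0m⟩ := Finset.exists_max_image
    (A.powerset.filter (fun K : Finset V => G.IsClique (K : Set V))) Finset.card ⟨∅, by simp⟩
  obtain ⟨S0, hS0, hS0m⟩ := Finset.exists_max_image
    (A.powerset.filter (fun K : Finset V => IsStable G (K : Set V))) Finset.card ⟨∅, by simp [IsStable]⟩
  simp only [Finset.mem_filter, Finset.mem_powerset, and_imp] at hK0 hK0m hS0 hS0m
  obtain ⟨hK0A, hK0c⟩ := hK0
  obtain ⟨hS0A, hS0s⟩ := hS0
  set ω := K0.card with hω
  set α := S0.card with hα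
  have nocol : ¬ ∃ c : V → ℕ, (∀ v ∈ A, c v < ω) ∧ ∀ u ∈ A, ∀ v ∈ A, G.Adj u v → c u ≠ c v := by
    rintro ⟨c, h1, h2⟩
    exact hA ⟨K0, by exact_mod_cast hK0A, hK0c, c, h1, h2⟩
  have hAne : A.Nonempty := by
    rw [Finset.nonempty_iff_ne_empty]
    rintro rfl
    exact nocol ⟨fun _ => 0, by simp, by simp⟩
  obtain ⟨a0, ha0⟩ := hAne
  have hω1 : 1 ≤ ω := by
    have := hK0m {a0} (by simpa using ha0) (by simp)
    simpa using this
  have hα1 : 1 ≤ α := by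
    have := hS0m {a0} (by simpa using ha0) (by simp [IsStable])
    simpa using this
  have hω2 : 2 ≤ ω := by
    by_contra hlt
    apply nocol
    refine ⟨fun _ => 0, fun v _ => hω1, ?_⟩
    intro u hu v hv huv
    have h2 := hK0m {u, v} (by simp [Finset.insert_subset_iff, hu, hv]) (by
      simp [SimpleGraph.isClique_iff, huv])
    rw [Finset.card_pair huv.ne] at h2
    omega
  have hcol : ∀ v : S0, ∃ c : V → ℕ, (∀ u ∈ A.erase v, c u < ω) ∧
      ∀ u ∈ A.erase v, ∀ u' ∈ A.erase v, G.Adj u u' → c u ≠ c u' := by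
    intro v
    obtain ⟨s, hs1, hs2, c, hc1, hc2⟩ := hmin' (A.erase v) (Finset.erase_ssubset (hS0A v.2))
    refine ⟨c, ?_, ?_⟩
    · intro u hu
      have hs1' : s ⊆ A.erase v := by exact_mod_cast hs1
      exact lt_of_lt_of_le (hc1 u (by exact_mod_cast hu))
        (hK0m s (hs1'.trans (Finset.erase_subset _ _)) hs2)
    · intro u hu u' hu'
      exact hc2 u (by exact_mod_cast hu) u' (by exact_mod_cast hu')
  choose c hc1 hc2 using hcol
  let S : Option (S0 × Fin ω) → Finset V := fun o =>
    o.elim S0 (fun p => (A.erase p.1).filter (fun u => c p.1 u = p.2))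
  have hSA : ∀ i, S i ⊆ A := by
    rintro (_ | ⟨v, k⟩)
    · exact hS0A
    · exact (Finset.filter_subset _ _).trans (Finset.erase_subset _ _)
  have hSs : ∀ i, IsStable G (S i : Set V) := by
    rintro (_ | ⟨v, k⟩)
    · exact hS0s
    · intro x hx y hy hxy
      simp only [S, Option.elim, Finset.mem_coe, Finset.mem_filter] at hx hy
      exact hc2 v x hx.1 y hy.1 hxy (hx.2.trans hy.2.symm)
  have hcard : Fintype.card (Option (S0 × Fin ω)) = α * ω + 1 := by
    simp [hα]
  have hcount : ∀ v ∈ A, ∑ i, (if v ∈ S i then (1 : ℝ) else 0) = α := by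
    intro u hu
    rw [Fintype.sum_option, Fintype.sum_prod_type]
    have : ∀ v : S0, ∑ k : Fin ω, (if u ∈ S (some (v, k)) then (1 : ℝ) else 0)
        = if u = v then 0 else 1 := by
      intro v
      by_cases huv : u = v
      · simp [S, huv]
      · have hlt : c v u < ω := hc1 v u (by simp [huv, hu])
        rw [Finset.sum_eq_single (⟨c v u, hlt⟩ : Fin ω)]
        · simp [S, huv, hu]
        · intro k _ hk
          have : c v u ≠ k := fun h => hk (Fin.ext h.symm)
          simp [S, this]
        · simp
    simp only [this]
    have e : ∑ v : S0, (if u = (v : V) then (0 : ℝ) else 1)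
        = ∑ v ∈ S0, (if u = v then (0 : ℝ) else 1) :=
      Finset.sum_coe_sort S0 (fun v => if u = v then (0 : ℝ) else 1)
    rw [e]
    have e2 : ∀ v ∈ S0, (if u = v then (0 : ℝ) else 1) = 1 - (if u = v then (1 : ℝ) else 0) := by
      intro v _; split_ifs <;> simp
    rw [Finset.sum_congr rfl e2, Finset.sum_sub_distrib, Finset.sum_ite_eq]
    simp only [S, Option.elim, Finset.sum_const, nsmul_eq_mul, mul_one, hα]
    by_cases huS : u ∈ S0 <;> simp [huS]
  have hle1 : ∀ K : Finset V, K ⊆ A → G.IsClique (K : Set V) → ∀ i,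
      ∑ v ∈ K, (if v ∈ S i then (1 : ℝ) else 0) ≤ 1 := by
    intro K _ hK i
    rw [Finset.sum_boole]
    have : (K.filter (fun v => v ∈ S i)).card ≤ 1 := by
      rw [Finset.card_le_one]
      intro x hx y hy
      by_contra hxy
      simp only [Finset.mem_filter] at hx hy
      exact hSs i x hx.2 y hy.2 (hK hx.1 hy.1 hxy)
    exact_mod_cast this
  have hKex : ∀ i, ∃ K : Finset V, K ⊆ A ∧ G.IsClique (K : Set V) ∧ K.card = ω ∧
      ∀ v ∈ K, v ∉ S i := by
    intro i
    by_cases hemp : S i = ∅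
    · exact ⟨K0, hK0A, hK0c, rfl, by simp [hemp]⟩
    · have hss : A \ S i ⊂ A := by
        apply Finset.sdiff_ssubset (hSA i) (Finset.nonempty_iff_ne_empty.2 hemp)
      obtain ⟨s, hs1, hs2, d, hd1, hd2⟩ := hmin' _ hss
      have hs1' : s ⊆ A \ S i := by exact_mod_cast hs1
      refine ⟨s, hs1'.trans Finset.sdiff_subset, hs2, ?_, fun v hv => (Finset.mem_sdiff.1 (hs1' hv)).2⟩
      by_contra hne
      have hlt : s.card < ω := lt_of_le_of_ne (hK0m s (hs1'.trans Finset.sdiff_subset) hs2) hne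
      apply nocol
      refine ⟨fun v => if v ∈ S i then s.card else d v, ?_, ?_⟩
      · intro v hv
        by_cases h : v ∈ S i
        · simp [h, hlt]
        · have := hd1 v (by simp [hv, h])
          simp only [h, if_false]; omega
      · intro u hu v hv huv
        by_cases h : u ∈ S i <;> by_cases h' : v ∈ S i
        · exact absurd huv (hSs i u h v h')
        · have := hd1 v (by simp [hv, h'])
          simp only [h, h', if_true, if_false]; omega
        · have := hd1 u (by simp [hu, h])
          simp only [h, h', if_true, if_false]; omega
        · simp only [h, h', if_false]
          exact hd2 u (by simp [hu, h]) v (by simp [hv, h']) huv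
  choose K hKA hKc hKcard hKd using hKex
  have hprod : ∀ i j, ∑ v ∈ K i, (if v ∈ S j then (1 : ℝ) else 0) = if i = j then 0 else 1 := by
    intro i
    have hz : ∑ v ∈ K i, (if v ∈ S i then (1 : ℝ) else 0) = 0 :=
      Finset.sum_eq_zero (fun v hv => by simp [hKd i v hv])
    have htot : ∑ j, ∑ v ∈ K i, (if v ∈ S j then (1 : ℝ) else 0) = α * ω := by
      rw [Finset.sum_comm, Finset.sum_congr rfl (fun v hv => hcount v (hKA i hv))]
      simp [hKcard]; ring
    have htot2 : ∑ j : Option (S0 × Fin ω), (if i = j then (0 : ℝ) else 1) = α * ω := by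
      have e2 : ∀ j ∈ Finset.univ, (if i = j then (0 : ℝ) else 1) = 1 - (if i = j then (1 : ℝ) else 0) := by
        intro v _; split_ifs <;> simp
      rw [Finset.sum_congr rfl e2, Finset.sum_sub_distrib, Finset.sum_ite_eq]
      simp [-Fintype.card_option, hcard]
    have hle : ∀ j ∈ Finset.univ, ∑ v ∈ K i, (if v ∈ S j then (1 : ℝ) else 0) ≤
        (if i = j then 0 else 1) := by
      intro j _
      by_cases h : i = j
      · subst h; simp only [if_true]; exact hz.le
      · simp only [h, if_false]; exact hle1 (K i) (hKA i) (hKc i) j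
    intro j
    exact (Finset.sum_eq_sum_iff_of_le hle).1 (htot.trans htot2.symm) j (Finset.mem_univ j)
  let M : (Option (S0 × Fin ω) → ℝ) →ₗ[ℝ] (A → ℝ) :=
    { toFun := fun γ v => ∑ i, γ i * (if (v : V) ∈ S i then (1 : ℝ) else 0)
      map_add' := by
        intro x y; ext v; simp only [Pi.add_apply, add_mul, Finset.sum_add_distrib]
      map_smul' := by
        intro r x; ext v; simp only [Pi.smul_apply, smul_eq_mul, Finset.mul_sum, mul_assoc, RingHom.id_apply] }
  have hMinj : Function.Injective M := by
    rw [← LinearMap.ker_eq_bot, LinearMap.ker_eq_bot']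
    intro γ hγ
    have hv : ∀ v ∈ A, ∑ i, γ i * (if v ∈ S i then (1 : ℝ) else 0) = 0 := by
      intro v hv
      exact congrFun hγ ⟨v, hv⟩
    have hi : ∀ i, γ i = ∑ j, γ j := by
      intro i
      have h0 : ∑ v ∈ K i, ∑ j, γ j * (if v ∈ S j then (1 : ℝ) else 0) = 0 :=
        Finset.sum_eq_zero (fun v hv' => hv v (hKA i hv'))
      rw [Finset.sum_comm] at h0
      simp only [← Finset.mul_sum, hprod] at h0
      have e2 : ∀ j ∈ Finset.univ, γ j * (if i = j then (0 : ℝ) else 1) = γ j - (if i = j then γ j else 0) := by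
        intro v _; split_ifs <;> simp
      rw [Finset.sum_congr rfl e2, Finset.sum_sub_distrib, Finset.sum_ite_eq] at h0
      simp only [Finset.mem_univ, if_true] at h0
      linarith
    have hg : ∑ j, γ j = 0 := by
      have : ∑ j, γ j = (α * ω + 1 : ℝ) * ∑ j, γ j := by
        conv_lhs => rw [Finset.sum_congr rfl (fun j _ => hi j)]
        rw [Finset.sum_const, Finset.card_univ, hcard, nsmul_eq_mul]
        push_cast; ring
      have hpos : (0 : ℝ) < α * ω := by
        have : 0 < α * ω := Nat.mul_pos hα1 hω1
        exact_mod_cast this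
      have h3 : (α * ω : ℝ) * ∑ j, γ j = 0 := by linarith
      rcases mul_eq_zero.1 h3 with h | h
      · exact absurd h hpos.ne'
      · exact h
    ext i
    rw [hi i, hg]; rfl
  have hge : α * ω + 1 ≤ A.card := by
    have := LinearMap.finrank_le_finrank_of_injective hMinj
    simpa [-Fintype.card_option, hcard] using this
  have hsum : ∑ i, ((S i).card : ℝ) = α * A.card := by
    have : ∑ v ∈ A, ∑ i, (if v ∈ S i then (1 : ℝ) else 0) = α * A.card := by
      rw [Finset.sum_congr rfl hcount]; simp; ring
    rw [← this, Finset.sum_comm]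
    refine Finset.sum_congr rfl fun i _ => ?_
    rw [Finset.sum_boole, Finset.filter_mem_eq_inter, Finset.inter_eq_right.2 (hSA i)]
  have hSle : ∀ i ∈ Finset.univ, ((S i).card : ℝ) ≤ α := by
    intro i _
    exact_mod_cast hS0m (S i) (hSA i) (hSs i)
  have hsumα : ∑ i : Option (S0 × Fin ω), (α : ℝ) = α * (α * ω + 1) := by
    rw [Finset.sum_const, Finset.card_univ, hcard, nsmul_eq_mul]; push_cast; ring
  have hAcard : A.card = α * ω + 1 := by
    apply le_antisymm _ hge
    have h1 := Finset.sum_le_sum hSle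
    rw [hsum, hsumα] at h1
    have h2 : α * A.card ≤ α * (α * ω + 1) := by exact_mod_cast h1
    exact Nat.le_of_mul_le_mul_left h2 hα1
  have hScard : ∀ i, (S i).card = α := by
    intro i
    have : ∑ i, ((S i).card : ℝ) = ∑ i : Option (S0 × Fin ω), (α : ℝ) := by
      rw [hsum, hsumα, hAcard]; push_cast; ring
    exact_mod_cast (Finset.sum_eq_sum_iff_of_le hSle).1 this i (Finset.mem_univ i)
  have hMsurj : Function.Surjective M := by
    refine (LinearMap.injective_iff_surjective_of_finrank_eq_finrank ?_).1 hMinj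
    simp [-Fintype.card_option, hcard, hAcard]
  refine ⟨α, ω, _, inferInstance, S, hα1, hω2, hcard, hAcard, hSA, hSs, hScard, hS0m, hK0m, hcount, ?_⟩
  intro f
  obtain ⟨γ, hγ⟩ := hMsurj (fun v => f v)
  exact ⟨γ, fun v hv => congrFun hγ ⟨v, hv⟩⟩

lemma params (b N Γ : ℝ) (hb0 : 0 < b) (hb1 : b < 1) (hN : 1 ≤ N) (hΓ : 0 ≤ Γ) :
    ∃ ε δ : ℝ, 0 < ε ∧ 0 < δ ∧ δ < 1 ∧ δ < b * ε ∧ ε ≤ (1 - δ) / N ∧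
      ε * (b ^ 2 / δ + Γ / ((1 - δ) / N)) ≤ 1 := by
  set κ := (b ^ 2 + b) / 2 with hκ
  set ρ := (1 - b) / (1 + b) with hρ
  set ε := ρ / (2 * N * (Γ + 1)) with hε
  have hρ0 : 0 < ρ := div_pos (by linarith) (by linarith)
  have hρ1 : ρ ≤ 1 := by
    rw [hρ, div_le_one (by linarith)]; linarith
  have hκ0 : 0 < κ := by positivity
  have hκb : κ < b := by rw [hκ]; nlinarith
  have hε0 : 0 < ε := by positivity
  have hεN : ε * (2 * N * (Γ + 1)) = ρ := by
    rw [hε]; field_simp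
  have hεN1 : ε * N ≤ 1 / 2 := by nlinarith [mul_nonneg (mul_nonneg hε0.le (by linarith : 0 ≤ N)) hΓ]
  have hε1 : ε ≤ 1 / 2 := by nlinarith
  have hδ : κ * ε ≤ 1 / 2 := by nlinarith
  have hδ' : 0 < 1 - κ * ε := by linarith
  refine ⟨ε, κ * ε, hε0, by positivity, by linarith, by nlinarith, ?_, ?_⟩
  · rw [le_div_iff₀ (by linarith)]; linarith
  · have e1 : ε * (b ^ 2 / (κ * ε)) = 1 - ρ := by
      rw [hκ, hρ]; field_simp; ring
    have e2 : ε * (Γ / ((1 - κ * ε) / N)) ≤ ρ := by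
      have : ε * (Γ / ((1 - κ * ε) / N)) = (ε * Γ * N) / (1 - κ * ε) := by
        field_simp
      rw [this, div_le_iff₀ hδ']
      have : ε * Γ * N ≤ ρ / 2 := by nlinarith [mul_pos hε0 (by linarith : 0 < N)]
      nlinarith
    rw [mul_add]; linarith

lemma mem_cone {V : Type} (G : SimpleGraph V) (z : Option V → ℝ) (h0 : 0 ≤ z none)
    (h1 : ∀ v, 0 ≤ z (some v)) (h2 : ∀ v, z (some v) ≤ z none)
    (h3 : ∀ u v, G.Adj u v → z (some u) + z (some v) ≤ z none) : z ∈ coneK (FRAC G) := by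
  rcases h0.eq_or_lt with h | h
  · refine ⟨0, le_rfl, 0, ⟨by simp, by simp⟩, h.symm, ?_⟩
    intro i
    have := h1 i
    have := h2 i
    rw [zero_mul]; linarith
  · refine ⟨z none, h0, fun v => z (some v) / z none, ⟨?_, ?_⟩, rfl, ?_⟩
    · intro v
      exact ⟨div_nonneg (h1 v) h0, by rw [div_le_one h]; exact h2 v⟩
    · intro u v huv
      rw [← add_div, div_le_one h]; exact h3 u v huv
    · intro i
      field_simp

lemma stab_valid {V : Type} [Fintype V] [DecidableEq V] (G : SimpleGraph V) (f : V → ℝ) (β : ℝ)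
    (h : ∀ R : Finset V, IsStable G (R : Set V) → ∑ v ∈ R, f v ≤ β) (x : V → ℝ) (hx : x ∈ STAB G) :
    ∑ v, f v * x v ≤ β := by
  classical
  have hconv : Convex ℝ {x : V → ℝ | ∑ v, f v * x v ≤ β} := by
    intro x hx y hy a b ha hb hab
    simp only [Set.mem_ofPred_eq, Pi.add_apply, Pi.smul_apply, smul_eq_mul] at *
    have : ∑ v, f v * (a * x v + b * y v) = a * ∑ v, f v * x v + b * ∑ v, f v * y v := by
      rw [Finset.mul_sum, Finset.mul_sum, ← Finset.sum_add_distrib]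
      exact Finset.sum_congr rfl fun v _ => by ring
    rw [this]
    have hβ : β = a * β + b * β := by rw [← add_mul, hab, one_mul]
    have h1 := mul_le_mul_of_nonneg_left hx ha
    have h2 := mul_le_mul_of_nonneg_left hy hb
    linarith
  have hsub : STAB G ⊆ {x : V → ℝ | ∑ v, f v * x v ≤ β} := by
    apply convexHull_min _ hconv
    rintro _ ⟨S, hS, rfl⟩
    have := h S.toFinset (by simpa using hS)
    simp only [Set.mem_ofPred_eq]
    refine le_trans (le_of_eq ?_) this
    simp [Set.indicator_apply, Finset.sum_ite]
    apply Finset.sum_congr _ (fun _ _ => rfl)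
    ext; simp
  exact hsub hx

/-- extended incidence vector -/
noncomputable def chi {V : Type} [DecidableEq V] (T : Finset V) : Option V → ℝ :=
  fun o => o.elim 1 (fun v => if v ∈ T then 1 else 0)

lemma chi_none {V : Type} [DecidableEq V] (T : Finset V) : chi T none = 1 := rfl
lemma chi_some {V : Type} [DecidableEq V] (T : Finset V) (v : V) :
    chi T (some v) = if v ∈ T then 1 else 0 := rfl
lemma chi_nonneg {V : Type} [DecidableEq V] (T : Finset V) (o : Option V) : 0 ≤ chi T o := by
  cases o
  · simp [chi_none]
  · rw [chi_some]; split_ifs <;> simp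
lemma chi_le {V : Type} [DecidableEq V] (T : Finset V) (o : Option V) : chi T o ≤ 1 := by
  cases o
  · simp [chi_none]
  · rw [chi_some]; split_ifs <;> simp
lemma chi_sq {V : Type} [DecidableEq V] (T : Finset V) (o : Option V) :
    chi T o * chi T o = chi T o := by
  cases o
  · simp [chi_none]
  · rw [chi_some]; split_ifs <;> simp
lemma chi_edge {V : Type} [DecidableEq V] (G : SimpleGraph V) (T : Finset V)
    (hT : IsStable G (T : Set V)) (u v : V) (huv : G.Adj u v) :
    chi T (some u) + chi T (some v) ≤ 1 := by
  rw [chi_some, chi_some]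
  by_cases h : u ∈ T <;> by_cases h' : v ∈ T
  · exact absurd huv (hT u h v h')
  all_goals simp [h, h']

lemma quad_one {κ : Type} [Fintype κ] (z f : κ → ℝ) :
    ∑ i, z i * ∑ j, (f i * f j) * z j = (∑ i, z i * f i) ^ 2 := by
  rw [sq, Finset.sum_mul]
  refine Finset.sum_congr rfl fun i _ => ?_
  rw [Finset.mul_sum, Finset.mul_sum]
  exact Finset.sum_congr rfl fun j _ => by ring

lemma psd_aux {κ μ : Type} [Fintype κ] [Fintype μ] [DecidableEq κ] (lam g : μ → ℝ) (t : μ → κ → ℝ) (q r : κ → ℝ)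
    (ε : ℝ) (hε : 0 ≤ ε) (hlam : ∀ m, 0 < lam m) (hr : ∀ i, r i = ∑ m, g m * t m i)
    (hb : ε * ∑ m, g m ^ 2 / lam m ≤ 1) :
    (Matrix.of fun i j => ∑ m, lam m * (t m i * t m j) + ε * (q i * q j - r i * r j) :
      Matrix κ κ ℝ).PosSemidef := by
  refine Matrix.PosSemidef.of_dotProduct_mulVec_nonneg ?_ ?_
  · ext i j
    simp only [Matrix.conjTranspose_apply, Matrix.of_apply, star_trivial]
    congr 1
    · exact Finset.sum_congr rfl fun m _ => by ring
    · ring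
  · intro z
    have e : star z ⬝ᵥ ((Matrix.of fun i j => ∑ m, lam m * (t m i * t m j) + ε * (q i * q j - r i * r j) :
      Matrix κ κ ℝ).mulVec z) = ∑ m, lam m * (∑ i, z i * t m i) ^ 2
        + ε * ((∑ i, z i * q i) ^ 2 - (∑ i, z i * r i) ^ 2) := by
      simp only [dotProduct, Matrix.mulVec, Matrix.of_apply, star_trivial, ← quad_one]
      have : ∀ i, z i * ∑ j, (∑ m, lam m * (t m i * t m j) + ε * (q i * q j - r i * r j)) * z j
          = ∑ m, lam m * (z i * ∑ j, (t m i * t m j) * z j)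
            + ε * (z i * ∑ j, (q i * q j) * z j - z i * ∑ j, (r i * r j) * z j) := by
        intro i
        have h1 : ∑ j, (∑ m, lam m * (t m i * t m j) + ε * (q i * q j - r i * r j)) * z j
          = ∑ m, lam m * (∑ j, (t m i * t m j) * z j)
            + ε * (∑ j, (q i * q j) * z j - ∑ j, (r i * r j) * z j) := by
          simp only [Finset.mul_sum, ← Finset.sum_sub_distrib]
          rw [Finset.sum_comm, ← Finset.sum_add_distrib]
          refine Finset.sum_congr rfl fun j _ => ?_
          rw [add_mul, Finset.sum_mul]
          congr 1
          · exact Finset.sum_congr rfl fun m _ => by ring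
          · ring
        rw [h1, mul_add, Finset.mul_sum]
        congr 1
        · exact Finset.sum_congr rfl fun m _ => by ring
        · ring
      rw [Finset.sum_congr rfl (fun i _ => this i), Finset.sum_add_distrib, Finset.sum_comm,
        ← Finset.mul_sum, Finset.sum_sub_distrib]
      congr 1
      exact Finset.sum_congr rfl fun m _ => by rw [Finset.mul_sum]
    rw [e]
    have hzr : ∑ i, z i * r i = ∑ m, g m * ∑ i, z i * t m i := by
      simp only [hr, Finset.mul_sum]
      rw [Finset.sum_comm]
      exact Finset.sum_congr rfl fun m _ => Finset.sum_congr rfl fun i _ => by ring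
    have hcs : (∑ i, z i * r i) ^ 2 ≤ (∑ m, g m ^ 2 / lam m) * ∑ m, lam m * (∑ i, z i * t m i) ^ 2 := by
      rw [hzr]
      apply Finset.sum_sq_le_sum_mul_sum_of_sq_le_mul
      · intro m _; exact div_nonneg (sq_nonneg _) (hlam m).le
      · intro m _; exact mul_nonneg (hlam m).le (sq_nonneg _)
      · intro m _
        have := (hlam m).ne'
        apply le_of_eq
        field_simp
    have hX : 0 ≤ ∑ m, lam m * (∑ i, z i * t m i) ^ 2 :=
      Finset.sum_nonneg fun m _ => mul_nonneg (hlam m).le (sq_nonneg _)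
    have h1 := mul_le_mul_of_nonneg_left hcs hε
    have h2 := mul_le_mul_of_nonneg_right hb hX
    have h3 := mul_nonneg hε (sq_nonneg (∑ i, z i * q i))
    nlinarith

lemma ls_core {V : Type} [Fintype V] [DecidableEq V] (G : SimpleGraph V) (A : Finset V)
    (α ω : ℕ) (ι : Type) [Fintype ι] (S : ι → Finset V) (hα : 1 ≤ α) (hω : 2 ≤ ω)
    (hι : Fintype.card ι = α * ω + 1) (hAc : A.card = α * ω + 1)
    (hSA : ∀ i, S i ⊆ A) (hSs : ∀ i, IsStable G (S i : Set V)) (hSc : ∀ i, (S i).card = α)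
    (hmax : ∀ R : Finset V, R ⊆ A → IsStable G (R : Set V) → R.card ≤ α)
    (hcount : ∀ v ∈ A, ∑ i, (if v ∈ S i then (1 : ℝ) else 0) = α)
    (hsolve : ∀ f : V → ℝ, ∃ γ : ι → ℝ, ∀ v ∈ A, ∑ i, γ i * (if v ∈ S i then (1 : ℝ) else 0) = f v)
    (hsep : ∀ i ∈ A, ∀ k, k ≠ i → ∃ l, i ∈ S l ∧ k ∉ S l)
    (w : V) (hw : w ∉ A) (R : Finset V) (hRA : R ⊆ A) (hRs : IsStable G (R : Set V))
    (hRw : ∀ v ∈ R, ¬ G.Adj w v) (hR1 : 1 ≤ R.card) (hR2 : R.card < α)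
    (hRmax : ∀ T : Finset V, T ⊆ A → IsStable G (T : Set V) → (∀ v ∈ T, ¬ G.Adj w v) →
      T.card ≤ R.card)
    (hls : LSplus (FRAC G) = STAB G) : False := by
  have hwR : w ∉ R := fun h => hw (hRA h)
  have hα0 : (0 : ℝ) < α := by exact_mod_cast hα
  have hωr : (2 : ℝ) ≤ ω := by exact_mod_cast hω
  obtain ⟨γ, hγ⟩ := hsolve (fun v => if v ∈ R then 1 else 0)
  obtain ⟨N, hN⟩ : ∃ N : ℝ, N = α * ω + 1 := ⟨_, rfl⟩
  have hN2 : 2 * (α : ℝ) + 1 ≤ N := by rw [hN]; nlinarith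
  have hN0 : 0 < N := by linarith
  obtain ⟨b, hb⟩ : ∃ b : ℝ, b = 1 - R.card / α := ⟨_, rfl⟩
  have hR1' : (1 : ℝ) ≤ R.card := by exact_mod_cast hR1
  have hR2' : (R.card : ℝ) < α := by exact_mod_cast hR2
  have hb0 : 0 < b := by
    rw [hb, sub_pos, div_lt_one hα0]; exact hR2'
  have hb1 : b < 1 := by
    have : (0 : ℝ) < R.card / α := by positivity
    linarith
  have hbα : b * α = α - R.card := by rw [hb]; field_simp
  obtain ⟨ε, δ, hε0, hδ0, hδ1, hδb, hεN, hεb⟩ := params b N (∑ i, γ i ^ 2) hb0 hb1 (by linarith)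
    (Finset.sum_nonneg fun i _ => sq_nonneg _)
  obtain ⟨κ, hκ⟩ : ∃ κ : ℝ, κ = (1 - δ) / N := ⟨_, rfl⟩
  have hκ0 : 0 < κ := by rw [hκ]; exact div_pos (by linarith) hN0
  have hκN : N * κ = 1 - δ := by rw [hκ]; field_simp
  rw [← hκ] at hεN hεb
  -- sum of the multipliers
  have hγsum : ∑ i, γ i = 1 - b := by
    have h1 : ∑ v ∈ A, ∑ i, γ i * (if v ∈ S i then (1 : ℝ) else 0) = R.card := by
      rw [Finset.sum_congr rfl hγ, Finset.sum_boole, Finset.filter_mem_eq_inter,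
        Finset.inter_eq_right.2 hRA]
    rw [Finset.sum_comm] at h1
    have h2 : ∀ i ∈ Finset.univ, ∑ v ∈ A, γ i * (if v ∈ S i then (1 : ℝ) else 0) = γ i * α := by
      intro i _
      rw [← Finset.mul_sum, Finset.sum_boole, Finset.filter_mem_eq_inter,
        Finset.inter_eq_right.2 (hSA i), hSc]
    rw [Finset.sum_congr rfl h2, ← Finset.sum_mul] at h1
    rw [hb]; field_simp; linarith
  let T : Option ι → Finset V := fun o => o.elim ∅ S
  let lam : Option ι → ℝ := fun o => o.elim δ (fun _ => κ)
  let g : Option ι → ℝ := fun o => o.elim b γ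
  have hTs : ∀ o, IsStable G (T o : Set V) := by
    rintro (_ | i)
    · simp [T, IsStable]
    · exact hSs i
  have hTA : ∀ o, T o ⊆ A := by
    rintro (_ | i)
    · simp [T]
    · exact hSA i
  have hlam : ∀ o, 0 < lam o := by
    rintro (_ | i)
    · exact hδ0
    · exact hκ0
  have hlam1 : ∑ o, lam o = 1 := by
    rw [Fintype.sum_option]
    simp only [lam, Option.elim, Finset.sum_const, Finset.card_univ, hι, nsmul_eq_mul]
    push_cast
    rw [← hN, hκN]; ring
  let q : Option V → ℝ := chi (insert w R)
  let r : Option V → ℝ := chi R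
  have hr : ∀ i, r i = ∑ o, g o * chi (T o) i := by
    rintro (_ | v)
    · rw [Fintype.sum_option]
      simp only [r, g, T, chi_none, Option.elim, mul_one, hγsum]; ring
    · rw [Fintype.sum_option]
      simp only [r, g, T, chi_some, Option.elim, Finset.notMem_empty, if_false, mul_zero, zero_add]
      by_cases hv : v ∈ A
      · exact (hγ v hv).symm
      · rw [if_neg (fun h => hv (hRA h)), Finset.sum_eq_zero]
        intro i _
        rw [if_neg (fun h => hv (hSA i h)), mul_zero]
  obtain ⟨Y, hY⟩ : ∃ Y : Matrix (Option V) (Option V) ℝ, Y = Matrix.of fun i j =>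
    ∑ o, lam o * (chi (T o) i * chi (T o) j) + ε * (q i * q j - r i * r j) := ⟨_, rfl⟩
  have hpsd : Y.PosSemidef := by
    rw [hY]
    apply psd_aux lam g (fun o => chi (T o)) q r ε hε0.le hlam hr
    rw [Fintype.sum_option]
    simp only [lam, g, Option.elim, ← Finset.sum_div]
    exact hεb
  -- the two parts of the matrix
  obtain ⟨P, hP⟩ : ∃ P : Option V → Option V → ℝ, P = fun i j =>
    ∑ o, lam o * (chi (T o) i * chi (T o) j) := ⟨_, rfl⟩
  obtain ⟨e, he⟩ : ∃ e : Option V → ℝ, e = fun o => if o = some w then 1 else 0 := ⟨_, rfl⟩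
  have hq : ∀ o, q o = r o + e o := by
    rintro (_ | v)
    · simp [q, r, he, chi_none]
    · by_cases hvw : v = w
      · subst hvw; simp [q, r, he, chi_some, hwR]
      · simp [q, r, he, chi_some, hvw]
  have hYP : ∀ i j, Y i j = P i j + ε * (r i * e j + e i * r j + e i * e j) := by
    intro i j
    rw [hY, hP]
    simp only [Matrix.of_apply, hq]
    ring
  have hen : e none = 0 := by simp [he]
  have hew : e (some w) = 1 := by simp [he]
  have hev : ∀ v, v ≠ w → e (some v) = 0 := by intro v hv; simp [he, hv]
  have he0 : ∀ o, 0 ≤ e o := by intro o; rw [he]; dsimp only; split_ifs <;> simp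
  have hrn : r none = 1 := rfl
  have hrw : r (some w) = 0 := by simp [r, chi_some, hwR]
  have hr0 : ∀ o, 0 ≤ r o := chi_nonneg R
  have hr1 : ∀ o, r o ≤ 1 := chi_le R
  have hPsymm : ∀ i j, P i j = P j i := by
    intro i j; rw [hP]; exact Finset.sum_congr rfl fun o _ => by ring
  have hPnn : P none none = 1 := by
    rw [hP]; simpa [chi_none] using hlam1
  have hPdiag : ∀ j, P j none = P j j := by
    intro j; rw [hP]
    exact Finset.sum_congr rfl fun o _ => by rw [chi_sq, chi_none, mul_one]
  have hP0 : ∀ i j, 0 ≤ P i j := by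
    intro i j; rw [hP]
    exact Finset.sum_nonneg fun o _ => mul_nonneg (hlam o).le (mul_nonneg (chi_nonneg _ _) (chi_nonneg _ _))
  have hPle : ∀ i j, P j i ≤ P none i := by
    intro i j; rw [hP]
    refine Finset.sum_le_sum fun o _ => mul_le_mul_of_nonneg_left ?_ (hlam o).le
    rw [chi_none]
    exact mul_le_mul_of_nonneg_right (chi_le _ _) (chi_nonneg _ _)
  have hPedge : ∀ i j k, G.Adj j k → P (some j) i + P (some k) i ≤ P none i := by
    intro i j k hjk; rw [hP]
    rw [← Finset.sum_add_distrib]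
    refine Finset.sum_le_sum fun o _ => ?_
    rw [← mul_add, ← add_mul, chi_none]
    exact mul_le_mul_of_nonneg_left
      (mul_le_mul_of_nonneg_right (chi_edge G _ (hTs o) j k hjk) (chi_nonneg _ _)) (hlam o).le
  have hPc1 : ∀ i j, P j none - P j i ≤ P none none - P none i := by
    intro i j; rw [hP]
    simp only [← Finset.sum_sub_distrib]
    refine Finset.sum_le_sum fun o _ => ?_
    rw [chi_none]
    nlinarith [mul_nonneg (hlam o).le (mul_nonneg (sub_nonneg.2 (chi_le (T o) i)) (sub_nonneg.2 (chi_le (T o) j)))]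
  have hPc2 : ∀ i j k, G.Adj j k → P (some j) none - P (some j) i + (P (some k) none - P (some k) i)
      ≤ P none none - P none i := by
    intro i j k hjk; rw [hP]
    simp only [← Finset.sum_sub_distrib, ← Finset.sum_add_distrib]
    refine Finset.sum_le_sum fun o _ => ?_
    rw [chi_none]
    nlinarith [mul_nonneg (hlam o).le (mul_nonneg (sub_nonneg.2 (chi_le (T o) i)) (sub_nonneg.2 (chi_edge G (T o) (hTs o) j k hjk)))]
  have hPw : ∀ i, P (some w) i = 0 := by
    intro i; rw [hP]
    refine Finset.sum_eq_zero fun o _ => ?_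
    rw [chi_some, if_neg (fun h => hw (hTA o h))]; ring
  have hPA : ∀ v ∈ A, P (some v) none = κ * α := by
    intro v hv
    rw [hP]
    dsimp only
    rw [Fintype.sum_option, ← hcount v hv, Finset.mul_sum]
    simp [lam, T, chi_some, chi_none]
  have hPnA : ∀ v, v ∉ A → P (some v) none = 0 := by
    intro v hv; rw [hP]
    refine Finset.sum_eq_zero fun o _ => ?_
    rw [chi_some, if_neg (fun h => hv (hTA o h))]; ring
  have hPle' : ∀ v, P (some v) none ≤ κ * α := by
    intro v
    by_cases hv : v ∈ A
    · exact (hPA v hv).le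
    · rw [hPnA v hv]; positivity
  have hslack : ∀ i ∈ A, ∀ k, k ≠ i → P (some k) (some i) + ε ≤ P none (some i) := by
    intro i hi k hk
    obtain ⟨l, hl1, hl2⟩ := hsep i hi k hk
    have : κ ≤ P none (some i) - P (some k) (some i) := by
      rw [hP]
      dsimp only
      rw [← Finset.sum_sub_distrib]
      have h1 : κ = lam (some l) * (chi (T (some l)) none * chi (T (some l)) (some i)) -
          lam (some l) * (chi (T (some l)) (some k) * chi (T (some l)) (some i)) := by
        simp [lam, T, chi_some, chi_none, hl1, hl2]
      rw [h1]
      refine Finset.single_le_sum (f := fun o => lam o * (chi (T o) none * chi (T o) (some i)) -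
          lam o * (chi (T o) (some k) * chi (T o) (some i))) ?_ (Finset.mem_univ (some l))
      intro o _
      rw [sub_nonneg, chi_none]
      refine mul_le_mul_of_nonneg_left ?_ (hlam o).le
      exact mul_le_mul_of_nonneg_right (chi_le _ _) (chi_nonneg _ _)
    linarith
  have hnum : 2 * (κ * α) + ε ≤ 1 := by
    have h1 : (2 * α + 1) * κ ≤ N * κ := mul_le_mul_of_nonneg_right hN2 hκ0.le
    nlinarith
  have hεκα : ε ≤ κ * α := by
    have : (1 : ℝ) ≤ α := by exact_mod_cast hα
    nlinarith
  -- entries of Y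
  have hYsymm : ∀ i j, Y i j = Y j i := by
    intro i j; rw [hYP, hYP, hPsymm i j]; ring
  have hYnn : Y none none = 1 := by rw [hYP, hPnn, hen]; ring
  have hYdiag : ∀ j, Y j none = Y j j := by
    intro j
    rw [hYP, hYP, hPdiag, hen, hrn]
    by_cases hj : j = some w
    · subst hj; rw [hew, hrw]; ring
    · have : e j = 0 := by simp [he, hj]
      rw [this]; ring
  have hY0 : ∀ i j, 0 ≤ Y i j := by
    intro i j
    rw [hYP]
    have := hP0 i j
    have := mul_nonneg (hr0 i) (he0 j)
    have := mul_nonneg (he0 i) (hr0 j)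
    have := mul_nonneg (he0 i) (he0 j)
    positivity
  have hYw : Y (some w) none = ε := by rw [hYP, hPw, hew, hrn, hen]; ring
  have hYv : ∀ v, v ≠ w → Y (some v) none = P (some v) none := by
    intro v hv; rw [hYP, hev v hv, hen]; ring
  -- column inequalities
  have hrR : ∀ v, v ∈ R → r (some v) = 1 := by intro v hv; simp [r, chi_some, hv]
  have hrnR : ∀ v, v ∉ R → r (some v) = 0 := by intro v hv; simp [r, chi_some, hv]
  have hYle : ∀ i j : V, Y (some j) (some i) ≤ Y none (some i) := by
    intro i j
    rw [hYP, hYP, hen, hrn]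
    have hp := hPle (some i) (some j)
    by_cases hiw : i = w
    · subst hiw
      rw [hew, hrw]
      by_cases hjw : j = i
      · subst hjw; rw [hew, hrw]; linarith
      · rw [hev j hjw]
        have := mul_le_mul_of_nonneg_left (hr1 (some j)) hε0.le
        linarith
    · rw [hev i hiw]
      by_cases hjw : j = w
      · subst hjw
        rw [hew, hrw]
        by_cases hiR : i ∈ R
        · have := hslack i (hRA hiR) j (Ne.symm hiw)
          rw [hrR i hiR]; linarith
        · rw [hrnR i hiR]; linarith
      · rw [hev j hjw]; linarith
  have hYew : ∀ i k : V, G.Adj w k → Y (some w) (some i) + Y (some k) (some i) ≤ Y none (some i) := by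
    intro i k hwk
    have hkw : k ≠ w := hwk.ne'
    have hkR : k ∉ R := fun h => hRw k h hwk
    rw [hYP, hYP, hYP, hen, hrn, hew, hrw, hev k hkw, hrnR k hkR, hPw]
    have hp := hPle (some i) (some k)
    by_cases hiw : i = w
    · subst hiw
      rw [hew, hrw]; linarith
    · rw [hev i hiw]
      by_cases hiR : i ∈ R
      · have hki : k ≠ i := fun h => hkR (h ▸ hiR)
        have := hslack i (hRA hiR) k hki
        rw [hrR i hiR]; linarith
      · rw [hrnR i hiR]; linarith
  have hYedge : ∀ i j k : V, G.Adj j k → Y (some j) (some i) + Y (some k) (some i) ≤ Y none (some i) := by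
    intro i j k hjk
    by_cases hjw : j = w
    · subst hjw; exact hYew i k hjk
    · by_cases hkw : k = w
      · subst hkw; rw [add_comm]; exact hYew i j hjk.symm
      · have hp := hPedge (some i) j k hjk
        rw [hYP, hYP, hYP, hen, hrn, hev j hjw, hev k hkw]
        by_cases hiw : i = w
        · subst hiw
          rw [hew]
          have h2 := mul_le_mul_of_nonneg_left (chi_edge G R hRs j k hjk) hε0.le
          change ε * (r (some j) + r (some k)) ≤ ε * 1 at h2
          linarith
        · rw [hev i hiw]; linarith
  have hYx : ∀ v, Y (some v) none ≤ κ * α := by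
    intro v
    by_cases hv : v = w
    · subst hv; rw [hYw]; exact hεκα
    · rw [hYv v hv]; exact hPle' v
  have hYc1 : ∀ i j : V, Y (some j) none - Y (some j) (some i) ≤ Y none none - Y none (some i) := by
    intro i j
    rw [hYsymm none (some i), hYnn]
    by_cases h : i = w ∨ j = w
    · have h0 := hY0 (some j) (some i)
      have h1 := hYx i
      have h2 := hYx j
      linarith
    · push Not at h
      have hp := hPc1 (some i) (some j)
      rw [hPnn, hPsymm none (some i)] at hp
      rw [hYP (some j) (some i), hYv i h.1, hYv j h.2, hev i h.1, hev j h.2]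
      linarith
  have hYc2 : ∀ i j k : V, G.Adj j k → Y (some j) none - Y (some j) (some i) +
      (Y (some k) none - Y (some k) (some i)) ≤ Y none none - Y none (some i) := by
    intro i j k hjk
    rw [hYsymm none (some i), hYnn]
    have h1 := hYx i
    have h2 := hYx j
    have h3 := hYx k
    have h4 := hY0 (some j) (some i)
    have h5 := hY0 (some k) (some i)
    by_cases hi : i = w
    · rw [hi] at h4 h5 ⊢; rw [hYw]; linarith
    by_cases hj : j = w
    · rw [hj] at h4 ⊢; rw [hYw]; linarith
    by_cases hk : k = w
    · rw [hk] at h5 ⊢; rw [hYw]; linarith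
    have hp := hPc2 (some i) j k hjk
    rw [hPnn, hPsymm none (some i)] at hp
    rw [hYP (some j) (some i), hYP (some k) (some i), hYv i hi, hYv j hj, hYv k hk,
      hev i hi, hev j hj, hev k hk]
    linarith
  -- the point
  have hx : (fun v => Y (some v) none) ∈ LSplus (FRAC G) := by
    refine ⟨?_, Y, hpsd, hYnn, hYdiag, fun _ => rfl, ?_, ?_⟩
    · intro v
      exact ⟨hY0 _ _, by linarith [hYx v]⟩
    · intro i
      apply mem_cone
      · exact hY0 _ _
      · intro v; exact hY0 _ _
      · intro v; exact hYle i v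
      · intro u v huv; exact hYedge i u v huv
    · intro i
      apply mem_cone
      · rw [hYnn, hYsymm none (some i)]; linarith [hYx i]
      · intro v
        have := hYle v i
        rw [hYsymm none (some v), hYsymm (some i)] at this
        linarith
      · intro v; exact hYc1 i v
      · intro u v huv; exact hYc2 i u v huv
  rw [hls] at hx
  have hval := stab_valid G (fun v => (if v ∈ A then (1 : ℝ) else 0) + (α - R.card) * (if v = w then 1 else 0))
    α ?_ _ hx
  · have hsum : ∑ v, ((if v ∈ A then (1 : ℝ) else 0) + (α - R.card) * (if v = w then 1 else 0)) * Y (some v) none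
        = A.card * (κ * α) + (α - R.card) * ε := by
      have h1 : ∀ v ∈ Finset.univ, ((if v ∈ A then (1 : ℝ) else 0) + (α - R.card) * (if v = w then 1 else 0)) * Y (some v) none
        = (if v ∈ A then κ * α else 0) + (if v = w then (α - R.card) * ε else 0) := by
        intro v _
        by_cases hv : v = w
        · subst hv; simp [hw, hYw]
        · rw [hYv v hv]
          by_cases hvA : v ∈ A
          · rw [hPA v hvA]; simp [hv, hvA]
          · simp [hv, hvA]
      rw [Finset.sum_congr rfl h1, Finset.sum_add_distrib, Finset.sum_ite_eq']
      simp
    rw [hsum, hAc, ← hbα] at hval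
    push_cast at hval
    rw [← hN] at hval
    have h3 : N * (κ * α) = (1 - δ) * α := by rw [← hκN]; ring
    rw [h3] at hval
    have h4 := mul_lt_mul_of_pos_right hδb hα0
    linarith
  · intro Q hQ
    rw [Finset.sum_add_distrib, ← Finset.mul_sum, Finset.sum_ite_eq', Finset.sum_boole,
      Finset.filter_mem_eq_inter]
    have hQs : IsStable G ((Q ∩ A : Finset V) : Set V) := by
      intro u hu v hv
      simp only [Finset.coe_inter, Set.mem_inter_iff, Finset.mem_coe] at hu hv
      exact hQ u hu.1 v hv.1
    by_cases hwQ : w ∈ Q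
    · have := hRmax (Q ∩ A) Finset.inter_subset_right hQs (fun v hv => hQ w hwQ v (Finset.mem_inter.1 hv).1)
      have h2 : ((Q ∩ A).card : ℝ) ≤ R.card := by exact_mod_cast this
      rw [if_pos hwQ]; linarith
    · have := hmax (Q ∩ A) Finset.inter_subset_right hQs
      have h2 : ((Q ∩ A).card : ℝ) ≤ α := by exact_mod_cast this
      rw [if_neg hwQ]; linarith

lemma qstab_seg {V : Type} [Fintype V] (G : SimpleGraph V) (x y : V → ℝ) (t : ℝ) (ht0 : 0 ≤ t)
    (ht1 : t ≤ 1) (hx : x ∈ QSTABset G) (hy : y ∈ QSTABset G) :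
    (fun v => (1 - t) * x v + t * y v) ∈ QSTABset G := by
  refine ⟨?_, ?_⟩
  · intro v
    have := mul_nonneg (sub_nonneg.2 ht1) (hx.1 v)
    have := mul_nonneg ht0 (hy.1 v)
    dsimp only; linarith
  · intro K hK
    rw [Finset.sum_add_distrib, ← Finset.mul_sum, ← Finset.mul_sum]
    have := mul_le_mul_of_nonneg_left (hx.2 K hK) (sub_nonneg.2 ht1)
    have := mul_le_mul_of_nonneg_left (hy.2 K hK) ht0
    linarith

lemma ind_mem {V : Type} [DecidableEq V] (G : SimpleGraph V) (R : Finset V)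
    (hR : IsStable G (R : Set V)) : (fun v => if v ∈ R then (1 : ℝ) else 0) ∈ STAB G := by
  apply subset_convexHull
  refine ⟨R, hR, ?_⟩
  ext v
  simp [Set.indicator_apply]

lemma lim_aux (p s β : ℝ) (h : ∀ t : ℝ, 0 < t → t ≤ 1 → β < (1 - t) * s + t * p) : β ≤ s := by
  by_contra hlt
  push Not at hlt
  have h1 := h 1 one_pos le_rfl
  have hps : 0 < p - s := by linarith
  have h2 := h ((β - s) / (p - s)) (div_pos (by linarith) hps) (by
    rw [div_le_one hps]; linarith)
  have : (1 - (β - s) / (p - s)) * s + (β - s) / (p - s) * p = β := by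
    field_simp; ring
  linarith

theorem main_aux {V : Type} [Fintype V] [DecidableEq V] (G : SimpleGraph V)
    (hfs : FsPerfect G) (hls : LSplus (FRAC G) = STAB G) (A : Finset V)
    (hA : ¬ Good G A) (hmin : ∀ C : Set V, C ⊂ A → Good G C) :
    (∀ u, u ∉ A → ∀ w, w ∉ A → u ≠ w → G.Adj u w) ∧ (∀ u ∈ A, ∀ w, w ∉ A → G.Adj u w) := by
  classical
  obtain ⟨α, ω, ι, _, S, hα, hω, hι, hAc, hSA, hSs, hSc, hmax, hcl, hcount, hsolve⟩ :=
    struct G A hA hmin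
  have hα0 : (0 : ℝ) < α := by exact_mod_cast hα
  have hω0 : (0 : ℝ) < ω := by exact_mod_cast (by omega : 0 < ω)
  have hzero : ∀ f : V → ℝ, (∀ i, ∑ v ∈ S i, f v = 0) → ∀ v ∈ A, f v = 0 := by
    intro f hf
    obtain ⟨γ, hγ⟩ := hsolve f
    have h1 : ∑ v ∈ A, f v * f v = 0 := by
      have e1 : ∀ v ∈ A, f v * f v = ∑ i, γ i * (if v ∈ S i then f v else 0) := by
        intro v hv
        conv_lhs => rw [← hγ v hv]
        rw [hγ v hv]
        nth_rewrite 1 [← hγ v hv]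
        rw [Finset.sum_mul]
        refine Finset.sum_congr rfl fun i _ => ?_
        split_ifs <;> ring
      rw [Finset.sum_congr rfl e1, Finset.sum_comm]
      refine Finset.sum_eq_zero fun i _ => ?_
      rw [← Finset.mul_sum, ← Finset.sum_filter, Finset.filter_mem_eq_inter,
        Finset.inter_eq_right.2 (hSA i), hf i, mul_zero]
    intro v hv
    have := (Finset.sum_eq_zero_iff_of_nonneg (fun v _ => mul_self_nonneg (f v))).1 h1 v hv
    exact mul_self_eq_zero.1 this
  have hsep : ∀ i ∈ A, ∀ k, k ≠ i → ∃ l, i ∈ S l ∧ k ∉ S l := by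
    intro i hi k hk
    by_contra hcon
    push Not at hcon
    have hex : ∃ l, i ∈ S l := by
      by_contra hno
      push Not at hno
      have := hcount i hi
      simp only [hno, if_false, Finset.sum_const_zero] at this
      linarith
    obtain ⟨l0, hl0⟩ := hex
    have hkA : k ∈ A := hSA l0 (hcon l0 hl0)
    have hle : ∀ l ∈ Finset.univ, (if i ∈ S l then (1 : ℝ) else 0) ≤ (if k ∈ S l then 1 else 0) := by
      intro l _
      by_cases h : i ∈ S l
      · simp [h, hcon l h]
      · simp only [h, if_false]; split_ifs <;> simp
    have heq := (Finset.sum_eq_sum_iff_of_le hle).1 ((hcount i hi).trans (hcount k hkA).symm)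
    have := hzero (fun v => (if v = i then (1 : ℝ) else 0) - (if v = k then 1 else 0)) (by
      intro l
      rw [Finset.sum_sub_distrib, Finset.sum_ite_eq', Finset.sum_ite_eq', heq l (Finset.mem_univ l), sub_self]) i hi
    simp [Ne.symm hk] at this
  -- the point with value 1/ω on A
  obtain ⟨p, hp⟩ : ∃ p : V → ℝ, p = fun v => if v ∈ A then 1 / (ω : ℝ) else 0 := ⟨_, rfl⟩
  have hpA : ∑ v ∈ A, p v = α + 1 / ω := by
    have : ∀ v ∈ A, p v = 1 / (ω : ℝ) := by intro v hv; simp [hp, hv]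
    rw [Finset.sum_congr rfl this, Finset.sum_const, hAc, nsmul_eq_mul]
    push_cast
    field_simp
  have hω' : (0 : ℝ) < 1 / ω := by positivity
  have hpQ : p ∈ QSTABset G := by
    refine ⟨fun v => ?_, fun K hK => ?_⟩
    · rw [hp]; dsimp only; split_ifs <;> positivity
    · rw [hp]
      dsimp only
      rw [← Finset.sum_filter, Finset.sum_const, nsmul_eq_mul, mul_one_div, div_le_one hω0]
      have := hcl (K.filter (fun v => v ∈ A)) (fun v hv => (Finset.mem_filter.1 hv).2)
        (hK.subset (by intro v hv; exact (Finset.mem_filter.1 hv).1))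
      exact_mod_cast this
  have hvalA : ∀ x ∈ STAB G, ∑ v ∈ A, x v ≤ α := by
    intro x hx
    have := stab_valid G (fun v => if v ∈ A then (1 : ℝ) else 0) α (by
      intro Q hQ
      rw [Finset.sum_boole, Finset.filter_mem_eq_inter]
      have := hmax (Q ∩ A) Finset.inter_subset_right (by
        intro u hu v hv
        simp only [Finset.coe_inter, Set.mem_inter_iff, Finset.mem_coe] at hu hv
        exact hQ u hu.1 v hv.1)
      exact_mod_cast this) x hx
    simpa [← Finset.sum_filter] using this
  have hpn : p ∉ STAB G := fun h => by
    have := hvalA p h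
    rw [hpA] at this; linarith
  rcases hfs with hfs | ⟨a, β, ha, hfs⟩
  · exact absurd (hfs ▸ hpQ) hpn
  have hST : ∀ x, x ∈ QSTABset G → x ∉ STAB G → β < ∑ v, a v * x v := by
    intro x hx hxn
    by_contra hle
    push Not at hle
    exact hxn (hfs ▸ ⟨hx, hle⟩)
  have hSQ : ∀ x ∈ STAB G, x ∈ QSTABset G := fun x hx => by
    rw [hfs] at hx; exact hx.1
  have hSβ : ∀ x ∈ STAB G, ∑ v, a v * x v ≤ β := fun x hx => by
    rw [hfs] at hx; exact hx.2
  have hlin : ∀ (x y : V → ℝ) (t : ℝ), ∑ v, a v * ((1 - t) * x v + t * y v) =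
      (1 - t) * ∑ v, a v * x v + t * ∑ v, a v * y v := by
    intro x y t
    rw [Finset.mul_sum, Finset.mul_sum, ← Finset.sum_add_distrib]
    exact Finset.sum_congr rfl fun v _ => by ring
  have hlinA : ∀ (x y : V → ℝ) (t : ℝ), ∑ v ∈ A, ((1 - t) * x v + t * y v) =
      (1 - t) * ∑ v ∈ A, x v + t * ∑ v ∈ A, y v := by
    intro x y t
    rw [Finset.mul_sum, Finset.mul_sum, ← Finset.sum_add_distrib]
  have hindsum : ∀ R : Finset V, ∑ v, a v * (if v ∈ R then (1 : ℝ) else 0) = ∑ v ∈ R, a v := by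
    intro R; simp [← Finset.sum_filter]
  have hindβ : ∀ R : Finset V, IsStable G (R : Set V) → ∑ v ∈ R, a v ≤ β := by
    intro R hR
    rw [← hindsum]; exact hSβ _ (ind_mem G R hR)
  have hSi : ∀ i, ∑ v ∈ S i, a v = β := by
    intro i
    apply le_antisymm (hindβ _ (hSs i))
    rw [← hindsum]
    apply lim_aux (∑ v, a v * p v)
    intro t ht0 ht1
    rw [← hlin]
    apply hST _ (qstab_seg G _ p t ht0.le ht1 (hSQ _ (ind_mem G _ (hSs i))) hpQ)
    intro hmem
    have := hvalA _ hmem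
    rw [hlinA, hpA, Finset.sum_boole, Finset.filter_mem_eq_inter, Finset.inter_eq_right.2 (hSA i), hSc] at this
    nlinarith [mul_pos ht0 hω']
  have haA : ∀ v ∈ A, a v = β / α := by
    intro v hv
    have := hzero (fun v => a v - β / α) (by
      intro i
      rw [Finset.sum_sub_distrib, hSi, Finset.sum_const, hSc, nsmul_eq_mul]
      field_simp; ring) v hv
    linarith
  have hap : ∑ v, a v * p v = β / α * (α + 1 / ω) := by
    rw [← hpA, Finset.mul_sum, hp]
    rw [← Finset.sum_subset (Finset.subset_univ A)]
    · exact Finset.sum_congr rfl fun v hv => by rw [haA v hv]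
    · intro v _ hv; simp [hv]
  have hapβ : ∑ v, a v * p v = β + β / α * (1 / ω) := by
    rw [hap]; field_simp
  have hγ0 : 0 < β / α := by
    have h1 := hST p hpQ hpn
    rw [hapβ] at h1
    by_contra hneg
    push Not at hneg
    nlinarith
  have hβ0 : 0 < β := by
    have := mul_pos hγ0 hα0
    rwa [div_mul_cancel₀ _ hα0.ne'] at this
  have hsingle : ∀ w, IsStable G (({w} : Finset V) : Set V) := by
    intro w; simp [IsStable]
  -- every outside node is complete to A
  have hcomplete : ∀ u ∈ A, ∀ w, w ∉ A → G.Adj u w := by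
    intro u hu w hw
    by_contra hadj
    obtain ⟨R, hR, hRm⟩ := Finset.exists_max_image
      (A.powerset.filter (fun T : Finset V => IsStable G (T : Set V) ∧ ∀ v ∈ T, ¬ G.Adj w v)) Finset.card
      ⟨∅, by simp [IsStable]⟩
    simp only [Finset.mem_filter, Finset.mem_powerset, and_imp] at hR hRm
    obtain ⟨hRA, hRs, hRw⟩ := hR
    have hR1 : 1 ≤ R.card := by
      have := hRm {u} (by simpa using hu) (hsingle u) (by
        intro v hv
        rw [Finset.mem_singleton] at hv
        subst hv
        exact fun h => hadj h.symm)
      simpa using this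
    have hwR : w ∉ R := fun h => hw (hRA h)
    rcases (hmax R hRA hRs).lt_or_eq with hlt | heq
    · exact ls_core G A α ω ι S hα hω hι hAc hSA hSs hSc hmax hcount hsolve hsep w hw R hRA hRs hRw
        hR1 hlt hRm hls
    · have h1 := hindβ (insert w R) (by
        intro x hx y hy
        simp only [Finset.coe_insert, Set.mem_insert_iff, Finset.mem_coe] at hx hy
        rcases hx with rfl | hx <;> rcases hy with rfl | hy
        · exact G.irrefl
        · exact hRw y hy
        · exact fun h => hRw x hx h.symm
        · exact hRs x hx y hy)
      rw [Finset.sum_insert hwR, Finset.sum_congr rfl (fun v hv => haA v (hRA hv)), Finset.sum_const,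
        heq, nsmul_eq_mul, mul_div_cancel₀ _ hα0.ne'] at h1
      have haw : a w < 0 := lt_of_le_of_ne (by linarith) (ha w)
      obtain ⟨c, hc⟩ : ∃ c : ℝ, c = β / α * (1 / ω) := ⟨_, rfl⟩
      have hc0 : 0 < c := by rw [hc]; positivity
      have hden : 0 < β + c - a w := by linarith
      obtain ⟨t, ht⟩ : ∃ t : ℝ, t = c / (β + c - a w) := ⟨_, rfl⟩
      have ht0 : 0 < t := by rw [ht]; positivity
      have ht1 : t ≤ 1 := by rw [ht, div_le_one hden]; linarith
      have hte : (1 - t) * (β + c) + t * a w = β := by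
        rw [ht]; field_simp; ring
      have hmem : (fun v => (1 - t) * p v + t * (if v ∈ ({w} : Finset V) then (1 : ℝ) else 0)) ∈ STAB G := by
        by_contra hn
        have := hST _ (qstab_seg G p _ t ht0.le ht1 hpQ (hSQ _ (ind_mem G {w} (hsingle w)))) hn
        rw [hlin, hindsum, hapβ, ← hc, Finset.sum_singleton, hte] at this
        exact lt_irrefl _ this
      have h3 := hvalA _ hmem
      rw [hlinA, hpA] at h3
      have h4 : ∑ v ∈ A, (if v ∈ ({w} : Finset V) then (1 : ℝ) else 0) = 0 := by
        refine Finset.sum_eq_zero fun v hv => ?_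
        rw [if_neg]; rw [Finset.mem_singleton]; rintro rfl; exact hw hv
      rw [h4, mul_zero, add_zero] at h3
      have h5 : β / α * ((1 - t) * (α + 1 / ω)) = (1 - t) * (β + c) := by
        rw [hc]; field_simp
      have h6 := mul_le_mul_of_nonneg_left h3 hγ0.le
      rw [h5, div_mul_cancel₀ _ hα0.ne'] at h6
      nlinarith [mul_pos ht0 (neg_pos.2 haw)]
  refine ⟨?_, hcomplete⟩
  have haw : ∀ w, w ∉ A → β ≤ a w := by
    intro w hw
    have hs : a w = ∑ v, a v * (if v ∈ ({w} : Finset V) then (1 : ℝ) else 0) := by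
      rw [hindsum, Finset.sum_singleton]
    rw [hs]
    apply lim_aux (∑ v, a v * p v)
    intro t ht0 ht1
    rw [← hlin]
    apply hST _ (qstab_seg G _ p t ht0.le ht1 (hSQ _ (ind_mem G _ (hsingle w))) hpQ)
    intro hmem
    have hv := stab_valid G (fun v => (if v ∈ A then (1 : ℝ) else 0) + α * (if v = w then 1 else 0)) α (by
      intro Q hQ
      rw [Finset.sum_add_distrib, ← Finset.mul_sum, Finset.sum_ite_eq', Finset.sum_boole,
        Finset.filter_mem_eq_inter]
      by_cases hwQ : w ∈ Q
      · have : Q ∩ A = ∅ := by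
          rw [Finset.eq_empty_iff_forall_notMem]
          intro v hv
          rw [Finset.mem_inter] at hv
          exact hQ v hv.1 w hwQ (hcomplete v hv.2 w hw)
        simp [this, hwQ]
      · have := hmax (Q ∩ A) Finset.inter_subset_right (by
          intro u hu v hv
          simp only [Finset.coe_inter, Set.mem_inter_iff, Finset.mem_coe] at hu hv
          exact hQ u hu.1 v hv.1)
        rw [if_neg hwQ, mul_zero, add_zero]
        exact_mod_cast this) _ hmem
    have hpw : p w = 0 := by simp [hp, hw]
    have e1 : ∑ v, ((if v ∈ A then (1 : ℝ) else 0) + α * (if v = w then 1 else 0)) *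
        ((1 - t) * (if v ∈ ({w} : Finset V) then (1 : ℝ) else 0) + t * p v) =
        α * (1 - t) + t * ∑ v ∈ A, p v := by
      have e2 : ∀ v ∈ Finset.univ, ((if v ∈ A then (1 : ℝ) else 0) + α * (if v = w then 1 else 0)) *
        ((1 - t) * (if v ∈ ({w} : Finset V) then (1 : ℝ) else 0) + t * p v) =
        (if v = w then α * (1 - t) else 0) + (if v ∈ A then t * p v else 0) := by
        intro v _
        by_cases hvw : v = w
        · subst hvw; simp [hw, hpw]
        · simp [hvw]
      rw [Finset.sum_congr rfl e2, Finset.sum_add_distrib, Finset.sum_ite_eq', Finset.mul_sum]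
      simp [← Finset.sum_filter]
    rw [e1, hpA] at hv
    nlinarith [mul_pos ht0 hω']
  intro u hu w hw huw
  by_contra hadj
  have h1 := hindβ {u, w} (by
    intro x hx y hy
    simp only [Finset.coe_insert, Finset.coe_singleton, Set.mem_insert_iff, Set.mem_singleton_iff] at hx hy
    rcases hx with rfl | rfl <;> rcases hy with rfl | rfl
    · exact G.irrefl
    · exact hadj
    · exact fun h => hadj h.symm
    · exact G.irrefl)
  rw [Finset.sum_pair huw] at h1
  have := haw u hu
  have := haw w hw
  linarith

end Fs

/-- A properly fs-perfect graph (fs-perfect and imperfect) which is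
`LS₊`-perfect is the complete join of a (possibly empty) complete graph and a
minimally imperfect graph: there is a set `A` of nodes inducing a minimally
imperfect graph whose complement induces a complete graph, with all edges in
between present. -/
theorem stmt18 {V : Type} [Fintype V] [DecidableEq V] (G : SimpleGraph V)
    (hfs : FsPerfect G) (himp : ¬ PerfectG G)
    (hls : LSplus (FRAC G) = STAB G) :
    ∃ A : Set V, MinImperfect (G.induce A) ∧
      (∀ u ∈ Aᶜ, ∀ w ∈ Aᶜ, u ≠ w → G.Adj u w) ∧
      (∀ u ∈ A, ∀ w ∈ Aᶜ, G.Adj u w) := by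
  obtain ⟨A, hA, hmin⟩ := Fs.exists_min G himp
  obtain ⟨h1, h2⟩ := Fs.main_aux G hfs hls A hA hmin
  refine ⟨(A : Set V), Fs.minImperfect_of G _ hA hmin, ?_, ?_⟩
  · intro u hu w hw huw
    exact h1 u (by simpa using hu) w (by simpa using hw) huw
  · intro u hu w hw
    exact h2 u (by simpa using hu) w (by simpa using hw)
end
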